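/- arXiv:1407.0514 — 8 statements merged into one kernel-verified Lean document; each statement's English description precedes it below -/
import Mathlib

section
/- Let (r_0, r_1, ..., r_h) be a characteristic sequence with n = r_0 and d_k = gcd(r_0, ..., r_{k−1}) for 1 ≤ k ≤ h+1, and assume that d_h r_h < n². Then n²/d_k − d_{k+1} − r_k ≥ 0 for every 1 ≤ k ≤ h. -/
/-- If `d` and `e` divide `n`, `e` divides `a`, and `d * a < n ^ 2`, then `a` is at least `e`
below `n ^ 2 / d`, since both are multiples of `e`. -/
theorem add_le_sq_div_of_dvd {n d e a : ℕ} (hd0 : 0 < d) (hd : d ∣ n) (hen : e ∣ n) (hea : e ∣ a)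
    (hlt : d * a < n ^ 2) : e + a ≤ n ^ 2 / d := by
  obtain ⟨m, rfl⟩ := hd
  have hq : (d * m) ^ 2 / d = d * m * m := by
    rw [show (d * m) ^ 2 = d * (d * m * m) by ring, Nat.mul_div_cancel_left _ hd0]
  have ha : a < d * m * m := by
    refine lt_of_mul_lt_mul_left (a := d) ?_ d.zero_le
    linarith
  have hle : e ≤ d * m * m - a :=
    Nat.le_of_dvd (by omega) (Nat.dvd_sub (hen.mul_right m) hea)
  omega

/-- For a characteristic sequence `(r 0, ..., r h)` with `n = r 0`
and `d k = gcd (r 0, ..., r (k-1))`, if `d h * r h < n ^ 2` then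
`n ^ 2 / d k - d (k + 1) - r k ≥ 0` for every `1 ≤ k ≤ h`
(as integers; the division is exact since `d k ∣ n`). -/
theorem stmt_2 (h : ℕ) (r : ℕ → ℕ)
    (hpos : ∀ k, k ≤ h → 0 < r k)
    -- axiom (1)
    (hdlt : ∀ k, 1 ≤ k → k ≤ h →
      Finset.gcd (Finset.range (k + 1)) r < Finset.gcd (Finset.range k) r)
    (hdlast : Finset.gcd (Finset.range (h + 1)) r = 1)
    -- axiom (2)
    (hdr : ∀ k, 1 ≤ k → k < h →
      Finset.gcd (Finset.range k) r * r k <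
        Finset.gcd (Finset.range (k + 1)) r * r (k + 1))
    -- hypothesis: d_h r_h < n²
    (hAM : Finset.gcd (Finset.range h) r * r h < r 0 ^ 2) :
    ∀ k, 1 ≤ k → k ≤ h →
      0 ≤ (r 0 : ℤ) ^ 2 / ((Finset.gcd (Finset.range k) r : ℕ) : ℤ)
            - ((Finset.gcd (Finset.range (k + 1)) r : ℕ) : ℤ) - (r k : ℤ) := by
  have hlt : ∀ k, k ≤ h → 1 ≤ k → Finset.gcd (Finset.range k) r * r k < r 0 ^ 2 := by
    intro k hk
    induction hk using Nat.decreasingInduction with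
    | self => exact fun _ => hAM
    | of_succ k hk ih => exact fun h1 => (hdr k h1 hk).trans (ih (by omega))
  intro k h1 hk
  have hd : Finset.gcd (Finset.range k) r ∣ r 0 :=
    Finset.gcd_dvd (Finset.mem_range.2 h1)
  have he0 : Finset.gcd (Finset.range (k + 1)) r ∣ r 0 :=
    Finset.gcd_dvd (Finset.mem_range.2 k.succ_pos)
  have hek : Finset.gcd (Finset.range (k + 1)) r ∣ r k :=
    Finset.gcd_dvd (Finset.mem_range.2 k.lt_succ_self)
  have := hlt k hk h1
  have := hdlt k h1 hk
  generalize Finset.gcd (Finset.range k) r = d at *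
  generalize Finset.gcd (Finset.range (k + 1)) r = e at *
  have := add_le_sq_div_of_dvd (by omega) hd he0 hek ‹d * r k < r 0 ^ 2›
  have : (e : ℤ) + r k ≤ (r 0 : ℤ) ^ 2 / d := by exact_mod_cast this
  omega
end

section
/- Let h ≥ 1 and let d_1 > d_2 > ... > d_{h+1} = 1 be positive integers such that d_{k+1} divides d_k for 1 ≤ k ≤ h. Define r_0 = d_1 and r_k = d_1²/d_k − d_{k+1} for 1 ≤ k ≤ h. Then gcd(r_0, r_1, ..., r_{k−1}) = d_k for every 1 ≤ k ≤ h+1. -/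
/-- If `b ∣ a ∣ c` with `c` positive, then `gcd (c ^ 2 / a - b, a) = b`. -/
theorem Nat.gcd_sq_div_sub_of_dvd {a b c : ℕ} (hc : 0 < c) (hac : a ∣ c) (hba : b ∣ a) :
    Nat.gcd (c ^ 2 / a - b) a = b := by
  obtain ⟨m, rfl⟩ := hac
  have ha : 0 < a := Nat.pos_of_mul_pos_right hc
  have hm : 0 < m := Nat.pos_of_mul_pos_left hc
  have hdiv : (a * m) ^ 2 / a = a * m ^ 2 := by
    rw [show (a * m) ^ 2 = a * (a * m ^ 2) by ring, Nat.mul_div_cancel_left _ ha]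
  have hle : b ≤ a * m ^ 2 := 
    (Nat.le_of_dvd ha hba).trans (Nat.le_mul_of_pos_right _ (by positivity))
  rw [hdiv]
  apply Nat.dvd_antisymm
  · have hsub := Nat.gcd_dvd_left (a * m ^ 2 - b) a
    exact (Nat.dvd_sub_iff_right hle ((Nat.gcd_dvd_right _ a).mul_right _)).1 hsub
  · exact Nat.dvd_gcd (Nat.dvd_sub (hba.mul_right _) dvd_rfl) hba

/-- For a divisor chain `d 1 > d 2 > ... > d (h+1) = 1` and
`r 0 = d 1`, `r k = d 1 ^ 2 / d k - d (k + 1)` for `1 ≤ k ≤ h`, one has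
`gcd (r 0, r 1, ..., r (k-1)) = d k` for every `1 ≤ k ≤ h + 1`. -/
theorem stmt_4 (h : ℕ) (hh : 1 ≤ h) (d r : ℕ → ℕ)
    (hdpos : ∀ k, 1 ≤ k → k ≤ h + 1 → 0 < d k)
    (hdlast : d (h + 1) = 1)
    (hdlt : ∀ k, 1 ≤ k → k ≤ h → d (k + 1) < d k)
    (hdvd : ∀ k, 1 ≤ k → k ≤ h → d (k + 1) ∣ d k)
    (hr0 : r 0 = d 1)
    (hrk : ∀ k, 1 ≤ k → k ≤ h → r k = d 1 ^ 2 / d k - d (k + 1)) :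
    ∀ k, 1 ≤ k → k ≤ h + 1 → Finset.gcd (Finset.range k) r = d k := by
  have hd1 : ∀ k, 1 ≤ k → k ≤ h + 1 → d k ∣ d 1 := by
    intro k hk
    induction k, hk using Nat.le_induction with
    | base => exact fun _ => dvd_rfl
    | succ k hk ih => exact fun hkh => (hdvd k hk (by omega)).trans (ih (by omega))
  intro k hk
  induction k, hk using Nat.le_induction with
  | base => simp [hr0]
  | succ k hk ih =>
    intro hkh
    rw [Finset.range_add_one, Finset.gcd_insert, ih (by omega), hrk k hk (by omega)]
    exact Nat.gcd_sq_div_sub_of_dvd (hdpos 1 le_rfl (by omega)) (hd1 k hk (by omega))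
      (hdvd k hk (by omega))
end

section
/- (Van der Kulk) Let K be an algebraically closed field and let (f, g) be a polynomial automorphism of K². Then either deg f divides deg g or deg g divides deg f. -/
open MvPolynomial

namespace VanDerKulk

open scoped WithZero

section Valuation

variable {K L : Type*} [Field K] [Field L] [Algebra K L]

/-- The additive order attached to an integer-valued multiplicative valuation. -/
noncomputable def ord (v : Valuation L ℤᵐ⁰) (z : L) : ℤ := -WithZero.log (v z)

variable (v : Valuation L ℤᵐ⁰)

lemma ord_mul {a b : L} (ha : a ≠ 0) (hb : b ≠ 0) : ord v (a * b) = ord v a + ord v b := by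
  rw [ord, map_mul, WithZero.log_mul (v.ne_zero_iff.2 ha) (v.ne_zero_iff.2 hb), ord, ord]
  ring

lemma ord_inv (a : L) : ord v a⁻¹ = -ord v a := by
  rw [ord, map_inv₀, WithZero.log_inv, ord]

lemma ord_div {a b : L} (ha : a ≠ 0) (hb : b ≠ 0) : ord v (a / b) = ord v a - ord v b := by
  rw [div_eq_mul_inv, ord_mul v ha (inv_ne_zero hb), ord_inv, sub_eq_add_neg]

lemma ord_pow (a : L) (n : ℕ) : ord v (a ^ n) = n * ord v a := by
  rw [ord, map_pow, WithZero.log_pow, ord]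
  simp

lemma ord_neg (a : L) : ord v (-a) = ord v a := by
  rw [ord, Valuation.map_neg, ord]

lemma ord_pos_iff {a : L} (ha : a ≠ 0) : 0 < ord v a ↔ v a < 1 := by
  rw [ord, Left.neg_pos_iff, WithZero.log_lt_iff_lt_exp (v.ne_zero_iff.2 ha), WithZero.exp_zero]

lemma ord_eq_zero_iff {a : L} (ha : a ≠ 0) : ord v a = 0 ↔ v a = 1 := by
  have h := v.ne_zero_iff.2 ha
  constructor
  · intro h0
    have : WithZero.log (v a) = 0 := by simpa [ord] using h0
    rw [← WithZero.exp_log h, this, WithZero.exp_zero]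
  · intro h1
    simp [ord, h1]

variable {v}

/-- If `θ` is not congruent to a constant, no nonzero polynomial vanishes on its residue. -/
lemma valuation_aeval_eq_one [IsAlgClosed K] {θ : L}
    (hv : ∀ c : K, c ≠ 0 → v (algebraMap K L c) = 1)
    (hθ : ∀ c : K, v (θ - algebraMap K L c) = 1) {Q : Polynomial K} (hQ : Q ≠ 0) :
    v (Polynomial.aeval θ Q) = 1 := by
  rw [(IsAlgClosed.splits Q).eq_prod_roots, map_mul, map_mul, Polynomial.aeval_C,
    hv _ (Polynomial.leadingCoeff_ne_zero.2 hQ), one_mul, map_multiset_prod, map_multiset_prod,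
    Multiset.map_map, Multiset.map_map]
  apply Multiset.prod_eq_one
  simp only [Multiset.mem_map]
  rintro _ ⟨c, -, rfl⟩
  simpa using hθ c

lemma valuation_aeval_sub_lt_one {ξ η : L}
    (hv : ∀ c : K, v (algebraMap K L c) ≤ 1) (hξ : v ξ < 1) (hη : v η ≤ 1)
    (G : MvPolynomial (Fin 2) K) :
    v (aeval ![ξ, η] G) ≤ 1 ∧
      v (aeval ![ξ, η] G - Polynomial.aeval η (aeval ![0, (Polynomial.X : Polynomial K)] G)) < 1 := by
  induction G using MvPolynomial.induction_on with
  | C c => simpa [algebraMap_eq] using hv c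
  | add p q hp hq =>
    simp only [map_add]
    refine ⟨v.map_add_le hp.1 hq.1, ?_⟩
    rw [add_sub_add_comm]
    exact v.map_add_lt hp.2 hq.2
  | mul_X p i hp =>
    fin_cases i
    · simp only [map_mul, aeval_X, Fin.zero_eta, Matrix.cons_val_zero, mul_zero, map_zero, sub_zero]
      exact ⟨mul_le_one' hp.1 hξ.le, (mul_le_of_le_one_left' hp.1).trans_lt hξ⟩
    · simp only [map_mul, aeval_X, Fin.mk_one, Matrix.cons_val_one, Matrix.cons_val_fin_one,
        Polynomial.aeval_X,
        ← sub_mul]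
      exact ⟨mul_le_one' hp.1 hη, (mul_le_of_le_one_right' hη).trans_lt hp.2⟩

end Valuation

section Bracket

variable {K L : Type*} [Field K] [Field L] [Algebra K L]

/-- The Jacobian bracket of two derivations. -/
def bracket (D₁ D₂ : Derivation K L L) (a b : L) : L := D₁ a * D₂ b - D₂ a * D₁ b

lemma derivation_pow_div_pow (D : Derivation K L L) {X Y : L} (hX : X ≠ 0) (hY : Y ≠ 0)
    (i j : ℕ) :
    D (Y ^ j / X ^ i) * (X * Y) = Y ^ j / X ^ i * (j * X * D Y - i * Y * D X) := by
  have hpow : ∀ (Z : L) (n : ℕ), Z ≠ 0 → D (Z ^ n) = n * Z ^ n * D Z / Z := by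
    intro Z n hZ
    cases n with
    | zero => simp
    | succ n =>
      rw [Derivation.leibniz_pow]
      simp only [nsmul_eq_mul, smul_eq_mul, Nat.add_sub_cancel]
      field_simp
      ring
  rw [Derivation.leibniz_div, hpow X i hX, hpow Y j hY]
  simp only [smul_eq_mul]
  field_simp

lemma bracket_monomial (D₁ D₂ : Derivation K L L) {X Y : L} (hX : X ≠ 0) (hY : Y ≠ 0)
    {a b i j : ℕ} (h : b * j = a * i + 1) :
    bracket D₁ D₂ (Y ^ j / X ^ i) (X ^ b / Y ^ a) * (X * Y) =
      -(bracket D₁ D₂ X Y * (Y ^ j / X ^ i * (X ^ b / Y ^ a))) := by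
  have hXY : X * Y ≠ 0 := mul_ne_zero hX hY
  apply mul_right_cancel₀ hXY
  have h' : (b : L) * j = a * i + 1 := mod_cast congrArg (Nat.cast : ℕ → L) h
  have e1 := derivation_pow_div_pow D₁ hX hY i j
  have e2 := derivation_pow_div_pow D₂ hX hY i j
  have e3 := derivation_pow_div_pow D₁ hY hX a b
  have e4 := derivation_pow_div_pow D₂ hY hX a b
  rw [mul_comm Y X] at e3 e4
  generalize Y ^ j / X ^ i = ρ at *
  generalize X ^ b / Y ^ a = θ at *
  calc _ = (D₁ ρ * (X * Y)) * (D₂ θ * (X * Y)) - (D₂ ρ * (X * Y)) * (D₁ θ * (X * Y)) := by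
        rw [bracket]; ring
    _ = ρ * θ * (X * Y) * (D₁ X * D₂ Y - D₂ X * D₁ Y) * (a * i - b * j) := by
        rw [e1, e2, e3, e4]; ring
    _ = _ := by rw [h', bracket]; ring

lemma bracket_sub_algebraMap (D₁ D₂ : Derivation K L L) (a b : L) (c : K) :
    bracket D₁ D₂ a (b - algebraMap K L c) = bracket D₁ D₂ a b := by
  simp [bracket]

lemma bracket_inv_left (D₁ D₂ : Derivation K L L) (a b : L) :
    bracket D₁ D₂ a⁻¹ b = -(a⁻¹ ^ 2 * bracket D₁ D₂ a b) := by
  simp only [bracket, Derivation.leibniz_inv, smul_eq_mul]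
  ring

lemma ord_add_le_ord_bracket {v : Valuation L ℤᵐ⁰} {D₁ D₂ : Derivation K L L}
    (h₁ : ∀ z, v (D₁ z) ≤ WithZero.exp (-1) * v z) (h₂ : ∀ z, v (D₂ z) ≤ WithZero.exp (-1) * v z)
    (x y : L) (hxy : bracket D₁ D₂ x y ≠ 0) :
    ord v x + ord v y + 2 ≤ ord v (bracket D₁ D₂ x y) := by
  have hx : x ≠ 0 := by
    rintro rfl
    simp [bracket] at hxy
  have hy : y ≠ 0 := by
    rintro rfl
    simp [bracket] at hxy
  have h : v (bracket D₁ D₂ x y) ≤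
      (WithZero.exp (-1) * v x) * (WithZero.exp (-1) * v y) := by
    refine v.map_sub_le ?_ ?_ <;> rw [map_mul]
    · exact mul_le_mul' (h₁ x) (h₂ y)
    · exact mul_le_mul' (h₂ x) (h₁ y)
  have hx' := v.ne_zero_iff.2 hx
  have hy' := v.ne_zero_iff.2 hy
  have he : (WithZero.exp (-1 : ℤ) : ℤᵐ⁰) ≠ 0 := WithZero.exp_ne_zero
  have h' := WithZero.log_le_log (v.ne_zero_iff.2 hxy) (by positivity) |>.2 h
  rw [WithZero.log_mul (mul_ne_zero he hx') (mul_ne_zero he hy'), WithZero.log_mul he hx',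
    WithZero.log_mul he hy', WithZero.log_exp] at h'
  simp only [ord]
  linarith

end Bracket

section Step

variable {K L : Type*} [Field K] [Field L] [Algebra K L]

lemma rootMultiplicity_add_natTrailingDegree_le {c : K} (hc : c ≠ 0) {Q : Polynomial K}
    (hQ : Q ≠ 0) : Q.rootMultiplicity c + Q.natTrailingDegree ≤ Q.natDegree := by
  obtain ⟨R, hR⟩ : Polynomial.X ^ Q.natTrailingDegree ∣ Q :=
    Polynomial.X_pow_dvd_iff.2 fun d hd => Polynomial.coeff_eq_zero_of_lt_natTrailingDegree hd
  have hco : IsCoprime ((Polynomial.X - Polynomial.C c) ^ Q.rootMultiplicity c)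
      ((Polynomial.X : Polynomial K) ^ Q.natTrailingDegree) := by
    apply IsCoprime.pow
    simpa using Polynomial.isCoprime_X_sub_C_of_isUnit_sub (R := K) (a := c) (b := 0)
      (by simpa using hc)
  have hdvd : (Polynomial.X - Polynomial.C c) ^ Q.rootMultiplicity c ∣ R := by
    apply hco.dvd_of_dvd_mul_left
    rw [← hR]
    exact Polynomial.pow_rootMultiplicity_dvd Q c
  have hR0 : R ≠ 0 := by
    rintro rfl
    exact hQ (by simpa using hR)
  have h1 := Polynomial.natDegree_le_of_dvd hdvd hR0
  have h2 := congrArg Polynomial.natDegree hR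
  rw [Polynomial.natDegree_mul (pow_ne_zero _ Polynomial.X_ne_zero) hR0,
    Polynomial.natDegree_X_pow] at h2
  simp only [Polynomial.natDegree_pow, Polynomial.natDegree_X_sub_C, mul_one] at h1
  omega

lemma aeval_pair (F : MvPolynomial (Fin 2) K) {A : Type*} [CommRing A] [Algebra K A] (x y : A) :
    aeval ![x, y] F = ∑ d ∈ F.support, algebraMap K A (F.coeff d) * (x ^ d 0 * y ^ d 1) := by
  rw [aeval_def, eval₂_eq']
  simp

lemma coeff_aeval_zero_X (F : MvPolynomial (Fin 2) K) (n : ℕ) :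
    (aeval ![0, (Polynomial.X : Polynomial K)] F).coeff n = F.coeff (Finsupp.single 1 n) := by
  rw [aeval_pair, Polynomial.finsetSum_coeff]
  simp only [Polynomial.algebraMap_eq, Polynomial.coeff_C_mul]
  rw [Finset.sum_eq_single (Finsupp.single 1 n)]
  · simp
  · intro d _ hd
    by_cases h0 : d 0 = 0
    · have h1 : n ≠ d 1 := by
        rintro rfl
        apply hd
        ext i
        fin_cases i <;> simp [h0]
      simp [h0, Polynomial.coeff_X_pow, h1]
    · simp [h0]
  · intro h
    simp [notMem_support_iff.1 h]

/-- Translation by `c` in the second variable. -/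
noncomputable def translate (c : K) : MvPolynomial (Fin 2) K →ₐ[K] MvPolynomial (Fin 2) K :=
  aeval ![X 0, X 1 + C c]

lemma aeval_translate_pair {A : Type*} [CommRing A] [Algebra K A] (c : K) (x y : A)
    (G : MvPolynomial (Fin 2) K) :
    aeval ![x, y - algebraMap K A c] (translate c G) = aeval ![x, y] G := by
  suffices h : (aeval ![x, y - algebraMap K A c]).comp (translate c) = aeval ![x, y] from
    DFunLike.congr_fun h G
  ext k
  fin_cases k <;> simp [translate]

lemma aeval_translate (c : K) (G : MvPolynomial (Fin 2) K) :
    aeval ![0, (Polynomial.X : Polynomial K)] (translate c G) =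
      (aeval ![0, (Polynomial.X : Polynomial K)] G).comp (Polynomial.X + Polynomial.C c) := by
  suffices h : (aeval ![0, (Polynomial.X : Polynomial K)]).comp (translate c) =
      (Polynomial.aeval (Polynomial.X + Polynomial.C c)).comp
        (aeval ![0, (Polynomial.X : Polynomial K)]) from DFunLike.congr_fun h G
  ext k
  fin_cases k <;> simp [translate]

/-- Substituting `x = u ^ a * t ^ j`, `y = u ^ b * t ^ i` into `F` and removing the factor `u ^ w`:
the exponent of `u` is replaced by its distance to `w`. -/
noncomputable def toricTransform (a b i j w : ℕ) (F : MvPolynomial (Fin 2) K) :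
    MvPolynomial (Fin 2) K :=
  ∑ d ∈ F.support, C (F.coeff d) *
    (X 0 ^ (((a * d 0 + b * d 1 : ℕ) : ℤ) - w).natAbs * X 1 ^ (j * d 0 + i * d 1))

lemma aeval_toricTransform {A : Type*} [CommRing A] [Algebra K A] (a b i j w : ℕ)
    (F : MvPolynomial (Fin 2) K) (x y : A) :
    aeval ![x, y] (toricTransform a b i j w F) = ∑ d ∈ F.support, algebraMap K A (F.coeff d) *
      (x ^ (((a * d 0 + b * d 1 : ℕ) : ℤ) - w).natAbs * y ^ (j * d 0 + i * d 1)) := by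
  simp [toricTransform]

/-- The polynomial of the edge of weight `w`. -/
noncomputable def edgePoly (a b i j w : ℕ) (F : MvPolynomial (Fin 2) K) : Polynomial K :=
  aeval ![0, (Polynomial.X : Polynomial K)] (toricTransform a b i j w F)

lemma edgePoly_coeff (a b i j w : ℕ) (F : MvPolynomial (Fin 2) K) (n : ℕ) :
    (edgePoly a b i j w F).coeff n = ∑ d ∈ F.support,
      if a * d 0 + b * d 1 = w ∧ j * d 0 + i * d 1 = n then F.coeff d else 0 := by
  rw [edgePoly, aeval_toricTransform, Polynomial.finsetSum_coeff]
  refine Finset.sum_congr rfl fun d _ => ?_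
  simp only [Polynomial.algebraMap_eq, Polynomial.coeff_C_mul]
  by_cases h : a * d 0 + b * d 1 = w
  · simp [h, Polynomial.coeff_X_pow, eq_comm]
  · have : (((a * d 0 + b * d 1 : ℕ) : ℤ) - w).natAbs ≠ 0 := by omega
    rw [zero_pow this]
    simp [h]

lemma edge_exponent {a b i j : ℕ} (h : b * j = a * i + 1) {d d' : Fin 2 →₀ ℕ}
    (hd : a * d 0 + b * d 1 = a * d' 0 + b * d' 1) :
    ((a * b : ℕ) : ℤ) * ((j * d 0 + i * d 1 : ℕ) - (j * d' 0 + i * d' 1 : ℕ) : ℤ) =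
      a * (d 0 - d' 0) := by
  zify at h hd
  push_cast
  linear_combination (a * (d 0 - d' 0) : ℤ) * h + (a * i : ℤ) * hd

lemma edgePoly_ne_zero {a b i j w : ℕ} (ha : 0 < a) (hb : 0 < b) (h : b * j = a * i + 1)
    {F : MvPolynomial (Fin 2) K} {d : Fin 2 →₀ ℕ} (hd : d ∈ F.support)
    (hdw : a * d 0 + b * d 1 = w) : edgePoly a b i j w F ≠ 0 := by
  intro h0
  have h1 := edgePoly_coeff a b i j w F (j * d 0 + i * d 1)
  rw [h0, Polynomial.coeff_zero, Finset.sum_eq_single d] at h1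
  · rw [if_pos ⟨hdw, rfl⟩] at h1
    exact mem_support_iff.1 hd h1.symm
  · intro d' _ hne
    rw [if_neg]
    rintro ⟨hw', he⟩
    have h2 := edge_exponent h (hw'.trans hdw.symm)
    rw [he, sub_self, mul_zero] at h2
    have h3 : d' 0 = d 0 := by
      rcases mul_eq_zero.1 h2.symm with h | h <;> omega
    have h4 : d' 1 = d 1 := by
      rw [h3] at hw'
      exact Nat.eq_of_mul_eq_mul_left hb (by omega)
    apply hne
    ext k
    fin_cases k
    · exact h3
    · exact h4
  · intro h
    exact absurd hd h

lemma rootMultiplicity_edgePoly_mul_le {a b i j w : ℕ} (h : b * j = a * i + 1)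
    {F : MvPolynomial (Fin 2) K} {c : K} (hc : c ≠ 0) (hQ : edgePoly a b i j w F ≠ 0) :
    (edgePoly a b i j w F).rootMultiplicity c * (a * b) ≤ w := by
  have hsupp : ∀ n ∈ (edgePoly a b i j w F).support,
      ∃ d : Fin 2 →₀ ℕ, a * d 0 + b * d 1 = w ∧ j * d 0 + i * d 1 = n := by
    intro n hn
    rw [Polynomial.mem_support_iff, edgePoly_coeff] at hn
    obtain ⟨d, -, hd⟩ := Finset.exists_ne_zero_of_sum_ne_zero hn
    exact ⟨d, by by_contra hcon; exact hd (if_neg hcon)⟩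
  obtain ⟨d, hd, hde⟩ := hsupp _ (Polynomial.natDegree_mem_support_of_nonzero hQ)
  obtain ⟨d', hd', hde'⟩ := hsupp _ (Polynomial.natTrailingDegree_mem_support_of_nonzero hQ)
  have h1 := rootMultiplicity_add_natTrailingDegree_le hc hQ
  have h2 := edge_exponent h (hd.trans hd'.symm)
  rw [hde, hde'] at h2
  zify at h1 hd ⊢
  push_cast at h2
  have h3 := mul_le_mul_of_nonneg_left h1 (by positivity : (0 : ℤ) ≤ a * b)
  linarith [mul_nonneg (Int.natCast_nonneg a) (Int.natCast_nonneg (d' 0)),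
    mul_nonneg (Int.natCast_nonneg b) (Int.natCast_nonneg (d 1))]

lemma toric_monomials {A B : L} (hA : A ≠ 0) (hB : B ≠ 0) {a b i j : ℕ} (h : b * j = a * i + 1) :
    (B ^ j / A ^ i) ^ a * (A ^ b / B ^ a) ^ j = A ∧
      (B ^ j / A ^ i) ^ b * (A ^ b / B ^ a) ^ i = B := by
  have hA' : A ^ (b * j) = A ^ (a * i) * A := by rw [h, pow_succ]
  have hB' : B ^ (b * j) = B ^ (a * i) * B := by rw [h, pow_succ]
  constructor
  · simp only [div_pow, ← pow_mul]
    rw [mul_comm j a, mul_comm i a, hA']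
    field_simp
  · simp only [div_pow, ← pow_mul]
    rw [mul_comm j b, mul_comm i b, hB']
    field_simp

/-- In the coordinates `ρ = B ^ j / A ^ i` and `θ = A ^ b / B ^ a`, either the edge of weight `w`
determines the order of `F (A, B)`, or `θ` is congruent to a root `c` of its polynomial and
`(ξ, θ - c)` is a new pair of local parameters. -/
lemma toric_step [IsAlgClosed K] (v : Valuation L ℤᵐ⁰) (D₁ D₂ : Derivation K L L)
    (hv : ∀ c : K, c ≠ 0 → v (algebraMap K L c) = 1) {A B : L} (hA : A ≠ 0) (hB : B ≠ 0)
    (hAB : bracket D₁ D₂ A B ≠ 0) {a b i j : ℕ} (ha : 0 < a) (hb : 0 < b)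
    (h : b * j = a * i + 1) (hord : b * ord v A = a * ord v B)
    (F : MvPolynomial (Fin 2) K) (w : ℕ) {ρ ξ : L} (hρ : ρ = B ^ j / A ^ i)
    (hξρ : ξ = ρ ∨ ξ = ρ⁻¹) (hξ : 0 < ord v ξ) {d₀ : Fin 2 →₀ ℕ} (hd₀ : d₀ ∈ F.support)
    (hd₀w : a * d₀ 0 + b * d₀ 1 = w)
    (hF : ∀ d ∈ F.support, ρ ^ (a * d 0 + b * d 1) =
      ρ ^ w * ξ ^ (((a * d 0 + b * d 1 : ℕ) : ℤ) - w).natAbs) :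
    (ord v (aeval ![A, B] F) = w * ord v ρ) ∨
    ∃ (η : L) (F' : MvPolynomial (Fin 2) K) (N : ℕ), 0 < ord v η ∧
      bracket D₁ D₂ ξ η ≠ 0 ∧
      ord v (bracket D₁ D₂ ξ η) - ord v ξ = ord v (bracket D₁ D₂ A B) - ord v A - ord v B ∧
      F'.coeff (Finsupp.single 1 N) ≠ 0 ∧ N * (a * b) ≤ w ∧
      aeval ![A, B] F = ρ ^ w * aeval ![ξ, η] F' := by
  set θ := A ^ b / B ^ a with hθdef
  have hρ0 : ρ ≠ 0 := by rw [hρ]; exact div_ne_zero (pow_ne_zero _ hB) (pow_ne_zero _ hA)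
  have hθ0 : θ ≠ 0 := div_ne_zero (pow_ne_zero _ hA) (pow_ne_zero _ hB)
  have hξ0 : ξ ≠ 0 := by
    rcases hξρ with rfl | rfl
    · exact hρ0
    · exact inv_ne_zero hρ0
  have hθord : ord v θ = 0 := by
    rw [hθdef, ord_div v (pow_ne_zero _ hA) (pow_ne_zero _ hB), ord_pow, ord_pow, hord, sub_self]
  have hvθ : v θ = 1 := (ord_eq_zero_iff v hθ0).1 hθord
  have hvξ : v ξ < 1 := (ord_pos_iff v hξ0).1 hξ
  obtain ⟨hmA, hmB⟩ := toric_monomials hA hB h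
  rw [← hρ, ← hθdef] at hmA hmB
  set G := toricTransform a b i j w F with hG
  set Q := edgePoly a b i j w F with hQdef
  have hQ : Q ≠ 0 := edgePoly_ne_zero ha hb h hd₀ hd₀w
  have hFG : aeval ![A, B] F = ρ ^ w * aeval ![ξ, θ] G := by
    rw [hG, aeval_toricTransform, aeval_pair, Finset.mul_sum]
    refine Finset.sum_congr rfl fun d hd => ?_
    have : A ^ d 0 * B ^ d 1 = ρ ^ (a * d 0 + b * d 1) * θ ^ (j * d 0 + i * d 1) := by
      conv_lhs => rw [← hmA, ← hmB]
      ring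
    rw [this, hF d hd]
    ring
  have hvle : ∀ c : K, v (algebraMap K L c) ≤ 1 := by
    intro c
    by_cases hc : c = 0
    · simp [hc]
    · exact (hv c hc).le
  by_cases hcase : ∀ c : K, v (θ - algebraMap K L c) = 1
  · left
    have h1 := valuation_aeval_eq_one hv hcase hQ
    have h2 := (valuation_aeval_sub_lt_one hvle hvξ hvθ.le G).2
    have h3 : v (aeval ![ξ, θ] G) = 1 := by
      rw [← h1, ← sub_add_cancel (aeval ![ξ, θ] G) (Polynomial.aeval θ Q)]
      apply Valuation.map_add_eq_of_lt_right
      rw [h1]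
      exact h2
    have h4 : aeval ![ξ, θ] G ≠ 0 := by
      rw [← v.ne_zero_iff, h3]
      exact one_ne_zero
    rw [hFG, ord_mul v (pow_ne_zero _ hρ0) h4, ord_pow, (ord_eq_zero_iff v h4).2 h3, add_zero]
  · right
    push Not at hcase
    obtain ⟨c, hc⟩ := hcase
    have hc0 : c ≠ 0 := by
      rintro rfl
      simp [hvθ] at hc
    have hb1 : bracket D₁ D₂ ρ θ * (A * B) = -(bracket D₁ D₂ A B * (ρ * θ)) := by
      rw [hρ, hθdef]
      exact bracket_monomial D₁ D₂ hA hB h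
    have hb2 : bracket D₁ D₂ ξ (θ - algebraMap K L c) * (A * B) = bracket D₁ D₂ A B * (ξ * θ) ∨
        bracket D₁ D₂ ξ (θ - algebraMap K L c) * (A * B) = -(bracket D₁ D₂ A B * (ξ * θ)) := by
      rw [bracket_sub_algebraMap]
      rcases hξρ with rfl | rfl
      · exact Or.inr hb1
      · left
        rw [bracket_inv_left]
        calc _ = -(ρ⁻¹ ^ 2) * (bracket D₁ D₂ ρ θ * (A * B)) := by ring
          _ = _ := by rw [hb1]; field_simp
    have hne : bracket D₁ D₂ A B * (ξ * θ) ≠ 0 := mul_ne_zero hAB (mul_ne_zero hξ0 hθ0)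
    have hb3 : bracket D₁ D₂ ξ (θ - algebraMap K L c) ≠ 0 := by
      intro h0
      rw [h0, zero_mul] at hb2
      rcases hb2 with hb2 | hb2
      · exact hne hb2.symm
      · exact hne (neg_eq_zero.1 hb2.symm)
    have hη0 : θ - algebraMap K L c ≠ 0 := by
      intro h0
      rw [h0] at hb3
      exact hb3 (by simp [bracket])
    refine ⟨θ - algebraMap K L c, translate c G, Q.rootMultiplicity c, ?_, hb3,
      ?_, ?_, rootMultiplicity_edgePoly_mul_le h hc0 hQ, ?_⟩
    · rw [ord_pos_iff v hη0]
      exact lt_of_le_of_ne (v.map_sub_le hvθ.le (hvle c)) hc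
    · have h1 : ord v (bracket D₁ D₂ ξ (θ - algebraMap K L c) * (A * B)) =
          ord v (bracket D₁ D₂ A B * (ξ * θ)) := by
        rcases hb2 with hb2 | hb2
        · rw [hb2]
        · rw [hb2, ord_neg]
      rw [ord_mul v hb3 (mul_ne_zero hA hB), ord_mul v hA hB,
        ord_mul v hAB (mul_ne_zero hξ0 hθ0), ord_mul v hξ0 hθ0, hθord] at h1
      linarith
    · rw [← coeff_aeval_zero_X, aeval_translate, Polynomial.rootMultiplicity_eq_natTrailingDegree]
      apply Polynomial.trailingCoeff_nonzero_iff_nonzero.2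
      exact (Polynomial.comp_X_add_C_ne_zero_iff).2 hQ
    · rw [hFG, aeval_translate_pair]

end Step

section Estimate

variable {K L : Type*} [Field K] [Field L] [Algebra K L]

lemma exists_mul_eq_mul_add_one {a b : ℕ} (ha : 0 < a) (hb : 0 < b) (hab : a.Coprime b) :
    ∃ i j : ℕ, b * j = a * i + 1 := by
  rcases Nat.lt_or_ge 1 a with h1 | h1
  · obtain ⟨j, -, hj⟩ := Nat.exists_mul_mod_eq_one_of_coprime hab.symm h1
    exact ⟨b * j / a, j, by rw [← hj]; exact (Nat.div_add_mod _ _).symm⟩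
  · obtain rfl : a = 1 := by omega
    exact ⟨b - 1, 1, by omega⟩

lemma ne_zero_of_ord_ne_zero {v : Valuation L ℤᵐ⁰} {z : L} (h : ord v z ≠ 0) : z ≠ 0 := by
  rintro rfl
  simp [ord] at h

lemma ord_pow_div_pow (v : Valuation L ℤᵐ⁰) {A B : L} (hA : A ≠ 0) (hB : B ≠ 0) {d : ℤ}
    {a b i j : ℕ} (h : b * j = a * i + 1) (hordA : ord v A = a * d) (hordB : ord v B = b * d) :
    ord v (B ^ j / A ^ i) = d := by
  rw [ord_div v (pow_ne_zero _ hB) (pow_ne_zero _ hA), ord_pow, ord_pow, hordA, hordB]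
  zify at h
  linear_combination d * h

/-- A polynomial of order `N` along the second axis cannot vanish too much at a point whose
coordinates have nonzero bracket. -/
theorem ord_aeval_le [IsAlgClosed K] (v : Valuation L ℤᵐ⁰) (D₁ D₂ : Derivation K L L)
    (hv : ∀ c : K, c ≠ 0 → v (algebraMap K L c) = 1)
    (hD : ∀ x y, bracket D₁ D₂ x y ≠ 0 → ord v x + ord v y + 2 ≤ ord v (bracket D₁ D₂ x y))
    (n : ℕ) : ∀ (ξ η : L) (F : MvPolynomial (Fin 2) K) (N : ℕ), 0 < ord v ξ → 0 < ord v η →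
      bracket D₁ D₂ ξ η ≠ 0 → ord v (bracket D₁ D₂ ξ η) = ord v ξ + ord v η + 2 + n →
      F.coeff (Finsupp.single 1 N) ≠ 0 → ord v (aeval ![ξ, η] F) ≤ N * (n + ord v η) := by
  induction n using Nat.strong_induction_on with
  | _ n ih =>
  intro ξ η F N hξ hη hbr hn hN
  by_cases hF0 : aeval ![ξ, η] F = 0
  · rw [hF0]
    simp only [ord, map_zero, WithZero.log_zero, neg_zero]
    positivity
  have hξ0 := ne_zero_of_ord_ne_zero hξ.ne'
  have hη0 := ne_zero_of_ord_ne_zero hη.ne'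
  obtain ⟨p, hp⟩ := Int.eq_ofNat_of_zero_le hξ.le
  obtain ⟨q, hq⟩ := Int.eq_ofNat_of_zero_le hη.le
  obtain ⟨a, b, hab, hpa, hqb⟩ := Nat.exists_coprime p q
  set d := p.gcd q
  rw [hp] at hξ
  have hp0 : 0 < p := by omega
  have hq0 : 0 < q := by omega
  have ha : 0 < a := Nat.pos_of_mul_pos_right (hpa ▸ hp0)
  have hb : 0 < b := Nat.pos_of_mul_pos_right (hqb ▸ hq0)
  have hd : 0 < d := Nat.pos_of_mul_pos_left (hpa ▸ hp0)
  obtain ⟨i, j, hij⟩ := exists_mul_eq_mul_add_one ha hb hab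
  have hordξ : ord v ξ = a * d := by rw [hp, hpa]; push_cast; ring
  have hordη : ord v η = b * d := by rw [hq, hqb]; push_cast; ring
  obtain ⟨e, he, hmin⟩ := Finset.exists_min_image F.support (fun e => a * e 0 + b * e 1)
    ⟨_, mem_support_iff.2 hN⟩
  have hwN : a * e 0 + b * e 1 ≤ b * N := by
    simpa using hmin _ (mem_support_iff.2 hN)
  have hρ : ord v (η ^ j / ξ ^ i) = d := ord_pow_div_pow v hξ0 hη0 hij hordξ hordη
  have hρ0 : η ^ j / ξ ^ i ≠ 0 := div_ne_zero (pow_ne_zero _ hη0) (pow_ne_zero _ hξ0)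
  set w := a * e 0 + b * e 1 with hw
  have hwN' : (w : ℤ) * d ≤ N * ord v η := by
    rw [hordη]
    zify at hwN
    nlinarith
  rcases toric_step v D₁ D₂ hv hξ0 hη0 hbr ha hb hij (by rw [hordξ, hordη]; ring) F w rfl
    (Or.inl rfl) (by rw [hρ]; exact_mod_cast hd) he hw.symm (by
      intro d' hd'
      rw [← pow_add]
      congr 1
      have := hmin d' hd'
      omega) with h1 | ⟨η', F', N', hη', hbr', hord', hN', hNw, hFF'⟩
  · rw [h1, hρ]
    have : (0 : ℤ) ≤ N * n := by positivity
    linarith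
  · have hF'0 : aeval ![η ^ j / ξ ^ i, η'] F' ≠ 0 := by
      intro h0
      rw [hFF', h0, mul_zero] at hF0
      exact hF0 rfl
    rw [hFF', ord_mul v (pow_ne_zero _ hρ0) hF'0, ord_pow, hρ]
    have h2 := hD _ _ hbr'
    obtain ⟨n', hn'⟩ := Int.eq_ofNat_of_zero_le (sub_nonneg.2 h2)
    have h3 := ih n' (by omega) _ _ F' N' (by rw [hρ]; exact_mod_cast hd) hη' hbr' (by omega) hN'
    have h4 : (n' : ℤ) + ord v η' = n := by omega
    rw [h4] at h3
    have h5 : N' ≤ N := by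
      have : b * N' ≤ b * N := by nlinarith
      exact Nat.le_of_mul_le_mul_left this hb
    have h6 : (N' : ℤ) * n ≤ N * n := by gcongr
    linarith

theorem false_of_coprime_orders [IsAlgClosed K] (v : Valuation L ℤᵐ⁰) (D₁ D₂ : Derivation K L L)
    (hv : ∀ c : K, c ≠ 0 → v (algebraMap K L c) = 1)
    (hD : ∀ x y, bracket D₁ D₂ x y ≠ 0 → ord v x + ord v y + 2 ≤ ord v (bracket D₁ D₂ x y))
    {A B : L} {a b d : ℕ} (ha : 2 ≤ a) (hb : 2 ≤ b) (hd : 0 < d) (hab : a.Coprime b)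
    (hordA : ord v A = -(a * d)) (hordB : ord v B = -(b * d)) (hbr : bracket D₁ D₂ A B ≠ 0)
    (hbr0 : ord v (bracket D₁ D₂ A B) = 0) (P : MvPolynomial (Fin 2) K)
    (hP : ord v (aeval ![A, B] P) = -1) : False := by
  have had : 0 < a * d := by positivity
  have hbd : 0 < b * d := by positivity
  have hA0 : A ≠ 0 := ne_zero_of_ord_ne_zero (v := v) (by rw [hordA]; exact_mod_cast by omega)
  have hB0 : B ≠ 0 := ne_zero_of_ord_ne_zero (v := v) (by rw [hordB]; exact_mod_cast by omega)
  obtain ⟨i, j, hij⟩ := exists_mul_eq_mul_add_one (by omega) (by omega) hab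
  have hdeg : P.totalDegree ≠ 0 := by
    intro h0
    rw [totalDegree_eq_zero_iff_eq_C] at h0
    rw [h0, aeval_C] at hP
    have hc := ne_zero_of_ord_ne_zero (v := v) (by rw [hP]; decide)
    rw [(ord_eq_zero_iff v hc).2 (hv _ fun h => hc (by rw [h, map_zero]))] at hP
    omega
  rw [ne_eq, totalDegree_eq_zero_iff] at hdeg
  push Not at hdeg
  obtain ⟨m, hm, k, hk⟩ := hdeg
  obtain ⟨e, he, hmax⟩ := Finset.exists_max_image P.support (fun e => a * e 0 + b * e 1) ⟨m, hm⟩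
  set w := a * e 0 + b * e 1 with hw
  have hw2 : 2 ≤ w := by
    refine le_trans ?_ (hmax m hm)
    fin_cases k <;> simp only [Fin.zero_eta, Fin.mk_one] at hk
    · nlinarith [Nat.pos_of_ne_zero hk]
    · nlinarith [Nat.pos_of_ne_zero hk]
  have hρ : ord v (B ^ j / A ^ i) = -d :=
    ord_pow_div_pow v hA0 hB0 hij (by rw [hordA]; ring) (by rw [hordB]; ring)
  have hρ0 : B ^ j / A ^ i ≠ 0 := div_ne_zero (pow_ne_zero _ hB0) (pow_ne_zero _ hA0)
  have hξ : ord v (B ^ j / A ^ i)⁻¹ = d := by rw [ord_inv, hρ, neg_neg]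
  rcases toric_step v D₁ D₂ hv hA0 hB0 hbr (by omega) (by omega) hij
    (by rw [hordA, hordB]; ring) P w rfl (Or.inr rfl) (by rw [hξ]; exact_mod_cast hd) he hw.symm (by
      intro d' hd'
      have h1 := hmax d' hd'
      obtain ⟨t, ht⟩ := Nat.exists_eq_add_of_le h1
      have h2 : (((a * d' 0 + b * d' 1 : ℕ) : ℤ) - w).natAbs = t := by omega
      rw [h2, ht, pow_add _ _ t, pow_add, inv_pow, mul_assoc, mul_inv_cancel₀ (pow_ne_zero _ hρ0),
        mul_one])
    with h1 | ⟨η, F, N, hη, hbr', hord', hN, hNw, hPF⟩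
  · rw [hP, hρ] at h1
    have : (2 : ℤ) ≤ w * d := by exact_mod_cast (by nlinarith)
    linarith
  · have hF0 : aeval ![(B ^ j / A ^ i)⁻¹, η] F ≠ 0 := by
      intro h0
      rw [hPF, h0, mul_zero] at hP
      simp [ord] at hP
    rw [hPF, ord_mul v (pow_ne_zero _ hρ0) hF0, ord_pow, hρ] at hP
    have h2 := hD _ _ hbr'
    obtain ⟨n, hn⟩ := Int.eq_ofNat_of_zero_le (sub_nonneg.2 h2)
    have h3 := ord_aeval_le v D₁ D₂ hv hD n _ η F N (by rw [hξ]; exact_mod_cast hd) hη hbr'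
      (by omega) hN
    have h4 : (n : ℤ) + ord v η = (a + b) * d - 2 := by
      rw [hbr0, hordA, hordB] at hord'
      linarith
    rw [h4] at h3
    have h5 : (w : ℤ) * d - 1 ≤ N * ((a + b) * d - 2) := by linarith
    have h6 : (N : ℤ) * (a * b) * d ≤ w * d := by
      gcongr
      exact_mod_cast hNw
    have h7 : (a + b : ℤ) ≤ a * b := by
      have : a + b ≤ a * b := by nlinarith
      exact_mod_cast this
    rcases Nat.eq_zero_or_pos N with h0 | h0
    · rw [h0] at h5
      have : (2 : ℤ) ≤ w * d := by exact_mod_cast (by nlinarith)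
      simp at h5
      linarith
    · have h8 : (N : ℤ) * d * (a + b) ≤ N * d * (a * b) := by gcongr
      have h9 : (1 : ℤ) ≤ N := by exact_mod_cast h0
      linarith

end Estimate

section Polynomial

variable {K : Type*} [Field K]

/-- The valuation `exp (deg p)` on polynomials, that is, the order of pole at infinity. -/
noncomputable def degreeValuation (K : Type*) [Field K] :
    Valuation (MvPolynomial (Fin 2) K) ℤᵐ⁰ := by
  classical
  exact
  { toFun := fun p => if p = 0 then 0 else WithZero.exp (p.totalDegree : ℤ)
    map_zero' := by simp
    map_one' := by simp
    map_mul' := fun p q => by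
      by_cases hp : p = 0
      · simp [hp]
      by_cases hq : q = 0
      · simp [hq]
      simp [hp, hq, totalDegree_mul_of_isDomain hp hq, WithZero.exp_add]
    map_add_le_max' := fun p q => by
      by_cases hp : p = 0
      · simp [hp]
      by_cases hq : q = 0
      · simp [hq]
      by_cases hpq : p + q = 0
      · simp [hpq]
      simp only [hp, hq, hpq, if_false, le_max_iff, WithZero.exp_le_exp, Nat.cast_le]
      exact le_max_iff.1 (totalDegree_add p q) }

lemma degreeValuation_apply {p : MvPolynomial (Fin 2) K} (hp : p ≠ 0) :
    degreeValuation K p = WithZero.exp (p.totalDegree : ℤ) := by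
  classical
  exact if_neg hp

lemma degreeValuation_ne_zero {p : MvPolynomial (Fin 2) K} (hp : p ≠ 0) :
    degreeValuation K p ≠ 0 := by
  rw [degreeValuation_apply hp]
  exact WithZero.exp_ne_zero

lemma totalDegree_pderiv_lt {p : MvPolynomial (Fin 2) K} {i : Fin 2} (h : pderiv i p ≠ 0) :
    (pderiv i p).totalDegree < p.totalDegree := by
  obtain ⟨m, hm, hmd⟩ := Finset.exists_mem_eq_sup _ (support_nonempty.2 h)
    (fun s : Fin 2 →₀ ℕ => s.sum fun _ e => e)
  rw [totalDegree, hmd]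
  have hm' : m + Finsupp.single i 1 ∈ p.support := by
    rw [mem_support_iff, coeff_pderiv] at hm
    exact mem_support_iff.2 (left_ne_zero_of_mul hm)
  refine lt_of_lt_of_le ?_ (le_totalDegree hm')
  rw [Finsupp.sum_add_index' (fun _ => rfl) (fun _ _ _ => rfl), Finsupp.sum_single_index rfl]
  exact Nat.lt_succ_self _

lemma degreeValuation_pderiv_le (i : Fin 2) (p : MvPolynomial (Fin 2) K) :
    degreeValuation K (pderiv i p) ≤ WithZero.exp (-1) * degreeValuation K p := by
  by_cases h : pderiv i p = 0
  · simp [h]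
  have hp : p ≠ 0 := by
    rintro rfl
    exact h (map_zero _)
  rw [degreeValuation_apply h, degreeValuation_apply hp, ← WithZero.exp_add, WithZero.exp_le_exp]
  have := totalDegree_pderiv_lt h
  omega

lemma derivation_aeval_pair {A : Type*} [CommRing A] [Algebra K A] (D : Derivation K A A)
    (x y : A) (P : MvPolynomial (Fin 2) K) :
    D (aeval ![x, y] P) =
      aeval ![x, y] (pderiv 0 P) * D x + aeval ![x, y] (pderiv 1 P) * D y := by
  induction P using MvPolynomial.induction_on with
  | C c => simp
  | add p q hp hq =>
    simp only [map_add, hp, hq]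
    ring
  | mul_X p i hp =>
    fin_cases i <;>
      simp [hp] <;> ring

/-- The Jacobian determinant of an automorphism is a unit. -/
lemma isUnit_jacobian {f g : MvPolynomial (Fin 2) K}
    (h : Function.Surjective (aeval (R := K) ![f, g])) :
    IsUnit (pderiv 0 f * pderiv 1 g - pderiv 1 f * pderiv 0 g) := by
  obtain ⟨P, hP⟩ := h (X 0)
  obtain ⟨Q, hQ⟩ := h (X 1)
  have h1 := derivation_aeval_pair (pderiv 0) f g P
  have h2 := derivation_aeval_pair (pderiv 1) f g P
  have h3 := derivation_aeval_pair (pderiv 0) f g Q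
  have h4 := derivation_aeval_pair (pderiv 1) f g Q
  rw [hP, pderiv_X_self] at h1
  rw [hP, pderiv_X_of_ne (by decide)] at h2
  rw [hQ, pderiv_X_of_ne (by decide)] at h3
  rw [hQ, pderiv_X_self] at h4
  refine IsUnit.of_mul_eq_one_right (aeval ![f, g] (pderiv 0 P) * aeval ![f, g] (pderiv 1 Q) -
    aeval ![f, g] (pderiv 1 P) * aeval ![f, g] (pderiv 0 Q)) ?_
  generalize aeval ![f, g] (pderiv 0 P) = a at *
  generalize aeval ![f, g] (pderiv 1 P) = b at *
  generalize aeval ![f, g] (pderiv 0 Q) = c at *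
  generalize aeval ![f, g] (pderiv 1 Q) = d at *
  calc _ = (a * pderiv 0 f + b * pderiv 0 g) * (c * pderiv 1 f + d * pderiv 1 g) -
        (a * pderiv 1 f + b * pderiv 1 g) * (c * pderiv 0 f + d * pderiv 0 g) := by ring
    _ = 1 := by rw [← h1, ← h2, ← h3, ← h4]; ring

end Polynomial

section FractionField

open TensorProduct in
lemma exists_derivation_extension {K A L : Type*} [CommRing K] [CommRing A] [IsDomain A] [Field L]
    [Algebra K A] [Algebra A L] [Algebra K L] [IsScalarTower K A L] [IsFractionRing A L]
    (D : Derivation K A A) :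
    ∃ D' : Derivation K L L, ∀ a, D' (algebraMap A L a) = algebraMap A L (D a) := by
  have : Algebra.FormallyEtale A L :=
    Algebra.FormallyEtale.of_isLocalization (Rₘ := L) (nonZeroDivisors A)
  let l : Ω[L⁄K] →ₗ[L] L :=
    (((Algebra.linearMap A L).comp D.liftKaehlerDifferential).liftBaseChange L).comp
      (KaehlerDifferential.tensorKaehlerEquivOfFormallyEtale K A L).symm.toLinearMap
  refine ⟨l.compDer (KaehlerDifferential.D K L), fun a => ?_⟩
  simp [l, KaehlerDifferential.tensorKaehlerEquivOfFormallyEtale_symm_D_algebraMap]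

variable {K L : Type*} [Field K] [Field L] [Algebra (MvPolynomial (Fin 2) K) L]
  [IsFractionRing (MvPolynomial (Fin 2) K) L]

variable (K L) in
lemma exists_degreeValuation_extension : ∃ v : Valuation L ℤᵐ⁰,
    ∀ p, v (algebraMap (MvPolynomial (Fin 2) K) L p) = degreeValuation K p :=
  ⟨(degreeValuation K).extendToLocalization (S := nonZeroDivisors _)
    (fun _ hp => degreeValuation_ne_zero (nonZeroDivisors.ne_zero hp)) L,
    fun _ => Valuation.extendToLocalization_apply_map_apply ..⟩

lemma valuation_derivation_le [Algebra K L] {v : Valuation L ℤᵐ⁰} {i : Fin 2} {D : Derivation K L L}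
    (hv : ∀ p, v (algebraMap (MvPolynomial (Fin 2) K) L p) = degreeValuation K p)
    (hD : ∀ p, D (algebraMap (MvPolynomial (Fin 2) K) L p) = algebraMap _ L (pderiv i p)) (z : L) :
    v (D z) ≤ WithZero.exp (-1) * v z := by
  obtain ⟨p, q, hq, rfl⟩ := IsFractionRing.div_surjective (A := MvPolynomial (Fin 2) K) z
  have hq0 := degreeValuation_ne_zero (nonZeroDivisors.ne_zero hq)
  rw [Derivation.leibniz_div, hD, hD, smul_eq_mul, map_mul, map_pow, map_inv₀, map_div₀]
  have h1 : v (algebraMap _ L q • algebraMap _ L (pderiv i p) -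
      algebraMap _ L p • algebraMap _ L (pderiv i q)) ≤
      WithZero.exp (-1) * degreeValuation K p * degreeValuation K q := by
    refine v.map_sub_le ?_ ?_
    · rw [smul_eq_mul, map_mul, hv, hv, mul_comm]
      gcongr
      exact degreeValuation_pderiv_le i p
    · rw [smul_eq_mul, map_mul, hv, hv, mul_right_comm, mul_comm]
      gcongr
      exact degreeValuation_pderiv_le i q
  rw [hv, hv]
  calc _ ≤ (degreeValuation K q)⁻¹ ^ 2 *
        (WithZero.exp (-1) * degreeValuation K p * degreeValuation K q) := by gcongr
    _ = _ := by field_simp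

end FractionField

lemma aeval_algebraMap_pair {K A L : Type*} [Field K] [CommRing A] [CommRing L] [Algebra K A]
    [Algebra A L] [Algebra K L] [IsScalarTower K A L] (x y : A) (P : MvPolynomial (Fin 2) K) :
    aeval ![algebraMap A L x, algebraMap A L y] P = algebraMap A L (aeval ![x, y] P) := by
  rw [← aeval_algebraMap_apply]
  congr 2
  ext k
  fin_cases k <;> rfl

end VanDerKulk

/-- **Van der Kulk.** If `(f, g)` is a polynomial automorphism of `K²`
(`K` algebraically closed), then `deg f ∣ deg g` or `deg g ∣ deg f`. -/
theorem stmt_7 {K : Type*} [Field K] [IsAlgClosed K]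
    (f g : MvPolynomial (Fin 2) K)
    (hauto : Function.Bijective
      (MvPolynomial.aeval (R := K) (S₁ := MvPolynomial (Fin 2) K) ![f, g])) :
    f.totalDegree ∣ g.totalDegree ∨ g.totalDegree ∣ f.totalDegree := by
  by_contra! hfg
  have hf0 : 0 < f.totalDegree :=
    Nat.pos_of_ne_zero fun h => hfg.2 (h ▸ dvd_zero _)
  have hg0 : 0 < g.totalDegree :=
    Nat.pos_of_ne_zero fun h => hfg.1 (h ▸ dvd_zero _)
  obtain ⟨a, b, hab, hfa, hgb⟩ := Nat.exists_coprime f.totalDegree g.totalDegree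
  set d := f.totalDegree.gcd g.totalDegree
  have ha : 2 ≤ a := by
    rcases a with _ | _ | a
    · omega
    · exact absurd (by rw [hfa, hgb]; simp) hfg.1
    · omega
  have hb : 2 ≤ b := by
    rcases b with _ | _ | b
    · omega
    · exact absurd (by rw [hfa, hgb]; simp) hfg.2
    · omega
  have hd : 0 < d := Nat.gcd_pos_of_pos_left _ hf0
  let L := FractionRing (MvPolynomial (Fin 2) K)
  let ι := algebraMap (MvPolynomial (Fin 2) K) L
  have hι : Function.Injective ι := IsFractionRing.injective _ _
  obtain ⟨v, hv⟩ := VanDerKulk.exists_degreeValuation_extension K L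
  obtain ⟨D₁, hD₁⟩ := VanDerKulk.exists_derivation_extension (L := L)
    (pderiv (R := K) (0 : Fin 2))
  obtain ⟨D₂, hD₂⟩ := VanDerKulk.exists_derivation_extension (L := L)
    (pderiv (R := K) (1 : Fin 2))
  have hord : ∀ p : MvPolynomial (Fin 2) K, p ≠ 0 →
      VanDerKulk.ord v (ι p) = -p.totalDegree := fun p hp => by
    rw [VanDerKulk.ord, hv, VanDerKulk.degreeValuation_apply hp, WithZero.log_exp]
  have hne : ∀ p : MvPolynomial (Fin 2) K, 0 < p.totalDegree → p ≠ 0 := by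
    rintro _ h rfl
    simp at h
  have hbr : VanDerKulk.bracket D₁ D₂ (ι f) (ι g) =
      ι (pderiv 0 f * pderiv 1 g - pderiv 1 f * pderiv 0 g) := by
    simp only [VanDerKulk.bracket, ι, hD₁, hD₂, map_sub, map_mul]
  have hJ := VanDerKulk.isUnit_jacobian hauto.2
  obtain ⟨P, hP⟩ := hauto.2 (X 0)
  refine VanDerKulk.false_of_coprime_orders v D₁ D₂ (A := ι f) (B := ι g) ?_
    (VanDerKulk.ord_add_le_ord_bracket (VanDerKulk.valuation_derivation_le hv hD₁)
      (VanDerKulk.valuation_derivation_le hv hD₂)) ha hb hd hab ?_ ?_ ?_ ?_ P ?_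
  · intro c hc
    rw [IsScalarTower.algebraMap_apply K (MvPolynomial (Fin 2) K) L, hv,
      VanDerKulk.degreeValuation_apply (by simpa using hc)]
    simp [algebraMap_eq]
  · rw [hord f (hne f hf0), hfa, Nat.cast_mul]
  · rw [hord g (hne g hg0), hgb, Nat.cast_mul]
  · rw [hbr]
    exact (map_ne_zero_iff _ hι).2 hJ.ne_zero
  · rw [hbr, hord _ hJ.ne_zero, (isUnit_iff_totalDegree_of_isReduced.1 hJ).2]
    simp
  · rw [VanDerKulk.aeval_algebraMap_pair, hP, hord _ (X_ne_zero 0), totalDegree_X]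
    simp
end

section
/- Let K be an algebraically closed field and let (g, f) be a polynomial automorphism of K² with deg f > 1. Then there exists a polynomial g̃ ∈ K[x, y] such that (g̃, f) is a polynomial automorphism of K² and deg g̃ < deg f. -/
open MvPolynomial

section WeightExpansion

variable {σ K : Type*} [Field K] (w : σ → ℕ)

/-- The substitution `X i ↦ X i * s ^ w i`. The coefficient of `s ^ d` in the image of `p` is the
weighted homogeneous component of `p` of weight `d`. -/
noncomputable def weightExpansion : MvPolynomial σ K →ₐ[K] Polynomial (MvPolynomial σ K) :=
  aeval fun i => Polynomial.C (X i) * Polynomial.X ^ w i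

theorem weightExpansion_monomial (d : σ →₀ ℕ) (a : K) :
    weightExpansion w (monomial d a) =
      Polynomial.monomial (Finsupp.weight w d) (monomial d a) := by
  rw [weightExpansion, aeval_monomial, ← Polynomial.C_mul_X_pow_eq_monomial, monomial_eq,
    Finsupp.weight_apply]
  simp only [Finsupp.prod, Finsupp.sum, mul_pow, Finset.prod_mul_distrib, ← pow_mul,
    Finset.prod_pow_eq_pow_sum, map_mul, map_prod, map_pow, smul_eq_mul, mul_comm (w _), mul_assoc]
  rfl

theorem coeff_weightExpansion (p : MvPolynomial σ K) (d : ℕ) :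
    (weightExpansion w p).coeff d = weightedHomogeneousComponent w d p := by
  induction p using MvPolynomial.monomial_add_induction_on with
  | C a =>
    rw [← monomial_zero', weightExpansion_monomial, Polynomial.coeff_monomial,
      weightedHomogeneousComponent_of_mem (isWeightedHomogeneous_monomial w _ _ rfl)]
    simp only [eq_comm]
  | monomial_add e a p _ _ ih =>
    rw [map_add, map_add, Polynomial.coeff_add, ih, weightExpansion_monomial,
      Polynomial.coeff_monomial,
      weightedHomogeneousComponent_of_mem (isWeightedHomogeneous_monomial w _ _ rfl)]
    simp only [eq_comm]

variable {w}

theorem MvPolynomial.IsWeightedHomogeneous.weightExpansion_eq {p : MvPolynomial σ K} {d : ℕ}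
    (hp : IsWeightedHomogeneous w p d) : weightExpansion w p = Polynomial.monomial d p := by
  ext1 k
  rw [coeff_weightExpansion, Polynomial.coeff_monomial, weightedHomogeneousComponent_of_mem hp]
  simp only [eq_comm]

variable (w)

theorem weightExpansion_injective :
    Function.Injective (weightExpansion (K := K) w) := by
  rw [injective_iff_map_eq_zero]
  intro p hp
  rw [← sum_weightedHomogeneousComponent w p]
  simp [← coeff_weightExpansion, hp]

theorem isWeightedHomogeneous_leadingCoeff_weightExpansion (p : MvPolynomial σ K) :
    IsWeightedHomogeneous w (weightExpansion w p).leadingCoeff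
      (weightExpansion w p).natDegree := by
  rw [Polynomial.leadingCoeff, coeff_weightExpansion]
  exact weightedHomogeneousComponent_mem w p _

theorem natDegree_weightExpansion (p : MvPolynomial σ K) :
    (weightExpansion w p).natDegree = weightedTotalDegree w p := by
  rcases eq_or_ne p 0 with rfl | hp
  · simp [weightedTotalDegree_zero]
  apply le_antisymm
  · rw [Polynomial.natDegree_le_iff_coeff_eq_zero]
    intro d hd
    rw [coeff_weightExpansion, weightedHomogeneousComponent_eq_zero d p hd]
  · refine Finset.sup_le fun d hd => Polynomial.le_natDegree_of_ne_zero fun h => ?_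
    rw [coeff_weightExpansion] at h
    have := congrArg (coeff d) h
    rw [coeff_weightedHomogeneousComponent, if_pos rfl] at this
    exact mem_support_iff.1 hd this

theorem natDegree_weightExpansion_one (p : MvPolynomial σ K) :
    (weightExpansion 1 p).natDegree = p.totalDegree := by
  rw [natDegree_weightExpansion, weightedTotalDegree_one]

end WeightExpansion

namespace Polynomial

/-- A polynomial expression in `q` whose coefficients have leading coefficient in `B` has leading
coefficient polynomial in that of `q`, provided the latter is transcendental over `B`. -/
theorem exists_leadingCoeff_sum_eq_aeval {A R : Type*} [CommRing A] [CommRing R] [IsDomain R]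
    [Algebra A R] (B : Subalgebra A R) (N : ℕ) (p : ℕ → Polynomial R) (q : Polynomial R)
    (hp : ∀ i, (p i).leadingCoeff ∈ B) (hq : Transcendental B q.leadingCoeff)
    (hne : ∑ i ∈ Finset.range N, p i * q ^ i ≠ 0) :
    ∃ β : Polynomial B,
      (∑ i ∈ Finset.range N, p i * q ^ i).leadingCoeff = Polynomial.aeval q.leadingCoeff β ∧
      ∀ i, β.coeff i ≠ 0 → (β.coeff i : R) = (p i).leadingCoeff ∧
        (p i).natDegree + i * q.natDegree =
          (∑ i ∈ Finset.range N, p i * q ^ i).natDegree := by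
  have hq0 : q ≠ 0 := by
    rintro rfl
    exact hq (by simpa using isAlgebraic_zero)
  classical
  set I := (Finset.range N).filter fun i => p i ≠ 0 with hI
  have hIne : I.Nonempty := by
    by_contra h
    rw [Finset.not_nonempty_iff_eq_empty, hI, Finset.filter_eq_empty_iff] at h
    exact hne (Finset.sum_eq_zero fun i hi => by simp [not_not.1 (h hi)])
  have hsum : ∑ i ∈ Finset.range N, p i * q ^ i = ∑ i ∈ I, p i * q ^ i := by
    rw [hI, Finset.sum_filter]
    refine Finset.sum_congr rfl fun i _ => ?_
    by_cases h : p i = 0 <;> simp [h]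
  rw [hsum]
  set e : ℕ → ℕ := fun i => (p i).natDegree + i * q.natDegree
  have he : ∀ i ∈ I, (p i * q ^ i).natDegree = e i := fun i hi => by
    rw [Polynomial.natDegree_mul (Finset.mem_filter.1 hi).2 (pow_ne_zero _ hq0),
      Polynomial.natDegree_pow]
  set D := I.sup' hIne e with hD
  set J := I.filter fun i => e i = D with hJ
  set β : Polynomial B := ∑ i ∈ J, Polynomial.monomial i ⟨(p i).leadingCoeff, hp i⟩ with hβ
  have hβc : ∀ i, β.coeff i = if i ∈ J then ⟨(p i).leadingCoeff, hp i⟩ else 0 := fun i => by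
    simp [hβ, Polynomial.coeff_monomial]
  have hcoeff : (∑ i ∈ I, p i * q ^ i).coeff D = Polynomial.aeval q.leadingCoeff β := by
    rw [Polynomial.finsetSum_coeff, hβ, map_sum, hJ, Finset.sum_filter (s := I)]
    refine Finset.sum_congr rfl fun i hi => ?_
    split_ifs with h
    · rw [← h, ← he i hi, Polynomial.coeff_natDegree, Polynomial.leadingCoeff_mul,
        Polynomial.leadingCoeff_pow, Polynomial.aeval_monomial]
      rfl
    · refine Polynomial.coeff_eq_zero_of_natDegree_lt ?_
      rw [he i hi]
      exact lt_of_le_of_ne (Finset.le_sup' e hi) h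
  have hβ0 : β ≠ 0 := by
    obtain ⟨i, hi, hiD⟩ := Finset.exists_mem_eq_sup' hIne e
    intro h
    have h1 := hβc i
    rw [h, if_pos (Finset.mem_filter.2 ⟨hi, hiD.symm⟩), Polynomial.coeff_zero] at h1
    have h2 := congrArg Subtype.val h1
    exact (Finset.mem_filter.1 hi).2 (Polynomial.leadingCoeff_eq_zero.1 h2.symm)
  have hnd : (∑ i ∈ I, p i * q ^ i).natDegree = D := by
    refine Polynomial.natDegree_eq_of_le_of_coeff_ne_zero ?_ ?_
    · refine Polynomial.natDegree_sum_le_of_forall_le _ _ fun i hi => ?_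
      rw [he i hi]
      exact Finset.le_sup' e hi
    · rw [hcoeff]
      exact fun h => hβ0 (transcendental_iff.1 hq β h)
  refine ⟨β, by rw [Polynomial.leadingCoeff, hnd, hcoeff], fun i hi => ?_⟩
  rw [hβc] at hi ⊢
  split_ifs at hi ⊢ with h
  · exact ⟨rfl, by rw [hnd]; exact (Finset.mem_filter.1 h).2⟩
  · exact absurd rfl hi

/-- Pseudo-division: some nonzero constant multiple of `z` can be divided by `q` with remainder. -/
theorem exists_C_mul_eq_mul_add {A : Type*} [CommRing A] [IsDomain A] {q : A[X]} (hq : q ≠ 0)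
    (z : A[X]) : ∃ a : A, a ≠ 0 ∧ ∃ c r : A[X], C a * z = c * q + r ∧ r.degree < q.degree := by
  induction hn : z.degree using WellFoundedLT.induction generalizing z with
  | _ n ih =>
    subst hn
    by_cases hz : z.degree < q.degree
    · exact ⟨1, one_ne_zero, 0, z, by simp, hz⟩
    have hqz : q.degree ≤ z.degree := not_lt.1 hz
    have hz0 : z ≠ 0 := by
      rintro rfl
      rw [degree_zero, le_bot_iff, degree_eq_bot] at hqz
      exact hq hqz
    have hnat := natDegree_le_natDegree hqz
    set t := C z.leadingCoeff * X ^ (z.natDegree - q.natDegree) with ht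
    have hlt : (C q.leadingCoeff * z - t * q).degree < z.degree := by
      have hlc : q.leadingCoeff ≠ 0 := leadingCoeff_ne_zero.2 hq
      have hlz : z.leadingCoeff ≠ 0 := leadingCoeff_ne_zero.2 hz0
      have h1 : (C q.leadingCoeff * z).degree = z.degree := by
        rw [degree_mul, degree_C hlc, zero_add]
      rw [← h1]
      refine degree_sub_lt_left ?_ (mul_ne_zero (C_ne_zero.2 hlc) hz0) ?_
      · rw [h1, degree_mul, ht, degree_C_mul_X_pow _ hlz, degree_eq_natDegree hq,
          degree_eq_natDegree hz0]
        norm_cast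
        omega
      · rw [ht, leadingCoeff_mul, leadingCoeff_mul, leadingCoeff_C, leadingCoeff_C_mul_X_pow,
          mul_comm]
    obtain ⟨a, ha, c, r, h, hr⟩ := ih _ hlt _ rfl
    refine ⟨a * q.leadingCoeff, mul_ne_zero ha (leadingCoeff_ne_zero.2 hq), c + C a * t, r, ?_, hr⟩
    rw [C_mul]
    linear_combination h

/-- Every polynomial has a nonzero constant multiple with an expansion in powers of `q` whose
coefficients have smaller degree than `q`. -/
theorem exists_C_mul_eq_sum_mul_pow {A : Type*} [CommRing A] [IsDomain A] {q : A[X]}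
    (hq : 0 < q.degree) (z : A[X]) :
    ∃ a : A, a ≠ 0 ∧ ∃ (N : ℕ) (b : ℕ → A[X]), (∀ i, (b i).degree < q.degree) ∧
      C a * z = ∑ i ∈ Finset.range N, b i * q ^ i := by
  have hq0 : q ≠ 0 := ne_zero_of_degree_gt hq
  induction hn : z.degree using WellFoundedLT.induction generalizing z with
  | _ n ih =>
    subst hn
    by_cases hz : z.degree < q.degree
    · refine ⟨1, one_ne_zero, 1, fun _ => z, fun _ => hz, by simp⟩
    obtain ⟨a, ha, c, r, h, hr⟩ := exists_C_mul_eq_mul_add hq0 z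
    have hc : c.degree < z.degree := by
      rcases eq_or_ne c 0 with rfl | hc0
      · rw [degree_zero, bot_lt_iff_ne_bot, Ne, degree_eq_bot]
        rintro rfl
        exact hz (by simpa only [degree_zero] using bot_lt_of_lt hq)
      · have h1 : (c * q).degree ≤ z.degree := by
          have : c * q = C a * z - r := by rw [h]; ring
          rw [this]
          refine (degree_sub_le _ _).trans (max_le ?_ (hr.le.trans (not_lt.1 hz)))
          rw [degree_mul, degree_C ha, zero_add]
        refine lt_of_lt_of_le ?_ h1
        rw [degree_mul, degree_eq_natDegree hc0, degree_eq_natDegree hq0]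
        rw [degree_eq_natDegree hq0] at hq
        norm_cast at hq ⊢
        omega
    obtain ⟨a', ha', N, b, hb, h'⟩ := ih _ hc c rfl
    refine ⟨a' * a, mul_ne_zero ha' ha, N + 1,
      fun i => Nat.casesOn i (C a' * r) b, fun i => ?_, ?_⟩
    · cases i with
      | zero => change (C a' * r).degree < _; rw [degree_mul, degree_C ha', zero_add]; exact hr
      | succ i => exact hb i
    · rw [Finset.sum_range_succ', C_mul, mul_assoc, h, mul_add, ← mul_assoc, h', Finset.sum_mul]
      simp only [pow_succ, pow_zero, mul_one, mul_assoc]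
      rfl

end Polynomial

section AlgebraicForms

variable {σ K : Type*} [Field K] {w : σ → ℕ}

theorem isWeightedHomogeneous_of_weightExpansion_eq {p : MvPolynomial σ K} {d : ℕ}
    (hp : weightExpansion w p = Polynomial.monomial d p) : IsWeightedHomogeneous w p d := by
  rcases eq_or_ne p 0 with rfl | hp0
  · exact isWeightedHomogeneous_zero K w d
  · simpa [hp, Polynomial.natDegree_monomial_eq d hp0] using
      isWeightedHomogeneous_leadingCoeff_weightExpansion w p

theorem MvPolynomial.IsWeightedHomogeneous.of_mul_left {p q : MvPolynomial σ K} {d e : ℕ}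
    (hp : IsWeightedHomogeneous w p d) (hp0 : p ≠ 0)
    (hpq : IsWeightedHomogeneous w (p * q) (d + e)) : IsWeightedHomogeneous w q e := by
  apply isWeightedHomogeneous_of_weightExpansion_eq
  have h := hpq.weightExpansion_eq
  rw [map_mul, hp.weightExpansion_eq, ← Polynomial.monomial_mul_monomial] at h
  exact mul_left_cancel₀ (by simpa using hp0) h

/-- A form algebraic over `K[T]`, where `T` is a form of positive weight, is up to a constant a
rational power of `T`. -/
theorem exists_pow_eq_C_mul_pow_of_isAlgebraic [IsAlgClosed K] {T r : MvPolynomial σ K} {d e : ℕ}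
    (hT : IsWeightedHomogeneous w T d) (hT0 : T ≠ 0) (hd : 0 < d)
    (hr : IsWeightedHomogeneous w r e) (halg : IsAlgebraic (Algebra.adjoin K {T}) r) :
    ∃ c : K, r ^ d = C c * T ^ e := by
  let L := AlgebraicClosure (FractionRing (MvPolynomial σ K))
  let ι : MvPolynomial σ K →+* L := algebraMap _ L
  have hι : Function.Injective ι := by
    rw [show ι = (algebraMap (FractionRing (MvPolynomial σ K)) L).comp (algebraMap _ _) from
      IsScalarTower.algebraMap_eq _ _ _]
    exact (algebraMap (FractionRing (MvPolynomial σ K)) L).injective.comp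
      (IsFractionRing.injective _ _)
  have hιC : ∀ a : K, ι (C a) = algebraMap K L a := fun a =>
    (IsScalarTower.algebraMap_apply K (MvPolynomial σ K) L a).symm
  obtain ⟨t, ht⟩ := IsAlgClosed.exists_pow_nat_eq (ι T) hd
  have ht0 : t ≠ 0 := by
    rintro rfl
    rw [zero_pow hd.ne'] at ht
    exact hT0 (hι (by rw [← ht, map_zero]))
  set ε : L := ι r * t⁻¹ ^ e with hε
  let η : MvPolynomial σ K →+* Polynomial L :=
    (Polynomial.compRingHom (Polynomial.C t⁻¹ * Polynomial.X)).comp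
      ((Polynomial.mapRingHom ι).comp (weightExpansion w).toRingHom)
  have hη : ∀ {p : MvPolynomial σ K} {k : ℕ}, IsWeightedHomogeneous w p k →
      η p = Polynomial.C (ι p * t⁻¹ ^ k) * Polynomial.X ^ k := by
    intro p k hp
    simp [η, hp.weightExpansion_eq, mul_pow, mul_assoc, -inv_pow]
  have hηT : η T = Polynomial.X ^ d := by
    rw [hη hT, ← ht, ← mul_pow, mul_inv_cancel₀ ht0, one_pow, map_one, one_mul]
  have hηC : ∀ a : K, η (C a) = Polynomial.C (algebraMap K L a) := by
    intro a
    rw [hη (isWeightedHomogeneous_C w a), hιC]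
    simp
  have hεalg : IsAlgebraic K ε := by
    by_contra htr
    obtain ⟨p, hp0, hp⟩ := halg
    let φ : Polynomial K →+* Algebra.adjoin K {T} :=
      (Polynomial.aeval (⟨T, Algebra.self_mem_adjoin_singleton K T⟩ : Algebra.adjoin K {T}) :
        Polynomial K →ₐ[K] _)
    have hφ : Function.Surjective φ := by
      rintro ⟨x, hx⟩
      rw [Algebra.adjoin_singleton_eq_range_aeval] at hx
      obtain ⟨a, rfl⟩ := hx
      refine ⟨a, Subtype.ext ?_⟩
      exact (Polynomial.aeval_algHom_apply (Algebra.adjoin K {T}).val _ a).symm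
    obtain ⟨F, rfl⟩ := Polynomial.map_surjective φ hφ p
    have hF0 : F ≠ 0 := by
      rintro rfl
      exact hp0 (Polynomial.map_zero φ)
    have hηφ : ∀ a : Polynomial K, η (φ a : MvPolynomial σ K) =
        (Polynomial.expand K d a).map (algebraMap K L) := by
      intro a
      induction a using Polynomial.induction_on' with
      | add a b ha hb => simp [ha, hb]
      | monomial k a =>
        have : (φ (Polynomial.monomial k a) : MvPolynomial σ K) = C a * T ^ k := by
          simp [φ, Polynomial.aeval_monomial]
        rw [this, map_mul, map_pow, hηC, hηT, Polynomial.expand_monomial, Polynomial.map_monomial,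
          ← Polynomial.C_mul_X_pow_eq_monomial, ← pow_mul, mul_comm d]
    have hsum : ∑ j ∈ F.support, (Polynomial.expand K d (F.coeff j) *
        Polynomial.X ^ (e * j)).map (algebraMap K L) * Polynomial.C (ε ^ j) = 0 := by
      have h := congrArg η hp
      rw [Polynomial.aeval_def, Polynomial.eval₂_map, Polynomial.eval₂_eq_sum, Polynomial.sum,
        map_sum, map_zero] at h
      rw [← h]
      refine Finset.sum_congr rfl fun j _ => ?_
      have hrj : η (r ^ j) = Polynomial.C (ε ^ j) * Polynomial.X ^ (e * j) := by
        rw [map_pow, hη hr, ← hε, mul_pow, ← map_pow, ← pow_mul]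
      have hF : η (((algebraMap (Algebra.adjoin K {T}) (MvPolynomial σ K)).comp φ) (F.coeff j)) =
        (Polynomial.expand K d (F.coeff j)).map (algebraMap K L) := hηφ _
      rw [map_mul, hrj, hF, Polynomial.map_mul, Polynomial.map_pow, Polynomial.map_X]
      ring
    have hcoeff : ∀ k j, (Polynomial.expand K d (F.coeff j) *
        Polynomial.X ^ (e * j)).coeff k = 0 := by
      intro k
      set H : Polynomial K := ∑ j ∈ F.support, Polynomial.monomial j
        ((Polynomial.expand K d (F.coeff j) * Polynomial.X ^ (e * j)).coeff k) with hH
      have hH0 : H = 0 := by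
        refine transcendental_iff.1 htr H ?_
        have h := congrArg (fun P => Polynomial.coeff P k) hsum
        simp only [Polynomial.finsetSum_coeff, Polynomial.coeff_mul_C, Polynomial.coeff_map,
          Polynomial.coeff_zero] at h
        rw [hH, map_sum]
        simpa only [Polynomial.aeval_monomial] using h
      intro j
      by_cases hj : j ∈ F.support
      · have h := congrArg (fun P => Polynomial.coeff P j) hH0
        rw [Polynomial.coeff_zero] at h
        simpa [hH, Polynomial.coeff_monomial, hj] using h
      · simp [Polynomial.notMem_support_iff.1 hj]
    refine hF0 (Polynomial.ext fun j => ?_)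
    have h : Polynomial.expand K d (F.coeff j) * Polynomial.X ^ (e * j) = 0 :=
      Polynomial.ext fun k => by rw [hcoeff, Polynomial.coeff_zero]
    rw [Polynomial.coeff_zero, ← Polynomial.expand_eq_zero hd]
    simpa using h
  obtain ⟨c, hc⟩ := minpoly.mem_range_of_degree_eq_one K ε
    (IsAlgClosed.degree_eq_one_of_irreducible K (minpoly.irreducible hεalg.isIntegral))
  refine ⟨c ^ d, hι ?_⟩
  have hr' : ι r = algebraMap K L c * t ^ e := by
    rw [hc, hε, mul_assoc, ← mul_pow, inv_mul_cancel₀ ht0, one_pow, mul_one]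
  rw [map_mul, map_pow, map_pow ι T, hιC, hr', ← ht, map_pow]
  ring

end AlgebraicForms

section CoreArgument

variable {K : Type*} [Field K]

/-- If the weight of `X j` does not divide that of `X i`, then `X i` spans the forms of
its weight. -/
theorem MvPolynomial.IsWeightedHomogeneous.eq_C_mul_X {w : Fin 2 → ℕ} {i j : Fin 2} (hij : i ≠ j)
    (hi : 0 < w i) (hj : 0 < w j) (hndvd : ¬ w j ∣ w i) {e : MvPolynomial (Fin 2) K}
    (he : IsWeightedHomogeneous w e (w i)) : ∃ c : K, e = C c * X i := by
  refine ⟨coeff (Finsupp.single i 1) e, ?_⟩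
  rw [C_mul_X_eq_monomial]
  refine he.eq_monomial_of_unique_weight fun d hd => ?_
  have hsum : d i * w i + d j * w j = w i := by
    rw [Finsupp.weight_apply, Finsupp.sum_fintype _ _ (by simp)] at hd
    fin_cases i <;> fin_cases j <;> simp_all [Fin.sum_univ_two, add_comm]
  have hdi : d i ≠ 0 := fun h => hndvd ⟨d j, by rw [h] at hsum; linarith⟩
  have h1 : d i = 1 := by
    refine le_antisymm ?_ (Nat.one_le_iff_ne_zero.2 hdi)
    by_contra! h
    nlinarith
  have h0 : d j = 0 := by
    rw [h1, one_mul] at hsum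
    have : d j * w j = 0 := by omega
    exact (Nat.mul_eq_zero.1 this).resolve_right hj.ne'
  ext k
  have hk : k = i ∨ k = j := by fin_cases i <;> fin_cases j <;> fin_cases k <;> simp_all
  rcases hk with rfl | rfl
  · simp [h1]
  · simp [h0, hij]

/-- If a homogeneous form algebraic over `K[T]` exceeds another in weight by `d`, then the quotient
exists and is a form vanishing wherever `T` does. -/
theorem exists_mul_eq_of_isAlgebraic [IsAlgClosed K] {σ : Type*} {w : σ → ℕ}
    {T b G : MvPolynomial σ K} {t γ d : ℕ} (hT : IsWeightedHomogeneous w T t) (hT0 : T ≠ 0)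
    (ht : 0 < t)
    (hG : IsWeightedHomogeneous w G γ) (hG0 : G ≠ 0)
    (hGalg : IsAlgebraic (Algebra.adjoin K {T}) G)
    (hb : IsWeightedHomogeneous w b (γ + d)) (hb0 : b ≠ 0)
    (hbalg : IsAlgebraic (Algebra.adjoin K {T}) b) :
    ∃ e, b = G * e ∧ IsWeightedHomogeneous w e d ∧ ∃ c : K, e ^ t = C c * T ^ d := by
  obtain ⟨c₁, h₁⟩ := exists_pow_eq_C_mul_pow_of_isAlgebraic hT hT0 ht hG hGalg
  obtain ⟨c₂, h₂⟩ := exists_pow_eq_C_mul_pow_of_isAlgebraic hT hT0 ht hb hbalg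
  have hc₁ : c₁ ≠ 0 := by
    rintro rfl
    rw [C_0, zero_mul] at h₁
    exact hG0 (eq_zero_of_pow_eq_zero h₁)
  have hTγ : T ^ γ = C c₁⁻¹ * G ^ t := by
    rw [h₁, ← mul_assoc, ← C_mul, inv_mul_cancel₀ hc₁, C_1, one_mul]
  have hbG : b ^ t = G ^ t * (C (c₂ * c₁⁻¹) * T ^ d) := by
    rw [h₂, pow_add, hTγ, C_mul]
    ring
  obtain ⟨e, rfl⟩ := (IsIntegrallyClosed.pow_dvd_pow_iff ht.ne').1 ⟨_, hbG⟩
  refine ⟨e, rfl, hG.of_mul_left hG0 hb, c₂ * c₁⁻¹, ?_⟩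
  rw [mul_pow] at hbG
  exact mul_left_cancel₀ (pow_ne_zero _ hG0) hbG

theorem leadingCoeff_weightExpansion_polynomialAlgHom {σ : Type*} (w : σ → ℕ)
    (φ : Polynomial K →ₐ[K] MvPolynomial σ K)
    (hφ : (weightExpansion w (φ Polynomial.X)).natDegree ≠ 0) (a : Polynomial K) :
    (weightExpansion w (φ a)).leadingCoeff =
      C a.leadingCoeff * (weightExpansion w (φ Polynomial.X)).leadingCoeff ^ a.natDegree := by
  have h : weightExpansion w (φ a) =
      (a.map C).comp (weightExpansion w (φ Polynomial.X)) := by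
    rw [← Polynomial.aeval_X_left_apply a, Polynomial.comp, Polynomial.eval₂_map,
      Polynomial.aeval_X_left_apply]
    conv_lhs => rw [← Polynomial.aeval_X_left_apply a, ← Polynomial.aeval_algHom_apply,
      ← Polynomial.aeval_algHom_apply, Polynomial.aeval_def]
    rfl
  rw [h, Polynomial.leadingCoeff_comp hφ,
    Polynomial.leadingCoeff_map_of_injective (C_injective _ _),
    Polynomial.natDegree_map_eq_of_injective (C_injective _ _)]

end CoreArgument

section CoreLemma

/-- If `q` has minimal degree among the polynomials whose image has leading form outside `B`, and
that form `Q` is transcendental over `B`, then every form `Z` is a polynomial in `Q` over `B` up to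
a nonzero factor from `B`. -/
theorem exists_mul_eq_aeval_of_minimal {σ K A R : Type*} [Field K] [CommRing A] [IsDomain A]
    [CommRing R] [Algebra R (MvPolynomial σ K)] (w : σ → ℕ)
    (Ψ : Polynomial A →+* MvPolynomial σ K) (hΨ : Function.Surjective Ψ)
    (hΨC : ∀ a, a ≠ 0 → Ψ (Polynomial.C a) ≠ 0)
    (B : Subalgebra R (MvPolynomial σ K)) {q : Polynomial A} (hq : 0 < q.degree)
    (hmin : ∀ b : Polynomial A, b.degree < q.degree →
      (weightExpansion w (Ψ b)).leadingCoeff ∈ B)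
    (htr : Transcendental B (weightExpansion w (Ψ q)).leadingCoeff)
    {Z : MvPolynomial σ K} {ζ : ℕ} (hZ : IsWeightedHomogeneous w Z ζ) (hZ0 : Z ≠ 0) :
    ∃ (G : B) (γ : ℕ) (β : Polynomial B), G ≠ 0 ∧
      IsWeightedHomogeneous w (G : MvPolynomial σ K) γ ∧
      G * Z = Polynomial.aeval (weightExpansion w (Ψ q)).leadingCoeff β ∧
      (β.coeff 0 ≠ 0 → IsWeightedHomogeneous w (β.coeff 0 : MvPolynomial σ K) (γ + ζ)) := by
  obtain ⟨z, rfl⟩ := hΨ Z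
  obtain ⟨a, ha, N, b, hb, h⟩ := Polynomial.exists_C_mul_eq_sum_mul_pow hq z
  have hW : weightExpansion w (Ψ (Polynomial.C a)) * weightExpansion w (Ψ z) =
      ∑ i ∈ Finset.range N, weightExpansion w (Ψ (b i)) * weightExpansion w (Ψ q) ^ i := by
    rw [← map_mul, ← map_mul, h]
    simp only [map_sum, map_mul, map_pow]
  have h0 : weightExpansion w (Ψ (Polynomial.C a)) ≠ 0 :=
    (map_ne_zero_iff _ (weightExpansion_injective w)).2 (hΨC a ha)
  have h1 : weightExpansion w (Ψ z) ≠ 0 :=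
    (map_ne_zero_iff _ (weightExpansion_injective w)).2 hZ0
  obtain ⟨β, hβ, hβc⟩ := Polynomial.exists_leadingCoeff_sum_eq_aeval B N
    (fun i => weightExpansion w (Ψ (b i))) (weightExpansion w (Ψ q))
    (fun i => hmin _ (hb i)) htr (by rw [← hW]; exact mul_ne_zero h0 h1)
  refine ⟨⟨_, hmin (Polynomial.C a) (Polynomial.degree_C_le.trans_lt hq)⟩, _, β, ?_,
    isWeightedHomogeneous_leadingCoeff_weightExpansion w _, ?_, fun hi => ?_⟩
  · exact fun h => h0 (Polynomial.leadingCoeff_eq_zero.1 (congrArg Subtype.val h))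
  · rw [← hβ, ← hW, Polynomial.leadingCoeff_mul, hZ.weightExpansion_eq,
      Polynomial.leadingCoeff_monomial]
  · obtain ⟨h2, h3⟩ := hβc 0 hi
    rw [← hW, Polynomial.natDegree_mul h0 h1, hZ.weightExpansion_eq,
      Polynomial.natDegree_monomial_eq ζ hZ0, zero_mul, add_zero] at h3
    rw [h2, ← h3]
    exact isWeightedHomogeneous_leadingCoeff_weightExpansion w _

/-- If the leading forms of the images of constants lie in a relatively algebraically closed
subalgebra `B`, then some two nonzero forms in `B` differ in weight by the weight of a variable. -/
theorem exists_weight_add_of_surjective {K A R : Type*} [Field K] [CommRing A] [IsDomain A]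
    [CommRing R] [Algebra R (MvPolynomial (Fin 2) K)] (w : Fin 2 → ℕ)
    (Ψ : Polynomial A →+* MvPolynomial (Fin 2) K) (hΨ : Function.Surjective Ψ)
    (hΨC : ∀ a, a ≠ 0 → Ψ (Polynomial.C a) ≠ 0)
    (B : Subalgebra R (MvPolynomial (Fin 2) K)) (hB : ∀ r, r ∉ B → Transcendental B r)
    (hΨB : ∀ a, (weightExpansion w (Ψ (Polynomial.C a))).leadingCoeff ∈ B) :
    ∃ (i : Fin 2) (b G : B) (γ : ℕ), G ≠ 0 ∧ b ≠ 0 ∧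
      IsWeightedHomogeneous w (G : MvPolynomial (Fin 2) K) γ ∧
      IsWeightedHomogeneous w (b : MvPolynomial (Fin 2) K) (γ + w i) := by
  by_contra! key
  have hXB : X 0 ∉ B := fun h => key 0 ⟨X 0, h⟩ 1 0 one_ne_zero
    (fun h => X_ne_zero (R := K) (0 : Fin 2) (congrArg Subtype.val h))
    (isWeightedHomogeneous_one K w) (by simpa using isWeightedHomogeneous_X K w 0)
  have hne : {q | (weightExpansion w (Ψ q)).leadingCoeff ∉ B}.Nonempty := by
    obtain ⟨z, hz⟩ := hΨ (X 0)
    refine ⟨z, ?_⟩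
    rwa [Set.mem_ofPred_eq, hz, (isWeightedHomogeneous_X K w 0).weightExpansion_eq,
      Polynomial.leadingCoeff_monomial]
  obtain ⟨q, hqB, hmin⟩ := WellFounded.has_min
    (InvImage.wf (fun p : Polynomial A => p.degree) wellFounded_lt) _ hne
  replace hmin : ∀ b : Polynomial A, b.degree < q.degree →
      (weightExpansion w (Ψ b)).leadingCoeff ∈ B :=
    fun b hb => by_contra fun h => hmin b h hb
  have hq : 0 < q.degree := by
    by_contra! h
    rw [Polynomial.eq_C_of_degree_le_zero h] at hqB
    exact hqB (hΨB _)
  have htr : Transcendental B (weightExpansion w (Ψ q)).leadingCoeff :=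
    hB _ hqB
  have hQ := isWeightedHomogeneous_leadingCoeff_weightExpansion w (Ψ q)
  set Q := (weightExpansion w (Ψ q)).leadingCoeff
  have expand := fun {Z : MvPolynomial (Fin 2) K} {ζ : ℕ} (hZ : IsWeightedHomogeneous w Z ζ) =>
    exists_mul_eq_aeval_of_minimal w Ψ hΨ hΨC B hq hmin htr hZ
  have hX : ∀ i, ∃ G : B, G ≠ 0 ∧ ∃ γ, IsWeightedHomogeneous w (G : MvPolynomial (Fin 2) K) γ ∧
      ∃ Z, (G : MvPolynomial (Fin 2) K) * X i = Q * Z := by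
    intro i
    obtain ⟨G, γ, β, hG0, hG, hβ, hβ0⟩ := expand (isWeightedHomogeneous_X K w i) (X_ne_zero i)
    refine ⟨G, hG0, γ, hG, ?_⟩
    have h0 : β.coeff 0 = 0 := by
      by_contra h
      exact key i _ G γ hG0 h hG (hβ0 h)
    obtain ⟨β', rfl⟩ := Polynomial.X_dvd_iff.2 h0
    exact ⟨_, by rw [hβ, map_mul, Polynomial.aeval_X]⟩
  obtain ⟨G₀, hG₀, γ₀, hγ₀, Z₀, h₀⟩ := hX 0
  obtain ⟨G₁, hG₁, γ₁, hγ₁, Z₁, h₁⟩ := hX 1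
  have hQ0 : Q ≠ 0 := fun h => htr (by rw [h]; exact isAlgebraic_zero)
  have hcross : Z₀ * (G₁ : MvPolynomial (Fin 2) K) * X 1 =
      X 0 * (Z₁ * (G₀ : MvPolynomial (Fin 2) K)) := by
    apply mul_left_cancel₀ hQ0
    linear_combination (-(G₁ : MvPolynomial (Fin 2) K) * X 1) * h₀ +
      ((G₀ : MvPolynomial (Fin 2) K) * X 0) * h₁
  obtain ⟨Z, hZ⟩ : X 0 ∣ Z₀ * (G₁ : MvPolynomial (Fin 2) K) := by
    refine ((X_prime (R := K) (i := (0 : Fin 2))).dvd_or_dvd ⟨_, hcross⟩).resolve_right ?_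
    rw [X_dvd_X]
    simp
  have hGG : (G₀ * G₁ : MvPolynomial (Fin 2) K) = Q * Z := by
    apply mul_left_cancel₀ (X_ne_zero (R := K) (0 : Fin 2))
    linear_combination (G₁ : MvPolynomial (Fin 2) K) * h₀ + Q * hZ
  have hGG0 : (G₀ * G₁ : MvPolynomial (Fin 2) K) ≠ 0 :=
    mul_ne_zero (by simpa using hG₀) (by simpa using hG₁)
  have hZ0 : Z ≠ 0 := by
    rintro rfl
    exact hGG0 (by rw [hGG, mul_zero])
  have hζ : IsWeightedHomogeneous w Z (weightExpansion w Z).natDegree := by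
    have h := congrArg (fun p => (weightExpansion w p).leadingCoeff) hGG
    simp only [map_mul, hγ₀.weightExpansion_eq, hγ₁.weightExpansion_eq, hQ.weightExpansion_eq,
      Polynomial.leadingCoeff_mul, Polynomial.leadingCoeff_monomial] at h
    rw [hGG] at h
    have hlc := isWeightedHomogeneous_leadingCoeff_weightExpansion w Z
    rwa [← mul_left_cancel₀ hQ0 h] at hlc
  obtain ⟨G, γ, β, hG0, hG, hβ, -⟩ := expand hζ hZ0
  refine htr ⟨Polynomial.C (G₀ * G₁ * G) - Polynomial.X * β, fun h => ?_, ?_⟩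
  · have := congrArg (fun p => Polynomial.coeff p 0) h
    simp [hG₀, hG₁, hG0] at this
  · rw [map_sub, Polynomial.aeval_C, map_mul (Polynomial.aeval Q), Polynomial.aeval_X, ← hβ,
      sub_eq_zero]
    change (G₀ * G₁ * G : MvPolynomial (Fin 2) K) = _
    rw [hGG, mul_assoc, mul_comm Z]

/-- If neither weight divides the other and `Ψ` is a surjection `K[x][y] → K[X 0, X 1]`, then the
leading form of `Ψ x` does not vanish at points with nonzero coordinates. -/
theorem aeval_leadingForm_ne_zero_of_not_dvd {K R : Type*} [Field K] [IsAlgClosed K] [CommRing R]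
    [IsDomain R] [Algebra K R] {w : Fin 2 → ℕ} (hw : ∀ i, 0 < w i)
    (hndvd : ∀ i j, i ≠ j → ¬ w j ∣ w i)
    (Ψ : Polynomial (Polynomial K) →ₐ[K] MvPolynomial (Fin 2) K) (hΨ : Function.Surjective Ψ)
    (hpos : 0 < (weightExpansion w (Ψ (Polynomial.C Polynomial.X))).natDegree)
    (θ : MvPolynomial (Fin 2) K →ₐ[K] R) (hθ : ∀ i, θ (X i) ≠ 0) :
    θ (weightExpansion w (Ψ (Polynomial.C Polynomial.X))).leadingCoeff ≠ 0 := by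
  intro hθT
  set T := (weightExpansion w (Ψ (Polynomial.C Polynomial.X))).leadingCoeff with hTdef
  have hT : IsWeightedHomogeneous w T _ := isWeightedHomogeneous_leadingCoeff_weightExpansion w _
  have hT0 : T ≠ 0 := by
    intro h
    rw [hTdef, Polynomial.leadingCoeff_eq_zero] at h
    rw [h] at hpos
    exact hpos.ne' Polynomial.natDegree_zero
  obtain ⟨B, hB, hB'⟩ : ∃ B : Subalgebra (Algebra.adjoin K {T}) (MvPolynomial (Fin 2) K),
      (∀ {r}, r ∈ B ↔ IsAlgebraic (Algebra.adjoin K {T}) r) ∧ ∀ r, r ∉ B → Transcendental B r :=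
    ⟨Subalgebra.algebraicClosure _ _, Subalgebra.mem_algebraicClosure _ _,
      fun _ h => Transcendental.subalgebraAlgebraicClosure h⟩
  have key : ∀ (i : Fin 2) (b G : B) (γ : ℕ), G ≠ 0 → b ≠ 0 →
      IsWeightedHomogeneous w (G : MvPolynomial (Fin 2) K) γ →
      ¬ IsWeightedHomogeneous w (b : MvPolynomial (Fin 2) K) (γ + w i) := by
    intro i b G γ hG0 hb0 hG hb
    obtain ⟨e, he, hew, c, hc⟩ := exists_mul_eq_of_isAlgebraic hT hT0 hpos hG
      (by simpa using hG0) (hB.1 G.2) hb (by simpa using hb0) (hB.1 b.2)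
    obtain ⟨j, hij⟩ := exists_ne i
    obtain ⟨a, rfl⟩ := hew.eq_C_mul_X hij.symm (hw i) (hw j) (hndvd i j hij.symm)
    have ha : a ≠ 0 := by
      rintro rfl
      exact hb0 (Subtype.ext (by simp [he]))
    have h := congrArg θ hc
    rw [map_mul, map_pow θ T, hθT, zero_pow (hw i).ne', mul_zero, map_pow, map_mul] at h
    refine mul_ne_zero ?_ (hθ i) (eq_zero_of_pow_eq_zero h)
    rw [← algebraMap_eq, AlgHom.commutes]
    simpa using ha
  have hlead : ∀ a : Polynomial K, (weightExpansion w (Ψ (Polynomial.C a))).leadingCoeff =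
      C a.leadingCoeff * T ^ a.natDegree := by
    have := leadingCoeff_weightExpansion_polynomialAlgHom w
      (Ψ.comp (Polynomial.CAlgHom (R := K) (A := Polynomial K))) (by simpa using hpos.ne')
    simpa using this
  have hTB : T ∈ B := hB.2 (isAlgebraic_algebraMap
    (⟨T, Algebra.self_mem_adjoin_singleton K T⟩ : Algebra.adjoin K {T}))
  have hCB : ∀ a : K, C a ∈ B := fun a => hB.2 (isAlgebraic_algebraMap
    (algebraMap K (Algebra.adjoin K {T}) a))
  have hΨC : ∀ a, a ≠ 0 → Ψ (Polynomial.C a) ≠ 0 := by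
    intro a ha h
    have := hlead a
    rw [h, map_zero, Polynomial.leadingCoeff_zero] at this
    exact mul_ne_zero (by simpa using ha) (pow_ne_zero _ hT0) this.symm
  obtain ⟨i, b, G, γ, hG0, hb0, hG, hb⟩ := exists_weight_add_of_surjective w
    Ψ.toRingHom hΨ hΨC B hB' fun a => by
      have h := hlead a
      rw [AlgHom.toRingHom_eq_coe, RingHom.coe_coe, h]
      exact mul_mem (hCB _) (pow_mem hTB _)
  exact key i b G γ hG0 hb0 hG hb

end CoreLemma

section Reduction

theorem natDegree_aeval_monomial_le_and_coeff {σ K S : Type*} [Field K] [CommRing S] [Algebra K S]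
    {w : σ → ℕ} {P : σ → Polynomial S} (hP : ∀ i, (P i).natDegree ≤ w i) (d : σ →₀ ℕ) :
    (aeval P (monomial d (1 : K))).natDegree ≤ Finsupp.weight w d ∧
      (aeval P (monomial d (1 : K))).coeff (Finsupp.weight w d) =
        aeval (fun i => (P i).coeff (w i)) (monomial d (1 : K)) := by
  induction d using Finsupp.induction_linear with
  | zero => simp
  | add d e hd he =>
    rw [← one_mul (1 : K), ← monomial_mul, map_mul, map_mul, map_add, hd.2.symm, he.2.symm]
    exact ⟨Polynomial.natDegree_mul_le_of_le hd.1 he.1,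
      Polynomial.coeff_mul_add_eq_of_natDegree_le hd.1 he.1⟩
  | single i k =>
    rw [Finsupp.weight_single, smul_eq_mul]
    rw [← X_pow_eq_monomial, map_pow, map_pow, aeval_X, aeval_X]
    exact ⟨Polynomial.natDegree_pow_le_of_le k (hP i),
      Polynomial.coeff_pow_of_natDegree_le (hP i)⟩

/-- If `P i` has degree at most `w i`, the coefficient of the substitution `r(P)` in the weighted
degree of `r` only depends on the leading form of `r`. -/
theorem coeff_aeval_natDegree_weightExpansion {σ K S : Type*} [Field K] [CommRing S] [Algebra K S]
    {w : σ → ℕ} {P : σ → Polynomial S} (hP : ∀ i, (P i).natDegree ≤ w i) (r : MvPolynomial σ K) :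
    (aeval P r).coeff (weightExpansion w r).natDegree =
      aeval (fun i => (P i).coeff (w i)) (weightExpansion w r).leadingCoeff := by
  classical
  rw [Polynomial.leadingCoeff, coeff_weightExpansion, weightedHomogeneousComponent_apply]
  conv_lhs => rw [r.as_sum, map_sum, ← r.as_sum]
  rw [Polynomial.finsetSum_coeff, map_sum, Finset.sum_filter]
  refine Finset.sum_congr rfl fun d hd => ?_
  obtain ⟨h₁, h₂⟩ := natDegree_aeval_monomial_le_and_coeff (K := K) hP d
  rw [← mul_one (coeff d r), ← smul_eq_mul, ← smul_monomial, map_smul, map_smul,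
    Polynomial.coeff_smul]
  split_ifs with h
  · rw [← h, h₂]
  · rw [Polynomial.coeff_eq_zero_of_natDegree_lt, smul_zero]
    refine h₁.trans_lt (lt_of_le_of_ne ?_ h)
    rw [natDegree_weightExpansion]
    exact le_weightedTotalDegree w hd

theorem MvPolynomial.IsWeightedHomogeneous.aeval_mul_pow {σ K S : Type*} [Field K] [CommRing S]
    [Algebra K S] {w : σ → ℕ} {T : MvPolynomial σ K} {τ : ℕ} (hT : IsWeightedHomogeneous w T τ)
    (v : σ → S) (s : S) : aeval (fun i => v i * s ^ w i) T = aeval v T * s ^ τ := by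
  have h : (Polynomial.eval₂AlgHom (aeval v : MvPolynomial σ K →ₐ[K] S) s
      (fun _ => Commute.all _ _)).comp
      (weightExpansion w) = aeval fun i => v i * s ^ w i := by
    ext i
    simp [weightExpansion]
  rw [← h, AlgHom.comp_apply, hT.weightExpansion_eq]
  simp

theorem MvPolynomial.IsWeightedHomogeneous.aeval_eq_dehomogenization_mul_pow {K L : Type*} [Field K]
    [Field L] [Algebra K L] {k τ : ℕ} {T : MvPolynomial (Fin 2) K}
    (hT : IsWeightedHomogeneous ![k, 1] T τ) (x : L) {y : L} (hy : y ≠ 0) :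
    aeval ![x, y] T =
      Polynomial.aeval (x / y ^ k) (aeval ![(Polynomial.X : Polynomial K), 1] T) * y ^ τ := by
  have h1 : (aeval ![x / y ^ k, 1] : MvPolynomial (Fin 2) K →ₐ[K] L) =
      (Polynomial.aeval (x / y ^ k)).comp (aeval ![(Polynomial.X : Polynomial K), 1]) := by
    ext i
    fin_cases i <;> simp
  have h2 : ![x, y] = fun i => ![x / y ^ k, 1] i * y ^ ![k, 1] i := by
    ext i
    fin_cases i <;> simp [hy]
  rw [h2, hT.aeval_mul_pow, h1, AlgHom.comp_apply]

/-- Over an algebraically closed field, a form for the weights `(k, 1)` vanishes at `(G, F)` only if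
`G` is a constant multiple of `F ^ k`. -/
theorem exists_eq_algebraMap_mul_pow_of_aeval_eq_zero {R K : Type*} [Field K] [IsAlgClosed K]
    [CommRing R] [IsDomain R] [Algebra K R] {k τ : ℕ} {T : MvPolynomial (Fin 2) K}
    (hT : IsWeightedHomogeneous ![k, 1] T τ) (hT0 : T ≠ 0) {G F : R} (hF : F ≠ 0)
    (h : aeval ![G, F] T = 0) : ∃ c : K, G = algebraMap K R c * F ^ k := by
  set p : Polynomial K := aeval ![(Polynomial.X : Polynomial K), 1] T with hp
  have hp0 : p ≠ 0 := by
    intro hp0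
    let ι := IsScalarTower.toAlgHom K (MvPolynomial (Fin 2) K)
      (FractionRing (MvPolynomial (Fin 2) K))
    have hι : Function.Injective ι := IsFractionRing.injective _ _
    have h1 := hT.aeval_eq_dehomogenization_mul_pow (ι (X 0)) (y := ι (X 1))
      ((map_ne_zero_iff ι hι).2 (X_ne_zero 1))
    rw [← hp, hp0, map_zero, zero_mul] at h1
    refine hT0 (hι ?_)
    rw [map_zero, ← h1]
    conv_lhs => rw [← aeval_X_left_apply T]
    rw [← AlgHom.comp_apply, comp_aeval]
    congr 2
    ext i
    fin_cases i <;> rfl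
  let ι := IsScalarTower.toAlgHom K R (FractionRing R)
  have hι : Function.Injective ι := IsFractionRing.injective _ _
  have hιF : ι F ≠ 0 := (map_ne_zero_iff ι hι).2 hF
  have h1 := hT.aeval_eq_dehomogenization_mul_pow (ι G) hιF
  have h2 : aeval ![ι G, ι F] T = ι (aeval ![G, F] T) := by
    rw [← AlgHom.comp_apply, comp_aeval]
    congr 2
    ext i
    fin_cases i <;> rfl
  rw [h2, h, map_zero, eq_comm, mul_eq_zero, or_iff_left (pow_ne_zero _ hιF)] at h1
  have halg : IsAlgebraic K (ι G / ι F ^ k) := ⟨p, hp0, h1⟩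
  obtain ⟨c, hc⟩ := minpoly.mem_range_of_degree_eq_one K _
    (IsAlgClosed.degree_eq_one_of_irreducible K (minpoly.irreducible halg.isIntegral))
  refine ⟨c, hι ?_⟩
  rw [map_mul, map_pow, AlgHom.commutes, hc, div_mul_cancel₀ _ (pow_ne_zero _ hιF)]

/-- If `(g, f)` is an automorphism of the plane with `1 < deg f ≤ deg g`, then the degree of `g` can
be lowered by subtracting a multiple of a power of `f`. -/
theorem exists_totalDegree_sub_C_mul_pow_lt {K : Type*} [Field K] [IsAlgClosed K]
    {g f : MvPolynomial (Fin 2) K}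
    (hauto : Function.Bijective
      (aeval ![g, f] : MvPolynomial (Fin 2) K →ₐ[K] MvPolynomial (Fin 2) K))
    (hf : 1 < f.totalDegree) (hgf : f.totalDegree ≤ g.totalDegree) :
    ∃ (c : K) (k : ℕ), (g - C c * f ^ k).totalDegree < g.totalDegree := by
  set w : Fin 2 → ℕ := ![g.totalDegree, f.totalDegree] with hw
  let e := AlgEquiv.ofBijective _ hauto
  have he : ∀ p, e p = aeval ![g, f] p := fun _ => rfl
  let φ : Polynomial K →ₐ[K] MvPolynomial (Fin 2) K := Polynomial.aeval (e.symm (X 0))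
  let Ψ : Polynomial (Polynomial K) →ₐ[K] MvPolynomial (Fin 2) K :=
    Polynomial.eval₂AlgHom φ (e.symm (X 1)) fun _ => Commute.all _ _
  have hΨX : Ψ (Polynomial.C Polynomial.X) = e.symm (X 0) := by simp [Ψ, φ]
  have hΨ : Function.Surjective Ψ := by
    have h : Ψ.comp (aeval ![Polynomial.C Polynomial.X, Polynomial.X]) =
        (e.symm : MvPolynomial (Fin 2) K →ₐ[K] MvPolynomial (Fin 2) K) := by
      ext1 i
      fin_cases i <;> simp [Ψ, φ]
    intro s
    refine ⟨aeval ![Polynomial.C Polynomial.X, Polynomial.X] (e s), ?_⟩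
    rw [← AlgHom.comp_apply, h]
    simp
  set τ := (weightExpansion w (e.symm (X 0))).natDegree with hτ
  set T := (weightExpansion w (e.symm (X 0))).leadingCoeff with hTdef
  have hT : IsWeightedHomogeneous w T τ := isWeightedHomogeneous_leadingCoeff_weightExpansion w _
  have hT0 : T ≠ 0 := by
    rw [hTdef, Polynomial.leadingCoeff_ne_zero, map_ne_zero_iff _ (weightExpansion_injective w)]
    simp
  have hτ1 : 1 < τ := by
    by_contra! h
    obtain ⟨a, ha⟩ : ∃ a, e.symm (X 0) = C a := by
      refine ⟨_, totalDegree_eq_zero_iff_eq_C.1 ((totalDegree_eq_zero_iff _ _).2 fun d hd i => ?_)⟩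
      have h1 := (le_weightedTotalDegree w hd).trans
        ((natDegree_weightExpansion w _).symm.le.trans h)
      by_contra hdi
      have h2 := Finsupp.le_weight_of_ne_zero' w hdi
      have h3 : 1 < w i := by fin_cases i <;> simp [w] <;> omega
      omega
    have h1 := congrArg e ha
    rw [AlgEquiv.apply_symm_apply, ← algebraMap_eq, AlgEquiv.commutes, algebraMap_eq] at h1
    have := congrArg totalDegree h1
    simp at this
  set G := (weightExpansion 1 g).leadingCoeff with hG
  set F := (weightExpansion 1 f).leadingCoeff with hF
  have hf0 : f ≠ 0 := by
    rintro rfl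
    simp at hf
  have hg0 : g ≠ 0 := by
    rintro rfl
    simp at hgf
    omega
  have hF0 : F ≠ 0 := Polynomial.leadingCoeff_ne_zero.2
    ((map_ne_zero_iff _ (weightExpansion_injective _)).2 hf0)
  have hG0 : G ≠ 0 := Polynomial.leadingCoeff_ne_zero.2
    ((map_ne_zero_iff _ (weightExpansion_injective _)).2 hg0)
  have hGc : (weightExpansion 1 g).coeff g.totalDegree = G := by
    rw [← natDegree_weightExpansion_one, Polynomial.coeff_natDegree]
  have hFc : (weightExpansion 1 f).coeff f.totalDegree = F := by
    rw [← natDegree_weightExpansion_one, Polynomial.coeff_natDegree]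
  have hrel : aeval ![G, F] T = 0 := by
    have h1 := coeff_aeval_natDegree_weightExpansion (w := w)
      (P := ![weightExpansion 1 g, weightExpansion 1 f])
      (by intro i; fin_cases i <;> simp [w, natDegree_weightExpansion_one]) (e.symm (X 0))
    have h2 : aeval ![weightExpansion 1 g, weightExpansion 1 f] (e.symm (X 0)) =
        weightExpansion 1 (X 0 : MvPolynomial (Fin 2) K) := by
      conv_rhs => rw [← e.apply_symm_apply (X 0), he, ← AlgHom.comp_apply, comp_aeval]
      congr 2
      ext1 i
      fin_cases i <;> rfl
    have h3 : (fun i => (![weightExpansion 1 g, weightExpansion 1 f] i).coeff (w i)) = ![G, F] := by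
      ext1 i
      fin_cases i
      exacts [hGc, hFc]
    rw [h2, h3, (isWeightedHomogeneous_X K 1 0).weightExpansion_eq, Polynomial.coeff_monomial,
      Pi.one_apply, ← hτ, if_neg hτ1.ne] at h1
    exact h1.symm
  have hdvd : f.totalDegree ∣ g.totalDegree := by
    by_contra hndvd
    refine aeval_leadingForm_ne_zero_of_not_dvd (w := w) ?_ ?_ Ψ hΨ ?_ (aeval ![G, F]) ?_ ?_
    · intro i
      fin_cases i <;> simp [w] <;> omega
    · intro i j hij
      have : ¬ g.totalDegree ∣ f.totalDegree := fun h =>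
        hndvd (hgf.antisymm (Nat.le_of_dvd (by omega) h)).dvd
      fin_cases i <;> fin_cases j <;> simp_all
    · rw [hΨX]
      omega
    · intro i
      fin_cases i <;> simpa
    · rwa [hΨX]
  obtain ⟨k, hk⟩ := hdvd
  obtain ⟨τ', hT'⟩ : ∃ τ', IsWeightedHomogeneous ![k, 1] T τ' := by
    have hwt : ∀ d : Fin 2 →₀ ℕ, Finsupp.weight w d = f.totalDegree * Finsupp.weight ![k, 1] d := by
      intro d
      simp only [Finsupp.weight_apply]
      rw [Finsupp.sum_fintype _ _ (by simp), Finsupp.sum_fintype _ _ (by simp)]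
      simp [Fin.sum_univ_two, hw, hk]
      ring
    obtain ⟨d, hd⟩ := exists_coeff_ne_zero hT0
    refine ⟨Finsupp.weight ![k, 1] d, fun d' hd' => ?_⟩
    have h := (hT hd').trans (hT hd).symm
    rw [hwt, hwt] at h
    exact Nat.eq_of_mul_eq_mul_left (by omega) h
  obtain ⟨c, hc⟩ := exists_eq_algebraMap_mul_pow_of_aeval_eq_zero hT' hT0 hF0 hrel
  refine ⟨c, k, ?_⟩
  rw [← natDegree_weightExpansion_one (g - _), map_sub, map_mul, map_pow,
    (isWeightedHomogeneous_C 1 c).weightExpansion_eq, Polynomial.monomial_zero_left]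
  have h1 : (Polynomial.C (C c) * weightExpansion 1 f ^ k).natDegree ≤ g.totalDegree := by
    refine Polynomial.natDegree_C_mul_le _ _ |>.trans (Polynomial.natDegree_pow_le.trans ?_)
    rw [natDegree_weightExpansion_one, hk, mul_comm]
  have h2 : (weightExpansion 1 g - Polynomial.C (C c) * weightExpansion 1 f ^ k).coeff
      g.totalDegree = 0 := by
    rw [Polynomial.coeff_sub, Polynomial.coeff_C_mul, hGc]
    rw [hk, mul_comm f.totalDegree,
      Polynomial.coeff_pow_of_natDegree_le (natDegree_weightExpansion_one f).le, hFc, hc,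
      algebraMap_eq, sub_self]
  refine lt_of_le_of_ne ((Polynomial.natDegree_sub_le_of_le
    (natDegree_weightExpansion_one g).le h1).trans_eq (max_self _)) fun h => ?_
  rw [← h, Polynomial.coeff_natDegree, Polynomial.leadingCoeff_eq_zero] at h2
  rw [h2, Polynomial.natDegree_zero] at h
  omega

/-- Composing an automorphism of the plane with a triangular one. -/
theorem bijective_aeval_sub_C_mul_pow {K : Type*} [Field K]
    {g f : MvPolynomial (Fin 2) K}
    (hauto : Function.Bijective
      (aeval ![g, f] : MvPolynomial (Fin 2) K →ₐ[K] MvPolynomial (Fin 2) K)) (c : K) (k : ℕ) :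
    Function.Bijective
      (aeval ![g - C c * f ^ k, f] : MvPolynomial (Fin 2) K →ₐ[K] MvPolynomial (Fin 2) K) := by
  have hcomp : ∀ a b : K,
      (aeval ![X 0 - C a * X 1 ^ k, X 1] : MvPolynomial (Fin 2) K →ₐ[K] MvPolynomial (Fin 2) K).comp
        (aeval ![X 0 - C b * X 1 ^ k, X 1]) = aeval ![X 0 - C (a + b) * X 1 ^ k, X 1] := by
    intro a b
    ext1 i
    fin_cases i
    · simp
      ring
    · simp
  have hid : (aeval ![X 0 - C 0 * X 1 ^ k, X 1] :
      MvPolynomial (Fin 2) K →ₐ[K] MvPolynomial (Fin 2) K) = AlgHom.id K _ := by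
    ext1 i
    fin_cases i <;> simp
  have helem : Function.Bijective
      (aeval ![X 0 - C c * X 1 ^ k, X 1] : MvPolynomial (Fin 2) K →ₐ[K] MvPolynomial (Fin 2) K) :=
    (AlgEquiv.ofAlgHom (aeval ![X 0 - C c * X 1 ^ k, X 1]) (aeval ![X 0 - C (-c) * X 1 ^ k, X 1])
      (by rw [hcomp, add_neg_cancel, hid]) (by rw [hcomp, neg_add_cancel, hid])).bijective
  have h : (aeval ![g - C c * f ^ k, f] : MvPolynomial (Fin 2) K →ₐ[K] MvPolynomial (Fin 2) K) =
      (aeval ![g, f]).comp (aeval ![X 0 - C c * X 1 ^ k, X 1]) := by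
    ext1 i
    fin_cases i <;> simp
  rw [h]
  exact hauto.comp helem

end Reduction

/-- If `(g, f)` is a polynomial automorphism of `K²` with
`deg f > 1`, then there is `g̃` with `(g̃, f)` a polynomial automorphism and
`deg g̃ < deg f`. -/
theorem stmt_8 {K : Type*} [Field K] [IsAlgClosed K]
    (g f : MvPolynomial (Fin 2) K)
    (hauto : Function.Bijective
      (MvPolynomial.aeval (R := K) (S₁ := MvPolynomial (Fin 2) K) ![g, f]))
    (hdeg : 1 < f.totalDegree) :
    ∃ g' : MvPolynomial (Fin 2) K,
      Function.Bijective
        (MvPolynomial.aeval (R := K) (S₁ := MvPolynomial (Fin 2) K) ![g', f]) ∧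
      g'.totalDegree < f.totalDegree := by
  induction hm : g.totalDegree using Nat.strong_induction_on generalizing g with
  | _ m ih =>
    subst hm
    rcases lt_or_ge g.totalDegree f.totalDegree with h | h
    · exact ⟨g, hauto, h⟩
    · obtain ⟨c, k, hlt⟩ := exists_totalDegree_sub_C_mul_pow_lt hauto hdeg h
      exact ih _ hlt _ (bijective_aeval_sub_C_mul_pow hauto c k) rfl
end

section
/- Let K be an algebraically closed field and let (g, f) be a polynomial automorphism of K² with deg g ≥ deg f > 1. Then N = deg g / deg f is a positive integer and there exists a constant c ∈ K such that deg(g − c·f^N) < deg g and (g − c·f^N, f) is again a polynomial automorphism of K². -/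
open MvPolynomial

namespace Polynomial.Bivariate

variable {K : Type*} [Field K]

/-- The substitution `X ↦ X * Y`, `Y ↦ Y`, i.e. a chart of the blow-up of the origin. -/
noncomputable def blowup : K[X][Y] →ₐ[K] K[X][Y] := aevalAeval (C X * Y) Y

theorem blowup_monomial_monomial (i j : ℕ) (c : K) :
    blowup (monomial i (monomial j c)) = monomial (i + j) (monomial j c) := by
  simp only [blowup, aevalAevalEquiv_apply_apply]
  simp [← C_mul_X_pow_eq_monomial]
  ring

theorem bivariate_induction {M : K[X][Y] → Prop} (hadd : ∀ p q, M p → M q → M (p + q))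
    (hmono : ∀ i j c, M (monomial i (monomial j c))) (p : K[X][Y]) : M p := by
  induction p using Polynomial.induction_on' with
  | add p q hp hq => exact hadd p q hp hq
  | monomial i a =>
    induction a using Polynomial.induction_on' with
    | add p q hp hq => rw [map_add]; exact hadd _ _ hp hq
    | monomial j c => exact hmono i j c

theorem coeff_coeff_blowup (p : K[X][Y]) (n j : ℕ) :
    ((blowup p).coeff n).coeff j = if j ≤ n then (p.coeff (n - j)).coeff j else 0 := by
  induction p using bivariate_induction with
  | hadd p q hp hq => simp only [map_add, coeff_add, hp, hq]; split_ifs <;> simp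
  | hmono i k c =>
    rw [blowup_monomial_monomial]
    simp only [coeff_monomial]
    split_ifs <;> simp_all [coeff_monomial] <;> grind

theorem aevalAeval_blowup {F : Type*} [Field F] [Algebra K F] (x y : F) (p : K[X][Y]) :
    aevalAeval x y (blowup p) = aevalAeval (x * y) y p := by
  induction p using bivariate_induction with
  | hadd p q hp hq => rw [map_add, map_add, map_add, hp, hq]
  | hmono i k c =>
    rw [blowup_monomial_monomial]
    simp [← C_mul_X_pow_eq_monomial]
    ring

theorem coeff_coeff_swap (p : K[X][Y]) (i j : ℕ) :
    ((swap p).coeff i).coeff j = (p.coeff j).coeff i := by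
  induction p using bivariate_induction with
  | hadd p q hp hq => simp only [map_add, coeff_add, hp, hq]
  | hmono k l c =>
    rw [swap_monomial_monomial]
    simp only [coeff_monomial]
    split_ifs <;> simp_all [coeff_monomial]

theorem aevalAeval_map_comp {F : Type*} [Field F] [Algebra K F] (x y : F) (c : K) (p : K[X][Y]) :
    aevalAeval (x - algebraMap K F c) y (p.map (compRingHom (X + C c))) = aevalAeval x y p := by
  induction p using bivariate_induction with
  | hadd p q hp hq => rw [Polynomial.map_add, map_add, map_add, hp, hq]
  | hmono i k c =>
    rw [Polynomial.map_monomial]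
    simp [← C_mul_X_pow_eq_monomial]

/-- A polynomial of order `n` at the origin becomes divisible by `Y ^ n` in a blow-up chart. -/
theorem exists_strict_transform (p : K[X][Y]) {i j : ℕ} (hij : (p.coeff i).coeff j ≠ 0)
    (hmin : ∀ k l, k + l < i + j → (p.coeff k).coeff l = 0) :
    ∃ q : K[X][Y], blowup p = X ^ (i + j) * q ∧ q.coeff 0 ≠ 0 ∧
      (q.coeff 0).natDegree ≤ i + j := by
  have hdvd : X ^ (i + j) ∣ blowup p := by
    rw [X_pow_dvd_iff]
    intro d hd
    ext l
    rw [coeff_coeff_blowup]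
    split_ifs with h
    · simpa using hmin _ _ (by omega)
    · simp
  obtain ⟨q, hq⟩ := hdvd
  have hcoeff : q.coeff 0 = (blowup p).coeff (i + j) := by
    rw [hq]; simp [coeff_X_pow_mul']
  refine ⟨q, hq, ?_, ?_⟩
  · rw [hcoeff]
    intro h
    have := coeff_coeff_blowup p (i + j) j
    simp [h] at this
    exact hij this.symm
  · rw [hcoeff, natDegree_le_iff_coeff_eq_zero]
    intro l hl
    rw [coeff_coeff_blowup, if_neg (by omega)]

end Polynomial.Bivariate

namespace Polynomial

open WithZero Bivariate

variable {K F : Type*} [Field K] [Field F] [Algebra K F] (v : Valuation F ℤᵐ⁰)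

theorem valuation_aeval_le_one (hK : ∀ c : K, v (algebraMap K F c) ≤ 1) {x : F} (hx : v x ≤ 1)
    (p : K[X]) :
    v (aeval x p) ≤ 1 := by
  induction p using Polynomial.induction_on' with
  | add p q hp hq => rw [map_add]; exact v.map_add_le hp hq
  | monomial i c =>
    rw [aeval_monomial, map_mul, map_pow]
    exact mul_le_one' (hK c) (pow_le_one' hx i)

theorem valuation_aevalAeval_le_one (hK : ∀ c : K, v (algebraMap K F c) ≤ 1) {x y : F}
    (hx : v x ≤ 1) (hy : v y ≤ 1) (p : K[X][Y]) : v (aevalAeval x y p) ≤ 1 := by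
  induction p using Polynomial.induction_on' with
  | add p q hp hq => rw [map_add]; exact v.map_add_le hp hq
  | monomial i c =>
    rw [← C_mul_X_pow_eq_monomial]
    simp only [map_mul, map_pow, aevalAeval_C, aevalAeval_Y]
    exact mul_le_one' (valuation_aeval_le_one v hK hx c) (pow_le_one' hy i)

theorem valuation_aeval_eq_one [IsAlgClosed K]
    (hK : ∀ c : K, c ≠ 0 → v (algebraMap K F c) = 1) {x : F}
    (hx : ∀ c : K, v (x - algebraMap K F c) = 1) {p : K[X]} (hp : p ≠ 0) : v (aeval x p) = 1 := by
  have h := (IsAlgClosed.splits p).eq_prod_roots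
  rw [h]
  simp only [map_mul, aeval_C, hK _ (leadingCoeff_ne_zero.2 hp), one_mul, map_multiset_prod,
    Multiset.map_map]
  apply Multiset.prod_eq_one
  simp only [Function.comp_apply, map_sub, aeval_X, aeval_C, hx, Multiset.mem_map]
  rintro _ ⟨_, _, rfl⟩
  rfl

theorem valuation_aevalAeval_eq_one [IsAlgClosed K]
    (hK : ∀ c : K, c ≠ 0 → v (algebraMap K F c) = 1)
    {x y : F} (hx : ∀ c : K, v (x - algebraMap K F c) = 1) (hy : v y < 1) {p : K[X][Y]}
    (hp : p.coeff 0 ≠ 0) : v (aevalAeval x y p) = 1 := by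
  have hK' : ∀ c : K, v (algebraMap K F c) ≤ 1 := fun c ↦ by
    by_cases h : c = 0
    · simp [h]
    · exact (hK c h).le
  have h1 := valuation_aeval_eq_one v hK hx hp
  rw [← divX_mul_X_add p, map_add, map_mul, aevalAeval_Y, aevalAeval_C,
    v.map_add_eq_of_lt_right, h1]
  rw [h1, map_mul]
  have := valuation_aevalAeval_le_one v hK' (by simpa using (hx 0).le) hy.le p.divX
  exact (mul_le_of_le_one_left' this).trans_lt hy

end Polynomial

namespace Derivation

open scoped WithZero

variable {K F : Type*} [Field K] [Field F] [Algebra K F] (D₁ D₂ : Derivation K F F)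

/-- The Jacobian determinant of a pair of elements with respect to two derivations. -/
def jacobian (a b : F) : F := D₁ a * D₂ b - D₂ a * D₁ b

theorem jacobian_swap (a b : F) : jacobian D₁ D₂ b a = -jacobian D₁ D₂ a b := by
  simp only [jacobian]; ring

theorem jacobian_mul_self (a b : F) : jacobian D₁ D₂ (a * b) b = b * jacobian D₁ D₂ a b := by
  simp only [jacobian, leibniz, smul_eq_mul]; ring

theorem jacobian_sub_algebraMap (a b : F) (c : K) :
    jacobian D₁ D₂ (a - algebraMap K F c) b = jacobian D₁ D₂ a b := by
  simp only [jacobian, map_sub, map_algebraMap, sub_zero]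

theorem valuation_jacobian_le {v : Valuation F ℤᵐ⁰} (h₁ : ∀ a, v (D₁ a) ≤ v a * WithZero.exp (-1))
    (h₂ : ∀ a, v (D₂ a) ≤ v a * WithZero.exp (-1)) (a b : F) :
    v (jacobian D₁ D₂ a b) ≤ v a * v b * WithZero.exp (-2) := by
  have key : ∀ {D D' : Derivation K F F}, (∀ a, v (D a) ≤ v a * WithZero.exp (-1)) →
      (∀ a, v (D' a) ≤ v a * WithZero.exp (-1)) →
      v (D a * D' b) ≤ v a * v b * WithZero.exp (-2) := by
    intro D D' h h'
    rw [map_mul]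
    refine (mul_le_mul' (h a) (h' b)).trans (le_of_eq ?_)
    rw [mul_mul_mul_comm, ← WithZero.exp_add]
    norm_num
  exact v.map_sub_le (key h₁ h₂) (key h₂ h₁)

theorem log_jacobian_le {v : Valuation F ℤᵐ⁰} (h₁ : ∀ a, v (D₁ a) ≤ v a * WithZero.exp (-1))
    (h₂ : ∀ a, v (D₂ a) ≤ v a * WithZero.exp (-1)) {a b : F} (hab : jacobian D₁ D₂ a b ≠ 0) :
    WithZero.log (v (jacobian D₁ D₂ a b)) ≤
      WithZero.log (v a) + WithZero.log (v b) - 2 := by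
  have ha : v a ≠ 0 := by
    rw [v.ne_zero_iff]; rintro rfl; simp [jacobian] at hab
  have hb : v b ≠ 0 := by
    rw [v.ne_zero_iff]; rintro rfl; simp [jacobian] at hab
  have := valuation_jacobian_le D₁ D₂ h₁ h₂ a b
  rw [← WithZero.log_le_log (by simpa using hab) (by simp [-WithZero.exp_neg, ha, hb]),
    WithZero.log_mul (mul_ne_zero ha hb) (WithZero.exp_ne_zero), WithZero.log_mul ha hb,
    WithZero.log_exp] at this
  omega

open Polynomial Polynomial.Bivariate

/-- The log canonical threshold inequality for a plane curve `p = 0` of multiplicity at most `n`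
at the centre `(a, b)` of a valuation `v`, where the log discrepancy is measured by the
Jacobian. -/
theorem log_aevalAeval_ge [IsAlgClosed K] {v : Valuation F ℤᵐ⁰}
    (hK : ∀ c : K, c ≠ 0 → v (algebraMap K F c) = 1)
    (h₁ : ∀ a, v (D₁ a) ≤ v a * WithZero.exp (-1)) (h₂ : ∀ a, v (D₂ a) ≤ v a * WithZero.exp (-1))
    (N : ℕ) {a b : F} (ha : v a < 1) (hb : v b < 1) (hab : jacobian D₁ D₂ a b ≠ 0)
    (hN : -WithZero.log (v (jacobian D₁ D₂ a b)) ≤ N) {p : K[X][Y]} {i j n : ℕ}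
    (hij : (p.coeff i).coeff j ≠ 0) (hn : i + j ≤ n) (hp : aevalAeval a b p ≠ 0) :
    n * (WithZero.log (v (jacobian D₁ D₂ a b)) + 2) ≤ WithZero.log (v (aevalAeval a b p)) := by
  induction N using Nat.strong_induction_on generalizing a b p i j n with
  | _ N ih =>
  wlog hle : v a ≤ v b generalizing a b p i j with H
  · have hs := jacobian_swap D₁ D₂ a b
    have hv : v (jacobian D₁ D₂ b a) = v (jacobian D₁ D₂ a b) := by rw [hs, v.map_neg]
    rw [← hv, ← aevalAeval_swap]
    refine H hb ha (by rwa [hs, neg_ne_zero]) (by rwa [hv]) (i := j) (j := i)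
      (by rwa [coeff_coeff_swap]) (by omega) (by rwa [aevalAeval_swap]) (le_of_not_ge hle)
  obtain ⟨k, l, hkl, hkln, hmin⟩ : ∃ k l, (p.coeff k).coeff l ≠ 0 ∧ k + l ≤ n ∧
      ∀ k' l', k' + l' < k + l → (p.coeff k').coeff l' = 0 := by
    classical
    have hex : ∃ m, ∃ k l, k + l = m ∧ (p.coeff k).coeff l ≠ 0 := ⟨_, i, j, rfl, hij⟩
    obtain ⟨k, l, h, hne⟩ := Nat.find_spec hex
    refine ⟨k, l, hne, ?_, fun k' l' h' ↦ ?_⟩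
    · exact h ▸ (Nat.find_min' hex ⟨i, j, rfl, hij⟩).trans hn
    · by_contra h0
      exact Nat.find_min hex (h ▸ h') ⟨k', l', rfl, h0⟩
  obtain ⟨q, hq, hq0, hqdeg⟩ := exists_strict_transform p hkl hmin
  have hb0 : b ≠ 0 := by rintro rfl; simp [jacobian] at hab
  have ha0 : a ≠ 0 := by rintro rfl; simp [jacobian] at hab
  have hvb : v b ≠ 0 := by simpa
  have hva : v a ≠ 0 := by simpa
  obtain ⟨c', hc'⟩ : ∃ c', c' = a / b := ⟨_, rfl⟩
  have hac : a = c' * b := by rw [hc']; field_simp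
  have hc'1 : v c' ≤ 1 := by
    rw [hc', map_div₀]; exact div_le_one_of_le₀ hle zero_le
  have hev : aevalAeval a b p = b ^ (k + l) * aevalAeval c' b q := by
    rw [hac, ← aevalAeval_blowup, hq, map_mul, map_pow, aevalAeval_Y]
  have hqne : v (aevalAeval c' b q) ≠ 0 := by
    rw [v.ne_zero_iff]; intro h; rw [hev, h, mul_zero] at hp; exact hp rfl
  have hJ : jacobian D₁ D₂ a b = b * jacobian D₁ D₂ c' b := by rw [hac, jacobian_mul_self]
  have hJ0 : jacobian D₁ D₂ c' b ≠ 0 := by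
    intro h; rw [hJ, h, mul_zero] at hab; exact hab rfl
  have hblog : WithZero.log (v b) < 0 := by
    rw [← WithZero.log_one]; exact (WithZero.log_lt_log hvb one_ne_zero).2 hb
  have halog : WithZero.log (v a) < 0 := by
    rw [← WithZero.log_one]; exact (WithZero.log_lt_log hva one_ne_zero).2 ha
  have hJle := log_jacobian_le D₁ D₂ h₁ h₂ hab
  have hJlog : WithZero.log (v (jacobian D₁ D₂ a b)) =
      WithZero.log (v b) + WithZero.log (v (jacobian D₁ D₂ c' b)) := by
    rw [hJ, map_mul, WithZero.log_mul hvb (by simpa)]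
  have hevlog : WithZero.log (v (aevalAeval a b p)) =
      (k + l : ℕ) * WithZero.log (v b) + WithZero.log (v (aevalAeval c' b q)) := by
    rw [hev, map_mul, map_pow, WithZero.log_mul (pow_ne_zero _ hvb) hqne, WithZero.log_pow,
      nsmul_eq_mul]
  have hkln' : ((k + l : ℕ) : ℤ) ≤ n := by exact_mod_cast hkln
  suffices ((k + l : ℕ) : ℤ) * (WithZero.log (v (jacobian D₁ D₂ c' b)) + 2) ≤
      WithZero.log (v (aevalAeval c' b q)) by
    rw [hevlog]
    nlinarith
  by_cases hc : ∀ c : K, v (c' - algebraMap K F c) = 1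
  · rw [valuation_aevalAeval_eq_one v hK hc hb hq0, WithZero.log_one]
    have := log_jacobian_le D₁ D₂ h₁ h₂ hJ0
    have hc'v : v c' = 1 := by simpa using hc 0
    rw [hc'v, WithZero.log_one] at this
    apply mul_nonpos_of_nonneg_of_nonpos <;> omega
  · push Not at hc
    obtain ⟨c, hc⟩ := hc
    have hclt : v (c' - algebraMap K F c) < 1 := by
      refine lt_of_le_of_ne (v.map_sub_le hc'1 ?_) hc
      by_cases h : c = 0
      · simp [h]
      · exact (hK c h).le
    rw [← jacobian_sub_algebraMap D₁ D₂ c' b c] at hJlog hJ0 ⊢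
    rw [← aevalAeval_map_comp c' b c] at hqne ⊢
    have hne : (q.coeff 0).comp (Polynomial.X + Polynomial.C c) ≠ 0 := by
      intro h
      rw [comp_eq_zero_iff] at h
      rcases h with h | ⟨-, h⟩
      · exact hq0 h
      · simpa using congrArg natDegree h
    refine ih (N - 1) ?_ hclt hb hJ0 ?_ (i := 0)
      (j := ((q.coeff 0).comp (Polynomial.X + Polynomial.C c)).natDegree)
      ?_ ?_ (by simpa using hqne)
    · omega
    · omega
    · simpa [Polynomial.coeff_map] using hne
    · simpa [natDegree_comp] using hqdeg

end Derivation

namespace Polynomial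

theorem rootMultiplicity_add_natTrailingDegree_le {K : Type*} [Field K] {p : K[X]} (hp : p ≠ 0)
    {c : K} (hc : c ≠ 0) : p.rootMultiplicity c + p.natTrailingDegree ≤ p.natDegree := by
  have hcop : IsCoprime ((X - C c) ^ p.rootMultiplicity c) (X ^ p.natTrailingDegree) := by
    apply IsCoprime.pow
    simpa using isCoprime_X_sub_C_of_isUnit_sub (a := c) (b := 0) (by simpa using hc)
  have hdvd := hcop.mul_dvd (pow_rootMultiplicity_dvd p c)
    (X_pow_dvd_iff.2 fun d hd ↦ coeff_eq_zero_of_lt_natTrailingDegree hd)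
  have := natDegree_le_of_dvd hdvd hp
  rwa [((monic_X_sub_C c).pow _).natDegree_mul (monic_X_pow _), natDegree_X_pow,
    (monic_X_sub_C c).natDegree_pow, natDegree_X_sub_C, mul_one] at this

open Bivariate

/-- In toric coordinates `s`, `u` with `s ^ m * g = u ^ b` and `s ^ r * f = u ^ a`, a polynomial in
`g` and `f` of weighted degree `D` becomes `s ^ (-D)` times a polynomial in `u` and `s`. -/
theorem exists_toric_transform {K : Type*} [Field K] {p : MvPolynomial (Fin 2) K} (hp : p ≠ 0)
    {m r a b : ℕ} (hr : 0 < r) (hab : b * r = a * m + 1) :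
    ∃ (e : Fin 2 →₀ ℕ) (q : K[X][Y]), q.coeff 0 ≠ 0 ∧
      (∀ c : K, c ≠ 0 → m * r * (q.coeff 0).rootMultiplicity c ≤ m * e 0 + r * e 1) ∧
      ∀ {F : Type*} [Field F] [Algebra K F] {s u g f : F}, s ^ m * g = u ^ b → s ^ r * f = u ^ a →
        aevalAeval u s q = s ^ (m * e 0 + r * e 1) * MvPolynomial.aeval ![g, f] p := by
  classical
  obtain ⟨e, he, hmax⟩ := p.support.exists_max_image (fun e ↦ m * e 0 + r * e 1)
    (MvPolynomial.support_nonempty.2 hp)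
  obtain ⟨D, hD⟩ : ∃ D, D = m * e 0 + r * e 1 := ⟨_, rfl⟩
  simp only [← hD] at hmax ⊢
  have hE : ∀ x : Fin 2 →₀ ℕ, m * x 0 + r * x 1 = D → r * (b * x 0 + a * x 1) = a * D + x 0 := by
    intro x hx
    linear_combination x 0 * hab + a * hx
  let q : K[X][Y] := ∑ x ∈ p.support, monomial (D - (m * x 0 + r * x 1))
    (monomial (b * x 0 + a * x 1) (p.coeff x))
  have hq0 : ∀ k, (q.coeff 0).coeff k = ∑ x ∈ p.support,
      if m * x 0 + r * x 1 = D ∧ b * x 0 + a * x 1 = k then p.coeff x else 0 := by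
    intro k
    simp only [q, finsetSum_coeff, coeff_monomial]
    refine Finset.sum_congr rfl fun x hx ↦ ?_
    have := hmax x hx
    by_cases h : m * x 0 + r * x 1 = D
    · simp [h, coeff_monomial]
    · rw [if_neg (by omega), if_neg (by tauto), coeff_zero]
  have hne : q.coeff 0 ≠ 0 := by
    intro h
    have h1 := hq0 (b * e 0 + a * e 1)
    rw [h, coeff_zero, Finset.sum_eq_single e] at h1
    · simp [← hD] at h1
      exact MvPolynomial.mem_support_iff.1 he h1.symm
    · rintro x - hxe
      rw [if_neg]
      rintro ⟨h2, h3⟩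
      apply hxe
      have h4 := hE x h2
      rw [h3, hE e hD.symm] at h4
      have h5 : x 0 = e 0 := by omega
      have h6 : x 1 = e 1 := by
        rw [h5, hD] at h2
        exact Nat.eq_of_mul_eq_mul_left hr (by omega)
      ext i
      fin_cases i <;> assumption
    · exact fun h ↦ absurd he h
  have hsupp : ∀ k, (q.coeff 0).coeff k ≠ 0 → ∃ x : Fin 2 →₀ ℕ,
      m * x 0 + r * x 1 = D ∧ b * x 0 + a * x 1 = k := by
    intro k hk
    rw [hq0] at hk
    obtain ⟨x, -, hx⟩ := Finset.exists_ne_zero_of_sum_ne_zero hk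
    exact ⟨x, by by_contra h; simp [h] at hx⟩
  refine ⟨e, q, hne, fun c hc ↦ ?_, fun {F} _ _ {s u g f} hg hf ↦ ?_⟩
  · rw [← hD]
    have h1 := rootMultiplicity_add_natTrailingDegree_le hne hc
    obtain ⟨x, hx, hxd⟩ := hsupp (q.coeff 0).natDegree (by simpa using hne)
    obtain ⟨y, hy, hyd⟩ := hsupp (q.coeff 0).natTrailingDegree (by simpa using hne)
    have h2 := hE x hx
    have h3 := hE y hy
    rw [hxd] at h2
    rw [hyd] at h3
    have h4 := Nat.mul_le_mul_left r h1
    have h5 : r * (q.coeff 0).rootMultiplicity c ≤ x 0 := by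
      rw [mul_add] at h4; omega
    calc _ = m * (r * (q.coeff 0).rootMultiplicity c) := by ring
      _ ≤ m * x 0 := Nat.mul_le_mul_left m h5
      _ ≤ D := by omega
  · rw [← hD]
    conv_rhs => rw [p.as_sum]
    simp only [q, map_sum, Finset.mul_sum]
    refine Finset.sum_congr rfl fun x hx ↦ ?_
    obtain ⟨t, ht⟩ := Nat.exists_eq_add_of_le (hmax x hx)
    rw [MvPolynomial.aeval_monomial, Finsupp.prod_fintype _ _ (by simp), ht,
      Nat.add_sub_cancel_left, ← C_mul_X_pow_eq_monomial, ← C_mul_X_pow_eq_monomial]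
    simp only [map_mul, map_pow, aevalAeval_C, aevalAeval_Y, aeval_C, aeval_X,
      Fin.prod_univ_two, Matrix.cons_val_zero, Matrix.cons_val_one]
    rw [pow_add u, pow_mul u, pow_mul u, ← hg, ← hf]
    ring

end Polynomial

namespace Derivation

open scoped WithZero
open WithZero Polynomial Polynomial.Bivariate

variable {K F : Type*} [Field K] [Field F] [Algebra K F] (D₁ D₂ : Derivation K F F)

theorem jacobian_toric {g f : F} (hg : g ≠ 0) (hf : f ≠ 0) {m r a b : ℕ}
    (hab : b * r = a * m + 1) :
    jacobian D₁ D₂ (g ^ r / f ^ m) (g ^ a / f ^ b) * (g * f) =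
      g ^ r / f ^ m * (g ^ a / f ^ b) * -jacobian D₁ D₂ g f := by
  have key : ∀ (D : Derivation K F F) (k l : ℕ), D (g ^ k / f ^ l) * (g * f) =
      g ^ k / f ^ l * (k * f * D g - l * g * D f) := by
    intro D k l
    rw [leibniz_div, leibniz_pow, leibniz_pow]
    simp only [smul_eq_mul, nsmul_eq_mul]
    rcases k with _ | k <;> rcases l with _ | l <;> simp <;> field_simp <;> ring
  have hab' : (b : F) * r = a * m + 1 := by exact_mod_cast congrArg (Nat.cast : ℕ → F) hab
  have h0 : g * f ≠ 0 := mul_ne_zero hg hf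
  apply mul_right_cancel₀ h0
  calc _ = (D₁ (g ^ r / f ^ m) * (g * f)) * (D₂ (g ^ a / f ^ b) * (g * f)) -
        (D₂ (g ^ r / f ^ m) * (g * f)) * (D₁ (g ^ a / f ^ b) * (g * f)) := by
          simp only [jacobian]; ring
    _ = _ := by
      simp only [key]
      simp only [jacobian]
      linear_combination (-(g ^ r / f ^ m) * (g ^ a / f ^ b) * (g * f) *
        (D₁ g * D₂ f - D₂ g * D₁ f)) * hab'

theorem _root_.Nat.Coprime.eq_one_of_mul_lt {m r : ℕ} (hcop : r.Coprime m) (hr : 0 < r)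
    (hrm : r ≤ m) (h : m * r < 1 + m + r) : r = 1 := by
  by_contra hr1
  obtain ⟨r', rfl⟩ := Nat.exists_eq_add_of_le (show 2 ≤ r by omega)
  obtain ⟨m', rfl⟩ := Nat.exists_eq_add_of_le hrm
  obtain ⟨rfl, rfl⟩ : r' = 0 ∧ m' = 0 := by constructor <;> nlinarith
  simp at hcop

theorem mul_lt_of_weight_le {d m r D T : ℕ} (hT : m * r * T ≤ D) (hdD : 1 < d * D)
    (key : T * (-(d * (1 + m + r) : ℤ) + 2) ≤ 1 - d * D) : m * r < 1 + m + r := by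
  have hT' : (m * r * T : ℤ) ≤ D := by exact_mod_cast hT
  have hdD' : (1 : ℤ) < d * D := by exact_mod_cast hdD
  have hT0 : (1 : ℤ) ≤ T := by
    rcases Nat.eq_zero_or_pos T with rfl | h
    · simp at key; omega
    · exact_mod_cast h
  zify
  by_contra! h
  have h1 : (0 : ℤ) ≤ T * (d * (m * r - (1 + m + r))) := by
    have := sub_nonneg.2 h
    positivity
  have h2 := mul_le_mul_of_nonneg_left hT' (Int.natCast_nonneg d)
  linarith

/-- Let `v` be a valuation of degree type and `g`, `f` elements of degrees `d * m ≥ d * r > 1`, with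
`m` and `r` coprime, whose Jacobian has degree zero. If some polynomial in `g` and `f` has degree
one, then `r = 1` and some `c * f ^ m` has the same leading term as `g`. -/
theorem exists_valuation_div_sub_lt_one [IsAlgClosed K] {v : Valuation F ℤᵐ⁰}
    (hK : ∀ c : K, c ≠ 0 → v (algebraMap K F c) = 1)
    (h₁ : ∀ a, v (D₁ a) ≤ v a * exp (-1)) (h₂ : ∀ a, v (D₂ a) ≤ v a * exp (-1))
    {g f : F} {d m r : ℕ} (hg : v g = exp ((d * m : ℕ) : ℤ)) (hf : v f = exp ((d * r : ℕ) : ℤ))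
    (hr : 1 < d * r) (hrm : r ≤ m) (hcop : r.Coprime m) (hJ : v (jacobian D₁ D₂ g f) = 1)
    {p : MvPolynomial (Fin 2) K} (hp : v (MvPolynomial.aeval ![g, f] p) = exp 1) :
    r = 1 ∧ ∃ c : K, v (g / f ^ m - algebraMap K F c) < 1 := by
  have hd : 0 < d := Nat.pos_of_ne_zero (by rintro rfl; simp at hr)
  have hr0 : 0 < r := Nat.pos_of_ne_zero (by rintro rfl; simp at hr)
  have hp0 : p ≠ 0 := by rintro rfl; exact exp_ne_zero (by rw [← hp, map_zero, map_zero])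
  have hg0 : g ≠ 0 := by rintro rfl; exact exp_ne_zero (by rw [← hg, map_zero])
  have hf0 : f ≠ 0 := by rintro rfl; exact exp_ne_zero (by rw [← hf, map_zero])
  obtain ⟨a, b, hab⟩ : ∃ a b : ℕ, b * r = a * m + 1 := by
    rcases hrm.lt_or_eq with h | h
    · obtain ⟨b, -, hb⟩ := Nat.exists_mul_mod_eq_one_of_coprime hcop (by omega)
      exact ⟨r * b / m, b, by rw [mul_comm b, ← hb, Nat.div_add_mod']⟩
    · obtain rfl : r = 1 := by rwa [← h, Nat.coprime_self] at hcop
      exact ⟨0, 1, by simp⟩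
  obtain ⟨e, q, hq0, hmult, hev⟩ := exists_toric_transform hp0 hr0 hab
  obtain ⟨D, hD⟩ : ∃ D, D = m * e 0 + r * e 1 := ⟨_, rfl⟩
  simp only [← hD] at hmult hev
  obtain ⟨s, hs⟩ : ∃ s, s = g ^ a / f ^ b := ⟨_, rfl⟩
  obtain ⟨u, hu⟩ : ∃ u, u = g ^ r / f ^ m := ⟨_, rfl⟩
  have hab' : (b * r : ℤ) = a * m + 1 := by exact_mod_cast hab
  have hvs : v s = exp (-d : ℤ) := by
    rw [hs, map_div₀, map_pow, map_pow, hg, hf, ← exp_nsmul, ← exp_nsmul, ← exp_sub]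
    congr 1
    simp only [nsmul_eq_mul]
    push_cast
    linear_combination -(d : ℤ) * hab'
  have hvu : v u = 1 := by
    rw [hu, map_div₀, map_pow, map_pow, hg, hf, ← exp_nsmul, ← exp_nsmul, ← exp_sub, ← exp_zero]
    congr 1
    simp only [nsmul_eq_mul]
    push_cast
    ring
  have hs1 : v s < 1 := by
    rw [hvs, ← exp_zero, exp_lt_exp]; omega
  have hsg : s ^ m * g = u ^ b := by
    rw [hs, hu, div_pow, div_pow, ← pow_mul, ← pow_mul, ← pow_mul, ← pow_mul, div_mul_eq_mul_div,
      ← pow_succ, mul_comm r, hab, mul_comm b m]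
  have hsf : s ^ r * f = u ^ a := by
    rw [hs, hu, div_pow, div_pow, ← pow_mul, ← pow_mul, ← pow_mul, ← pow_mul, hab, pow_succ,
      mul_comm r a, mul_comm m a]
    field_simp
  have hevq := hev hsg hsf
  have hvq : v (aevalAeval u s q) = exp (1 - d * D : ℤ) := by
    rw [hevq, map_mul, map_pow, hvs, hp, ← exp_nsmul, ← exp_add]
    congr 1
    simp only [nsmul_eq_mul]
    ring
  have hqne : aevalAeval u s q ≠ 0 := by
    intro h; exact exp_ne_zero (by rw [← hvq, h, map_zero])
  have hK' : ∀ c : K, v (algebraMap K F c) ≤ 1 := fun c ↦ by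
    by_cases h : c = 0
    · simp [h]
    · exact (hK c h).le
  have hdD : 1 < d * D := by
    by_contra! h
    have h1 : d * r ≤ d * m := Nat.mul_le_mul_left d hrm
    have h2 : d * D = d * m * e 0 + d * r * e 1 := by rw [hD]; ring
    have h3 : d * D = 0 := by
      rcases Nat.eq_zero_or_pos (e 0) with h4 | h4 <;>
        rcases Nat.eq_zero_or_pos (e 1) with h5 | h5 <;> first | simp [h2, h4, h5]; done | nlinarith
    have h4 := valuation_aevalAeval_le_one v hK' hvu.le hs1.le q
    rw [hvq, ← exp_zero, exp_le_exp] at h4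
    have : (d : ℤ) * D = 0 := by exact_mod_cast h3
    omega
  have hc : ∃ c : K, v (u - algebraMap K F c) < 1 := by
    by_contra! h
    have h1 := valuation_aevalAeval_eq_one v hK (x := u) (y := s) (fun c ↦ le_antisymm
      (v.map_sub_le hvu.le (hK' c)) (h c)) hs1 hq0
    rw [hvq, exp_eq_one] at h1
    have : (1 : ℤ) < d * D := by exact_mod_cast hdD
    omega
  obtain ⟨c, hc⟩ := hc
  suffices r = 1 by
    subst this
    exact ⟨rfl, c, by simpa [hu] using hc⟩
  have hc0 : c ≠ 0 := by rintro rfl; simp [hvu] at hc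
  have hJt := jacobian_toric D₁ D₂ hg0 hf0 hab
  rw [← hs, ← hu] at hJt
  have hJus : v (jacobian D₁ D₂ u s) = exp (-(d * (1 + m + r)) : ℤ) := by
    have := congrArg v hJt
    rw [map_mul, map_mul, map_mul, map_mul, v.map_neg, hvu, hvs, hJ, hg, hf, one_mul, mul_one,
      ← exp_add] at this
    rw [eq_div_of_mul_eq exp_ne_zero this, ← exp_sub]
    congr 1
    push_cast
    ring
  have key := log_aevalAeval_ge D₁ D₂ hK h₁ h₂ (d * (1 + m + r)) (a := u - algebraMap K F c)
    (b := s) hc hs1 (by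
      rw [jacobian_sub_algebraMap]; intro h; exact exp_ne_zero (by rw [← hJus, h, map_zero]))
    (by rw [jacobian_sub_algebraMap, hJus, log_exp]; push_cast; omega)
    (p := q.map (compRingHom (Polynomial.X + Polynomial.C c)))
    (i := 0) (j := (q.coeff 0).rootMultiplicity c) (n := (q.coeff 0).rootMultiplicity c)
    (by
      rw [Polynomial.coeff_map, rootMultiplicity_eq_natTrailingDegree, coe_compRingHom_apply]
      refine trailingCoeff_nonzero_iff_nonzero.2 fun h ↦ ?_
      rw [comp_eq_zero_iff] at h
      rcases h with h | ⟨-, h⟩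
      · exact hq0 h
      · simpa using congrArg natDegree h) (by omega)
    (by rwa [aevalAeval_map_comp])
  rw [aevalAeval_map_comp, jacobian_sub_algebraMap, hJus, hvq, log_exp, log_exp] at key
  have hT := hmult c hc0
  refine hcop.eq_one_of_mul_lt hr0 hrm ?_
  exact mul_lt_of_weight_le hT hdD (by linear_combination key)

end Derivation

namespace MvPolynomial

open scoped WithZero
open WithZero

section DegreeValuation

variable (σ K : Type*) [Field K]

open Classical in
/-- The valuation of the polynomial ring given by the total degree. -/
noncomputable def degreeValuation : Valuation (MvPolynomial σ K) ℤᵐ⁰ where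
  toFun p := if p = 0 then 0 else exp (p.totalDegree : ℤ)
  map_zero' := by simp
  map_one' := by simp
  map_mul' p q := by
    by_cases hp : p = 0
    · simp [hp]
    by_cases hq : q = 0
    · simp [hq]
    simp [hp, hq, totalDegree_mul_of_isDomain hp hq, exp_add]
  map_add_le_max' p q := by
    by_cases hp : p = 0
    · simp [hp]
    by_cases hq : q = 0
    · simp [hq]
    by_cases hpq : p + q = 0
    · simp [hpq]
    simpa [hp, hq, hpq] using totalDegree_add p q

variable {σ K}

theorem degreeValuation_apply {p : MvPolynomial σ K} (hp : p ≠ 0) :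
    degreeValuation σ K p = exp (p.totalDegree : ℤ) := by
  simp [degreeValuation, hp]

theorem degreeValuation_eq_zero_iff {p : MvPolynomial σ K} :
    degreeValuation σ K p = 0 ↔ p = 0 := by
  by_cases hp : p = 0
  · simp [hp]
  · simp [hp, degreeValuation_apply hp]

theorem degreeValuation_monomial_le {p : MvPolynomial σ K} {e : σ →₀ ℕ} (he : e ∈ p.support)
    (i : σ) (c : K) : degreeValuation σ K (monomial (e - Finsupp.single i 1) (c * e i)) ≤
      degreeValuation σ K p * exp (-1) := by
  have hp : p ≠ 0 := by rintro rfl; simp at he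
  by_cases h0 : monomial (e - Finsupp.single i 1) (c * e i) = 0
  · simp [h0]
  rw [degreeValuation_apply h0, degreeValuation_apply hp, ← exp_add, exp_le_exp,
    totalDegree_monomial _ (by simpa using h0)]
  have hei : Finsupp.single i 1 ≤ e := by
    rw [Finsupp.single_le_iff]
    by_contra h
    exact h0 (by simp [show e i = 0 by omega])
  have h1 : e.degree ≤ p.totalDegree := le_totalDegree he
  have h2 : (e - Finsupp.single i 1).degree + 1 = e.degree := by
    conv_rhs => rw [← tsub_add_cancel_of_le hei]
    simp
  change (((e - Finsupp.single i 1).degree : ℕ) : ℤ) ≤ _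
  omega

theorem degreeValuation_pderiv_le (i : σ) (p : MvPolynomial σ K) :
    degreeValuation σ K (pderiv i p) ≤ degreeValuation σ K p * exp (-1) := by
  conv_lhs => rw [p.as_sum, map_sum]
  refine Valuation.map_sum_le _ fun e he ↦ ?_
  rw [pderiv_monomial]
  exact degreeValuation_monomial_le he i _

end DegreeValuation

end MvPolynomial

namespace Derivation

open scoped WithZero TensorProduct
open WithZero KaehlerDifferential

variable {K A F : Type*} [CommRing K] [CommRing A] [Field F] [Algebra K F] [Algebra A F]
  [IsFractionRing A F]

theorem exists_extension_fractionRing [Algebra K A] [IsScalarTower K A F] (D : Derivation K A A) :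
    ∃ D' : Derivation K F F, ∀ a, D' (algebraMap A F a) = algebraMap A F (D a) := by
  have : Algebra.FormallyEtale A F := .of_isLocalization (nonZeroDivisors A)
  let l : Ω[A⁄K] →ₗ[A] F := Algebra.linearMap A F ∘ₗ D.liftKaehlerDifferential
  refine ⟨((l.liftBaseChange F) ∘ₗ
    (tensorKaehlerEquivOfFormallyEtale K A F).symm.toLinearMap).compDer (KaehlerDifferential.D K F),
    fun a ↦ ?_⟩
  simp [l, tensorKaehlerEquivOfFormallyEtale_symm_D_algebraMap]

theorem valuation_le_of_isFractionRing {v : Valuation F ℤᵐ⁰} {D : Derivation K F F} {w : ℤᵐ⁰}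
    (h : ∀ a : A, v (D (algebraMap A F a)) ≤ v (algebraMap A F a) * w) (x : F) :
    v (D x) ≤ v x * w := by
  obtain ⟨a, b, hb, rfl⟩ := IsFractionRing.div_surjective (A := A) x
  have hb0 : v (algebraMap A F b) ≠ 0 := by
    rw [v.ne_zero_iff]
    have := (algebraMap A F).domain_nontrivial
    exact IsFractionRing.to_map_ne_zero_of_mem_nonZeroDivisors hb
  generalize hx : algebraMap A F a = x at *
  generalize hy : algebraMap A F b = y at *
  have hx' := h a
  have hy' := h b
  rw [hx] at hx'
  rw [hy] at hy'
  rw [leibniz_div, smul_eq_mul, map_mul]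
  calc _ ≤ v (y⁻¹ ^ 2) * (v x * v y * w) := by
        gcongr
        refine v.map_sub_le ?_ ?_ <;> rw [smul_eq_mul, map_mul]
        · calc _ ≤ v y * (v x * w) := by gcongr
            _ = _ := by rw [mul_left_comm, mul_assoc]
        · calc _ ≤ v x * (v y * w) := by gcongr
            _ = _ := (mul_assoc ..).symm
    _ = v (x / y) * w := by
        rw [map_div₀, map_pow, map_inv₀]
        field_simp

end Derivation

namespace MvPolynomial

theorem pderiv_aeval {K : Type*} [CommRing K] (g f P : MvPolynomial (Fin 2) K) (i : Fin 2) :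
    pderiv i (aeval ![g, f] P) = aeval ![g, f] (pderiv 0 P) * pderiv i g +
      aeval ![g, f] (pderiv 1 P) * pderiv i f := by
  induction P using MvPolynomial.induction_on with
  | C a => simp
  | add p q hp hq => simp only [map_add, hp, hq]; ring
  | mul_X p j hp =>
    rw [map_mul, pderiv_mul, hp]
    fin_cases j <;> simp <;> ring

theorem isUnit_jacobian_of_surjective {K : Type*} [CommRing K] {g f : MvPolynomial (Fin 2) K}
    (h : Function.Surjective (aeval (R := K) ![g, f])) :
    IsUnit (pderiv 0 g * pderiv 1 f - pderiv 1 g * pderiv 0 f) := by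
  obtain ⟨P, hP⟩ := h (X 0)
  obtain ⟨Q, hQ⟩ := h (X 1)
  refine IsUnit.of_mul_eq_one_right
    (aeval ![g, f] (pderiv 0 P * pderiv 1 Q - pderiv 1 P * pderiv 0 Q)) ?_
  have h1 := fun i ↦ pderiv_aeval g f P i
  have h2 := fun i ↦ pderiv_aeval g f Q i
  rw [hP] at h1
  rw [hQ] at h2
  calc _ = pderiv 0 (X 0 : MvPolynomial (Fin 2) K) * pderiv 1 (X 1) -
        pderiv 1 (X 0 : MvPolynomial (Fin 2) K) * pderiv 0 (X 1) := by
        rw [h1, h1, h2, h2]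
        simp only [map_sub, map_mul]
        ring
    _ = 1 := by simp

theorem aeval_sub_C_mul_pow_bijective {K : Type*} [CommRing K] {g f : MvPolynomial (Fin 2) K}
    (h : Function.Bijective (aeval (R := K) ![g, f])) (c : K) (N : ℕ) :
    Function.Bijective (aeval (R := K) ![g - C c * f ^ N, f]) := by
  let φ (c : K) : MvPolynomial (Fin 2) K →ₐ[K] MvPolynomial (Fin 2) K :=
    aeval ![X 0 - C c * X 1 ^ N, X 1]
  have hφ : ∀ c, (φ c).comp (φ (-c)) = AlgHom.id K _ := by
    intro c
    ext i : 1
    fin_cases i <;> simp [φ]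
  have h1 : aeval (R := K) ![g - C c * f ^ N, f] = (aeval ![g, f]).comp (φ c) := by
    ext i : 1
    fin_cases i <;> simp [φ]
  rw [h1, AlgHom.coe_comp]
  refine h.comp (Function.bijective_iff_has_inverse.2 ⟨φ (-c), fun x ↦ ?_, fun x ↦ ?_⟩)
  · simpa using DFunLike.congr_fun (hφ (-c)) x
  · exact DFunLike.congr_fun (hφ c) x

open scoped WithZero
open WithZero

/-- A pair of polynomials generating the polynomial ring in two variables has degrees dividing one
another, and the leading form of the one is proportional to a power of that of the other. -/
theorem exists_totalDegree_sub_lt {K : Type*} [Field K] [IsAlgClosed K]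
    {g f : MvPolynomial (Fin 2) K} (h : Function.Surjective (aeval (R := K) ![g, f]))
    (hdeg : 1 < f.totalDegree) (hge : f.totalDegree ≤ g.totalDegree) :
    f.totalDegree ∣ g.totalDegree ∧ ∃ c : K,
      (g - C c * f ^ (g.totalDegree / f.totalDegree)).totalDegree < g.totalDegree := by
  let F := FractionRing (MvPolynomial (Fin 2) K)
  let v : Valuation F ℤᵐ⁰ := (degreeValuation (Fin 2) K).extendToLocalization
    (S := nonZeroDivisors (MvPolynomial (Fin 2) K)) (fun p hp ↦ by
      simpa [Ideal.primeCompl, Valuation.mem_supp_iff, degreeValuation_eq_zero_iff] using hp) F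
  have hv : ∀ p, v (algebraMap _ F p) = degreeValuation (Fin 2) K p := fun p ↦
    Valuation.extendToLocalization_apply_map_apply ..
  have hK : ∀ c : K, c ≠ 0 → v (algebraMap K F c) = 1 := by
    intro c hc
    rw [IsScalarTower.algebraMap_apply K (MvPolynomial (Fin 2) K) F, hv, algebraMap_eq,
      degreeValuation_apply (by simpa)]
    simp
  obtain ⟨D₁, hD₁⟩ := (pderiv (R := K) (0 : Fin 2)).exists_extension_fractionRing (F := F)
  obtain ⟨D₂, hD₂⟩ := (pderiv (R := K) (1 : Fin 2)).exists_extension_fractionRing (F := F)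
  have h₁ := D₁.valuation_le_of_isFractionRing (v := v) (A := MvPolynomial (Fin 2) K)
    (w := exp (-1)) fun p ↦ by rw [hD₁, hv, hv]; exact degreeValuation_pderiv_le ..
  have h₂ := D₂.valuation_le_of_isFractionRing (v := v) (A := MvPolynomial (Fin 2) K)
    (w := exp (-1)) fun p ↦ by rw [hD₂, hv, hv]; exact degreeValuation_pderiv_le ..
  have hJ : v (Derivation.jacobian D₁ D₂ (algebraMap _ F g) (algebraMap _ F f)) = 1 := by
    obtain ⟨c, hc, hJ⟩ := isUnit_iff_eq_C_of_isReduced.1 (isUnit_jacobian_of_surjective h)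
    rw [Derivation.jacobian, hD₁, hD₁, hD₂, hD₂, ← map_mul, ← map_mul, ← map_sub, hJ,
      ← algebraMap_eq, ← IsScalarTower.algebraMap_apply, hK c hc.ne_zero]
  have hf0 : f ≠ 0 := by rintro rfl; simp at hdeg
  have hg0 : g ≠ 0 := by rintro rfl; simp at hge; omega
  obtain ⟨P, hP⟩ := h (X 0)
  have hP' : v (aeval ![algebraMap _ F g, algebraMap _ F f] P) = exp 1 := by
    have h1 : aeval ![algebraMap _ F g, algebraMap _ F f] P =
        algebraMap _ F (aeval ![g, f] P) := by
      rw [← aeval_algebraMap_apply]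
      congr 2
      ext i
      fin_cases i <;> rfl
    rw [h1, hP, hv, degreeValuation_apply (X_ne_zero _), totalDegree_X, Nat.cast_one]
  obtain ⟨d, hd⟩ : ∃ d, d = f.totalDegree.gcd g.totalDegree := ⟨_, rfl⟩
  have hd0 : 0 < d := hd ▸ Nat.gcd_pos_of_pos_left _ (by omega)
  obtain ⟨r, m, hcop, hr, hm⟩ := Nat.exists_coprime f.totalDegree g.totalDegree
  rw [← hd, mul_comm] at hr hm
  obtain ⟨rfl, c, hc⟩ := Derivation.exists_valuation_div_sub_lt_one D₁ D₂ hK h₁ h₂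
    (g := algebraMap _ F g) (f := algebraMap _ F f) (d := d) (m := m) (r := r)
    (by rw [hv, degreeValuation_apply hg0, hm]) (by rw [hv, degreeValuation_apply hf0, hr])
    (by omega) (Nat.le_of_mul_le_mul_left (by omega) hd0) hcop hJ hP'
  rw [mul_one] at hr
  have hN : g.totalDegree / f.totalDegree = m := by rw [hm, hr, Nat.mul_div_cancel_left _ hd0]
  refine ⟨⟨m, by rw [hm, hr]⟩, c, ?_⟩
  rw [hN]
  by_cases h0 : g - C c * f ^ m = 0
  · rw [h0, totalDegree_zero]; omega
  have hfF : algebraMap _ F f ≠ 0 := by simpa using hf0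
  have key : v (algebraMap _ F (g - C c * f ^ m)) < v (algebraMap _ F f) ^ m := by
    have h1 : algebraMap _ F (g - C c * f ^ m) =
        (algebraMap _ F g / algebraMap _ F f ^ m - algebraMap K F c) * algebraMap _ F f ^ m := by
      rw [map_sub, map_mul, map_pow, ← algebraMap_eq, ← IsScalarTower.algebraMap_apply, sub_mul,
        div_mul_cancel₀ _ (pow_ne_zero m hfF)]
    rw [h1, map_mul, map_pow]
    exact mul_lt_of_lt_one_left (pow_pos (by simpa [zero_lt_iff] using hfF) m) hc
  rw [hv, hv, degreeValuation_apply h0, degreeValuation_apply hf0, ← exp_nsmul, exp_lt_exp,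
    nsmul_eq_mul] at key
  rw [hm, ← hr, mul_comm f.totalDegree]
  exact_mod_cast key

end MvPolynomial

/-- If `(g, f)` is a polynomial automorphism of `K²` with
`deg g ≥ deg f > 1`, then `N = deg g / deg f` is a positive integer and there is
`c ∈ K` such that `deg (g - c f ^ N) < deg g` and `(g - c f ^ N, f)` is again a
polynomial automorphism of `K²`. -/
theorem stmt_9 {K : Type*} [Field K] [IsAlgClosed K]
    (g f : MvPolynomial (Fin 2) K)
    (hauto : Function.Bijective
      (MvPolynomial.aeval (R := K) (S₁ := MvPolynomial (Fin 2) K) ![g, f]))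
    (hdeg : 1 < f.totalDegree) (hge : f.totalDegree ≤ g.totalDegree) :
    f.totalDegree ∣ g.totalDegree ∧ 0 < g.totalDegree / f.totalDegree ∧
    ∃ c : K,
      (g - MvPolynomial.C c * f ^ (g.totalDegree / f.totalDegree)).totalDegree
          < g.totalDegree ∧
      Function.Bijective
        (MvPolynomial.aeval (R := K) (S₁ := MvPolynomial (Fin 2) K)
          ![g - MvPolynomial.C c * f ^ (g.totalDegree / f.totalDegree), f]) := by
  obtain ⟨hdvd, c, hc⟩ := exists_totalDegree_sub_lt hauto.2 hdeg hge
  exact ⟨hdvd, Nat.div_pos hge (by omega), c, hc, aeval_sub_C_mul_pow_bijective hauto c _⟩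
end

section
/- Let K be an algebraically closed field and let f ∈ K[x, y] with deg f = n > 1 be such that (g, f) is a polynomial automorphism of K² for some g. Then there exist an integer h ≥ 1 and polynomials f_1, f_2, ..., f_{h+1} = f in K[x, y] such that deg f_1 = 1, deg f_k < deg f_{k+1} and deg f_k divides deg f_{k+1} for 1 ≤ k ≤ h, and (f_k, f_{k+1}) is a polynomial automorphism of K² for every 1 ≤ k ≤ h. -/
open MvPolynomial

section LeadingForm

variable {K σ τ M : Type*} [CommRing K] [AddCommGroup M]

theorem component_one (w : σ → M) :
    weightedHomogeneousComponent w 0 (1 : MvPolynomial σ K) = 1 :=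
  (isWeightedHomogeneous_one K w).weightedHomogeneousComponent_same

theorem component_X (w : σ → M) (i : σ) :
    weightedHomogeneousComponent w (w i) (X i : MvPolynomial σ K) = X i :=
  (isWeightedHomogeneous_X K w i).weightedHomogeneousComponent_same

variable [LinearOrder M]

/-- All monomials of `p` have `w`-weight at most `D`. -/
def WeightLE (w : σ → M) (D : M) (p : MvPolynomial σ K) : Prop :=
  ∀ d, coeff d p ≠ 0 → Finsupp.weight w d ≤ D

theorem WeightLE.component_eq_zero {w : σ → M} {D E : M} {p : MvPolynomial σ K}
    (hp : WeightLE w D p) (h : D < E) : weightedHomogeneousComponent w E p = 0 := by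
  classical
  ext d
  rw [coeff_weightedHomogeneousComponent, coeff_zero, ite_eq_right_iff]
  intro hd
  by_contra hc
  exact absurd (hp d hc) (by rw [hd]; exact h.not_ge)

theorem weightLE_one (w : σ → M) : WeightLE w 0 (1 : MvPolynomial σ K) := by
  classical
  intro d hd
  rw [coeff_one] at hd
  obtain rfl : 0 = d := by by_contra h; simp [h] at hd
  simp

theorem weightLE_X (w : σ → M) (i : σ) : WeightLE w (w i) (X i : MvPolynomial σ K) := by
  intro d hd
  rw [← isWeightedHomogeneous_X K w i hd]

variable [IsOrderedAddMonoid M]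

theorem WeightLE.mul {w : σ → M} {D E : M} {p q : MvPolynomial σ K}
    (hp : WeightLE w D p) (hq : WeightLE w E q) : WeightLE w (D + E) (p * q) := by
  classical
  intro d hd
  rw [coeff_mul] at hd
  obtain ⟨⟨x, y⟩, hxy, h⟩ := Finset.exists_ne_zero_of_sum_ne_zero hd
  rw [Finset.HasAntidiagonal.mem_antidiagonal] at hxy
  rw [← hxy, map_add]
  exact add_le_add (hp _ (left_ne_zero_of_mul h)) (hq _ (right_ne_zero_of_mul h))

theorem WeightLE.component_mul {w : σ → M} {D E : M} {p q : MvPolynomial σ K}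
    (hp : WeightLE w D p) (hq : WeightLE w E q) :
    weightedHomogeneousComponent w (D + E) (p * q) =
      weightedHomogeneousComponent w D p * weightedHomogeneousComponent w E q := by
  classical
  ext d
  rw [coeff_weightedHomogeneousComponent, coeff_mul, coeff_mul]
  trans ∑ x ∈ Finset.HasAntidiagonal.antidiagonal d,
    if Finsupp.weight w d = D + E then coeff x.1 p * coeff x.2 q else 0
  · split_ifs <;> simp
  refine Finset.sum_congr rfl fun ⟨x, y⟩ hxy ↦ ?_
  rw [Finset.HasAntidiagonal.mem_antidiagonal] at hxy
  simp only [coeff_weightedHomogeneousComponent]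
  rw [← hxy, map_add]
  by_cases hx : coeff x p = 0
  · simp [hx]
  by_cases hy : coeff y q = 0
  · simp [hy]
  have h1 := hp x hx
  have h2 := hq y hy
  simp only [add_eq_add_iff_eq_and_eq h1 h2]
  by_cases h3 : Finsupp.weight w x = D <;> by_cases h4 : Finsupp.weight w y = E <;> simp [h3, h4]

theorem WeightLE.pow {w : σ → M} {D : M} {p : MvPolynomial σ K} (hp : WeightLE w D p) (n : ℕ) :
    WeightLE w (n • D) (p ^ n) ∧ weightedHomogeneousComponent w (n • D) (p ^ n) =
      weightedHomogeneousComponent w D p ^ n := by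
  induction n with
  | zero => simp [weightLE_one, component_one]
  | succ n ih =>
    rw [succ_nsmul, pow_succ, pow_succ, ← ih.2]
    exact ⟨ih.1.mul hp, ih.1.component_mul hp⟩

theorem WeightLE.prod {ι : Type*} {w : σ → M} {D : ι → M} {p : ι → MvPolynomial σ K}
    (s : Finset ι) (hp : ∀ i, WeightLE w (D i) (p i)) :
    WeightLE w (∑ i ∈ s, D i) (∏ i ∈ s, p i) ∧
      weightedHomogeneousComponent w (∑ i ∈ s, D i) (∏ i ∈ s, p i) =
      ∏ i ∈ s, weightedHomogeneousComponent w (D i) (p i) := by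
  classical
  induction s using Finset.induction_on with
  | empty => simp [weightLE_one, component_one]
  | insert i s hi ih =>
    rw [Finset.sum_insert hi, Finset.prod_insert hi, Finset.prod_insert hi, ← ih.2]
    exact ⟨(hp i).mul ih.1, (hp i).component_mul ih.1⟩

/-- Taking leading forms commutes with substitution, provided the weights are compatible. -/
theorem WeightLE.component_aeval {w : σ → M} {w' : τ → M} {D : M} {p : MvPolynomial σ K}
    {F : σ → MvPolynomial τ K} (hp : WeightLE w D p) (hF : ∀ i, WeightLE w' (w i) (F i)) :
    weightedHomogeneousComponent w' D (aeval F p) =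
      aeval (fun i ↦ weightedHomogeneousComponent w' (w i) (F i))
        (weightedHomogeneousComponent w D p) := by
  classical
  rw [weightedHomogeneousComponent_apply D p]
  conv_lhs => rw [p.as_sum]
  rw [map_sum, map_sum, map_sum, Finset.sum_filter]
  refine Finset.sum_congr rfl fun d hd ↦ ?_
  have key := WeightLE.prod (w := w') (D := fun i ↦ d i • w i) (p := fun i ↦ F i ^ d i) d.support
    fun i ↦ ((hF i).pow _).1
  have hw : ∑ i ∈ d.support, d i • w i = Finsupp.weight w d := by
    rw [Finsupp.weight_apply]; rfl
  rw [hw] at key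
  rw [aeval_monomial, ← C_eq_algebraMap, weightedHomogeneousComponent_C_mul, Finsupp.prod]
  split_ifs with h
  · rw [← h, key.2, aeval_monomial, ← C_eq_algebraMap, Finsupp.prod]
    simp only [((hF _).pow _).2]
  · rw [key.1.component_eq_zero ((hp d (mem_support_iff.mp hd)).lt_of_ne h), mul_zero]

end LeadingForm

/-- A binary form over an algebraically closed field is a product of linear forms. -/
theorem exists_factorization_of_isHomogeneous {K : Type*} [Field K] [IsAlgClosed K]
    {q : MvPolynomial (Fin 2) K} {N : ℕ} (hq : q.IsHomogeneous N) (h0 : q ≠ 0) :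
    ∃ (κ : K) (j : ℕ) (s : Multiset K), κ ≠ 0 ∧
      q = C κ * X 1 ^ j * (s.map fun c ↦ X 0 - C c * X 1).prod := by
  set p : Polynomial K := aeval ![Polynomial.X, 1] q with hp
  have hpq : p.homogenize N = q := Polynomial.homogenize_eq_of_isHomogeneous hq hp.symm
  have hp0 : p ≠ 0 := by
    rintro h
    rw [h, Polynomial.homogenize_zero] at hpq
    exact h0 hpq.symm
  have hdeg : p.natDegree ≤ N := by
    by_contra! hlt
    have : p.coeff p.natDegree = 0 := by
      generalize p.natDegree = n at hlt
      rw [hp, aeval_def, eval₂_eq', Polynomial.finsetSum_coeff]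
      refine Finset.sum_eq_zero fun d hd ↦ ?_
      have h1 := hq (mem_support_iff.mp hd)
      have h2 : d 0 + d 1 = N := by
        rw [← h1]
        simp [Finsupp.weight_apply, Finsupp.sum_fintype, Fin.sum_univ_two]
      rw [Fin.prod_univ_two]
      simp only [Matrix.cons_val_zero, Matrix.cons_val_one, one_pow, mul_one]
      rw [← Polynomial.C_eq_algebraMap, Polynomial.coeff_C_mul, Polynomial.coeff_X_pow,
        if_neg (by omega), mul_zero]
    exact hp0 (Polynomial.leadingCoeff_eq_zero.mp this)
  have hsplit := (IsAlgClosed.splits p).eq_prod_roots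
  have hcard : p.roots.card = p.natDegree := (IsAlgClosed.splits p).natDegree_eq_card_roots.symm
  have key : ∀ s : Multiset K, ((s.map fun c ↦ Polynomial.X - Polynomial.C c).prod).homogenize
      s.card = (s.map fun c ↦ (X 0 - C c * X 1 : MvPolynomial (Fin 2) K)).prod := by
    intro s
    induction s using Multiset.induction_on with
    | empty => simp
    | cons c s ih =>
      rw [Multiset.map_cons, Multiset.prod_cons, Multiset.map_cons, Multiset.prod_cons,
        Multiset.card_cons, add_comm, Polynomial.homogenize_mul _ _ (by simp) (by simp), ih]
      simp [Polynomial.homogenize_sub]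
  refine ⟨p.leadingCoeff, N - p.natDegree, p.roots,
    Polynomial.leadingCoeff_ne_zero.mpr hp0, ?_⟩
  rw [← key, hcard, ← hpq]
  conv_lhs => rw [hsplit, show N = (N - p.natDegree) + p.natDegree by omega]
  rw [Polynomial.homogenize_mul _ _ (by simp) (by simp [hcard]), Polynomial.homogenize_C]

/-- A weighted homogeneous polynomial in two variables over an algebraically closed field is a
product of variables and binomials. -/
theorem exists_factorization_of_weighted {K : Type*} [Field K] [IsAlgClosed K]
    {p : MvPolynomial (Fin 2) K} (h0 : p ≠ 0) {a b D : ℕ} (ha : 0 < a) (hb : 0 < b)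
    (hab : a.Coprime b)
    (hp : ∀ d, coeff d p ≠ 0 → b * d 0 + a * d 1 = D) :
    ∃ (κ : K) (i j : ℕ) (s : Multiset K), κ ≠ 0 ∧
      p = C κ * X 0 ^ i * X 1 ^ j * (s.map fun c ↦ X 0 ^ a - C c * X 1 ^ b).prod := by
  classical
  obtain ⟨e, he⟩ := ne_zero_iff.mp h0
  have hmod : ∀ d, coeff d p ≠ 0 → d 0 % a = e 0 % a ∧ d 1 % b = e 1 % b ∧
      d 0 / a + d 1 / b = e 0 / a + e 1 / b := by
    intro d hd
    have h := (hp d hd).trans (hp e he).symm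
    have h1 : d 0 ≡ e 0 [MOD a] := by
      refine Nat.ModEq.cancel_left_of_coprime (c := b) hab ?_
      have h2 : b * d 0 + a * d 1 ≡ b * e 0 + a * e 1 [MOD a] := by rw [h]
      simpa [Nat.ModEq] using h2
    have h2 : d 1 ≡ e 1 [MOD b] := by
      refine Nat.ModEq.cancel_left_of_coprime (c := a) hab.symm ?_
      have h2 : b * d 0 + a * d 1 ≡ b * e 0 + a * e 1 [MOD b] := by rw [h]
      simpa [Nat.ModEq] using h2
    refine ⟨h1, h2, ?_⟩
    have e1 := Nat.mod_add_div (d 0) a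
    have e2 := Nat.mod_add_div (e 0) a
    have e3 := Nat.mod_add_div (d 1) b
    have e4 := Nat.mod_add_div (e 1) b
    rw [show d 0 % a = e 0 % a from h1] at e1
    rw [show d 1 % b = e 1 % b from h2] at e3
    have h3 : b * (e 0 % a + a * (d 0 / a)) + a * (e 1 % b + b * (d 1 / b)) =
        b * (e 0 % a + a * (e 0 / a)) + a * (e 1 % b + b * (e 1 / b)) := by
      rw [e1, e2, e3, e4, h]
    have : (a * b) * (d 0 / a + d 1 / b) = (a * b) * (e 0 / a + e 1 / b) := by
      linarith
    exact Nat.eq_of_mul_eq_mul_left (by positivity) this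
  set q : MvPolynomial (Fin 2) K := ∑ d ∈ p.support,
    C (coeff d p) * (X 0 ^ (d 0 / a) * X 1 ^ (d 1 / b)) with hq
  have hpq : p = X 0 ^ (e 0 % a) * X 1 ^ (e 1 % b) * aeval ![X 0 ^ a, X 1 ^ b] q := by
    conv_lhs => rw [p.as_sum]
    rw [hq, map_sum, Finset.mul_sum]
    refine Finset.sum_congr rfl fun d hd ↦ ?_
    obtain ⟨h1, h2, -⟩ := hmod d (mem_support_iff.mp hd)
    rw [monomial_eq, Finsupp.prod_fintype _ _ fun _ ↦ pow_zero _, Fin.prod_univ_two]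
    have e1 := Nat.mod_add_div (d 0) a
    have e2 := Nat.mod_add_div (d 1) b
    rw [h1] at e1
    rw [h2] at e2
    conv_lhs => rw [← e1, ← e2]
    simp only [map_mul, map_pow, aeval_X, algHom_C, ← C_eq_algebraMap, Matrix.cons_val_zero,
      Matrix.cons_val_one, pow_add, pow_mul]
    ring
  have hq0 : q ≠ 0 := by
    intro h
    exact h0 (by rw [hpq, h, map_zero (aeval _), mul_zero])
  have hqh : q.IsHomogeneous (e 0 / a + e 1 / b) := by
    refine IsHomogeneous.sum _ _ _ fun d hd ↦ ?_
    rw [← (hmod d (mem_support_iff.mp hd)).2.2]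
    exact ((isHomogeneous_X_pow 0 _).mul (isHomogeneous_X_pow 1 _)).C_mul _
  obtain ⟨κ, j, s, hκ, hs⟩ := exists_factorization_of_isHomogeneous hqh hq0
  refine ⟨κ, e 0 % a, e 1 % b + b * j, s, hκ, ?_⟩
  rw [hpq, hs]
  simp only [map_mul, map_pow, aeval_X, algHom_C, ← C_eq_algebraMap, Matrix.cons_val_zero,
      Matrix.cons_val_one, map_multiset_prod, Multiset.map_map, Function.comp_def, map_sub]
  rw [pow_add, pow_mul]
  ring

/-- The extension of a derivation to polynomials that acts coefficientwise. -/
noncomputable def coeffDerivation {K R : Type*} [CommRing K] [CommRing R] [Algebra K R]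
    (d : Derivation K R R) : Derivation K (Polynomial R) (Polynomial R) :=
  (PolynomialModule.equivPolynomialSelf (R := R)).toLinearMap.compDer d.mapCoeffs

theorem coeff_coeffDerivation {K R : Type*} [CommRing K] [CommRing R] [Algebra K R]
    (d : Derivation K R R) (p : Polynomial R) (n : ℕ) :
    (coeffDerivation d p).coeff n = d (p.coeff n) := rfl

theorem natDegree_coeffDerivation_le {K R : Type*} [CommRing K] [CommRing R] [Algebra K R]
    (d : Derivation K R R) (p : Polynomial R) :
    (coeffDerivation d p).natDegree ≤ p.natDegree := by
  refine Polynomial.natDegree_le_iff_coeff_eq_zero.mpr fun n hn ↦ ?_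
  rw [coeff_coeffDerivation, Polynomial.coeff_eq_zero_of_natDegree_lt hn, map_zero]

theorem coeffDerivation_C {K R : Type*} [CommRing K] [CommRing R] [Algebra K R]
    (d : Derivation K R R) (r : R) :
    coeffDerivation d (Polynomial.C r) = Polynomial.C (d r) := by
  ext n
  rw [coeff_coeffDerivation, Polynomial.coeff_C, Polynomial.coeff_C]
  split_ifs <;> simp

/-- If `U` and `V` are coprime, `U ^ (a - 1) * E = V ^ (b - 1) * G ≠ 0` and `E`, `G` have degrees at
most those of `U`, `V`, then `U` and `V` are constant. -/
theorem natDegree_eq_zero_of_mul_pow_eq {L : Type*} [Field L] {U V E G : Polynomial L}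
    {a b : ℕ} (ha : 2 ≤ a) (hb : 2 ≤ b) (hab : a.Coprime b) (hUV : IsCoprime U V)
    (hE : E.natDegree ≤ U.natDegree) (hG : G.natDegree ≤ V.natDegree) (hE0 : E ≠ 0)
    (h : U ^ (a - 1) * E = V ^ (b - 1) * G) : U.natDegree = 0 ∧ V.natDegree = 0 := by
  have hcop : IsCoprime (U ^ (a - 1)) (V ^ (b - 1)) := hUV.pow
  by_cases hU : U = 0
  · subst hU
    refine ⟨Polynomial.natDegree_zero, ?_⟩
    exact Polynomial.natDegree_eq_zero_of_isUnit (isCoprime_zero_left.mp hUV)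
  have hG0 : G ≠ 0 := by
    rintro rfl
    rw [mul_zero] at h
    exact mul_ne_zero (pow_ne_zero _ hU) hE0 h
  have h1 : U ^ (a - 1) ∣ G := hcop.dvd_of_dvd_mul_left ⟨E, h.symm⟩
  have h2 : V ^ (b - 1) ∣ E := hcop.symm.dvd_of_dvd_mul_left ⟨G, h⟩
  have h3 := Polynomial.natDegree_le_of_dvd h1 hG0
  have h4 := Polynomial.natDegree_le_of_dvd h2 hE0
  rw [Polynomial.natDegree_pow] at h3 h4
  obtain ⟨a, rfl⟩ := Nat.exists_eq_add_of_le ha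
  obtain ⟨b, rfl⟩ := Nat.exists_eq_add_of_le hb
  have hne : a ≠ 0 ∨ b ≠ 0 := by
    by_contra! hcon
    rw [hcon.1, hcon.2] at hab
    norm_num at hab
  rw [show 2 + a - 1 = a + 1 by omega] at h3
  rw [show 2 + b - 1 = b + 1 by omega] at h4
  have h5 : (a + 1) * U.natDegree ≤ V.natDegree := h3.trans hG
  have h6 : (b + 1) * V.natDegree ≤ U.natDegree := h4.trans hE
  have : U.natDegree = 0 := by
    rcases hne with hne | hne
    · have : 1 ≤ a := by omega
      nlinarith
    · have : 1 ≤ b := by omega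
      nlinarith
  refine ⟨this, ?_⟩
  rw [this] at h6
  nlinarith

theorem natDegree_eq_zero_of_mul_pow_eq_C {R : Type*} [CommRing R] [IsDomain R]
    {V W : Polynomial R} {n : ℕ} (hn : n ≠ 0) {r : R} (hr : r ≠ 0)
    (h : V ^ n * W = Polynomial.C r) : V.natDegree = 0 := by
  have h1 : V ^ n * W ≠ 0 := by rw [h]; simpa using hr
  have h2 := congrArg Polynomial.natDegree h
  rw [Polynomial.natDegree_mul (left_ne_zero_of_mul h1) (right_ne_zero_of_mul h1),
    Polynomial.natDegree_pow, Polynomial.natDegree_C] at h2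
  simpa [hn] using (Nat.add_eq_zero_iff.mp h2).1

/-- The curve `x ^ a - c y ^ b = x₀ ^ a - c y₀ ^ b` with `(x₀, y₀)` generic has no nonconstant
polynomial parametrization through `(x₀, y₀)`. -/
theorem natDegree_eq_zero_of_pow_sub {K : Type*} [Field K]
    {U V : Polynomial (MvPolynomial (Fin 2) K)} {a b : ℕ} {c : K} (ha : 2 ≤ a) (hb : 2 ≤ b)
    (hab : a.Coprime b) (hc : c ≠ 0) (hU0 : U.coeff 0 = X 0) (hV0 : V.coeff 0 = X 1)
    (h : U ^ a - Polynomial.C (C c) * V ^ b = Polynomial.C (X 0 ^ a - C c * X 1 ^ b)) :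
    U.natDegree = 0 ∧ V.natDegree = 0 := by
  set R := MvPolynomial (Fin 2) K
  have hU : U ≠ 0 := by rintro rfl; exact X_ne_zero (R := K) (0 : Fin 2) hU0.symm
  have hV : V ≠ 0 := by rintro rfl; exact X_ne_zero (R := K) (1 : Fin 2) hV0.symm
  have hdegs : a * U.natDegree = b * V.natDegree := by
    have hW : (Polynomial.C (C c) * V ^ b).natDegree = b * V.natDegree := by
      rw [Polynomial.natDegree_C_mul (by simpa using hc), Polynomial.natDegree_pow]
    rw [← hW, ← Polynomial.natDegree_pow, ← sub_add_cancel (U ^ a) (Polynomial.C (C c) * V ^ b), h,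
      Polynomial.natDegree_C_add]
  suffices hs : U.natDegree = 0 ∨ V.natDegree = 0 by
    rcases hs with hs | hs <;> rw [hs, mul_zero] at hdegs
    · exact ⟨hs, by rcases Nat.mul_eq_zero.mp hdegs.symm with h | h <;> omega⟩
    · exact ⟨by rcases Nat.mul_eq_zero.mp hdegs with h | h <;> omega, hs⟩
  have hd (d : Derivation K R R) :
      (a : Polynomial R) * U ^ (a - 1) * coeffDerivation d U
        - Polynomial.C (C c) * ((b : Polynomial R) * V ^ (b - 1) * coeffDerivation d V) =
      Polynomial.C
        ((a : R) * X 0 ^ (a - 1) * d (X 0) - C c * ((b : R) * X 1 ^ (b - 1) * d (X 1))) := by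
    have := congrArg (coeffDerivation d) h
    rw [coeffDerivation_C, map_sub, map_sub, Derivation.leibniz, Derivation.leibniz,
      Derivation.leibniz_pow, Derivation.leibniz_pow, Derivation.leibniz_pow,
      Derivation.leibniz_pow, coeffDerivation_C,
      show (C c : R) = algebraMap K R c from rfl, Derivation.map_algebraMap] at this
    simp only [smul_eq_mul, nsmul_eq_mul, map_zero, mul_zero, add_zero] at this
    rw [show (C c : R) = algebraMap K R c from rfl, mul_assoc,
      mul_assoc (b : Polynomial R), this]
    congr 1
    ring
  have hnat (n : ℕ) : (n : R) = C (n : K) := by simp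
  have hC0 {k : K} (hk : k ≠ 0) : (C k : R) ≠ 0 := by simpa using hk
  by_cases ha0 : (a : K) = 0
  · have hb0 : (b : K) ≠ 0 := by
      intro hb0
      obtain ⟨x, y, hxy⟩ := (Nat.isCoprime_iff_coprime.mpr hab)
      have := congrArg (Int.cast (R := K)) hxy
      push_cast at this
      simp [ha0, hb0] at this
    right
    have haR : (a : R) = 0 := by rw [hnat, ha0, C_0]
    have haP : (a : Polynomial R) = 0 := by rw [← Polynomial.C_eq_natCast, haR, Polynomial.C_0]
    have := hd (pderiv 1)
    rw [haR, haP, pderiv_X_self] at this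
    refine natDegree_eq_zero_of_mul_pow_eq_C (n := b - 1)
      (W := -Polynomial.C (C c) * (b : Polynomial R) * coeffDerivation (pderiv 1) V)
      (r := - (C c * (C (b : K) * X 1 ^ (b - 1)))) (by omega) ?_ ?_
    · exact neg_ne_zero.mpr (mul_ne_zero (hC0 hc) (mul_ne_zero (hC0 hb0)
        (pow_ne_zero _ (X_ne_zero _))))
    · rw [← hnat]
      convert this using 2 <;> ring
  by_cases hb0 : (b : K) = 0
  · left
    have hbR : (b : R) = 0 := by rw [hnat, hb0, C_0]
    have hbP : (b : Polynomial R) = 0 := by rw [← Polynomial.C_eq_natCast, hbR, Polynomial.C_0]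
    have := hd (pderiv 0)
    rw [hbR, hbP, pderiv_X_self] at this
    refine natDegree_eq_zero_of_mul_pow_eq_C (n := a - 1)
      (W := (a : Polynomial R) * coeffDerivation (pderiv 0) U)
      (r := C (a : K) * X 0 ^ (a - 1)) (by omega) ?_ ?_
    · exact mul_ne_zero (hC0 ha0) (pow_ne_zero _ (X_ne_zero _))
    · rw [← hnat]
      convert this using 2 <;> ring
  -- the derivation annihilating `X 0 ^ a - C c * X 1 ^ b`
  set d : Derivation K R R := mkDerivation K
    ![C c * (C (b : K) * X 1 ^ (b - 1)), C (a : K) * X 0 ^ (a - 1)] with hdef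
  have hd0 : d (X 0) = C c * (C (b : K) * X 1 ^ (b - 1)) := by rw [hdef, mkDerivation_X]; rfl
  have hd1 : d (X 1) = C (a : K) * X 0 ^ (a - 1) := by rw [hdef, mkDerivation_X]; rfl
  have hid := hd d
  rw [hd0, hd1, hnat, hnat, show (C (a : K) * X 0 ^ (a - 1) * (C c * (C (b : K) * X 1 ^ (b - 1)))
    - C c * (C (b : K) * X 1 ^ (b - 1) * (C (a : K) * X 0 ^ (a - 1))) : R) = 0 by ring,
    Polynomial.C_0, sub_eq_zero] at hid
  let L := FractionRing R
  let φ := Polynomial.mapRingHom (algebraMap R L)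
  have hinj : Function.Injective (algebraMap R L) := IsFractionRing.injective R L
  have hdegφ (p : Polynomial R) : (φ p).natDegree = p.natDegree :=
    Polynomial.natDegree_map_eq_of_injective hinj p
  have hφ0 : Function.Injective φ := Polynomial.map_injective _ hinj
  have hr : (X 0 ^ a - C c * X 1 ^ b : R) ≠ 0 := by
    intro h0
    have := congrArg (eval ![1, 0]) h0
    simp [show b ≠ 0 by omega] at this
  have hcop : IsCoprime (φ U) (φ V) := by
    have hunit : IsUnit (φ (Polynomial.C (X 0 ^ a - C c * X 1 ^ b))) := by
      simp only [φ, Polynomial.coe_mapRingHom, Polynomial.map_C]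
      exact Polynomial.isUnit_C.mpr (isUnit_iff_ne_zero.mpr (by
        rw [Ne, map_eq_zero_iff _ hinj]; exact hr))
    obtain ⟨w, hw⟩ := hunit
    have h1 : φ U ^ a - φ (Polynomial.C (C c)) * φ V ^ b = w := by
      rw [hw, ← h, map_sub, map_mul, map_pow, map_pow]
    refine ⟨↑w⁻¹ * φ U ^ (a - 1), - ↑w⁻¹ * φ (Polynomial.C (C c)) * φ V ^ (b - 1), ?_⟩
    have e1 : φ U ^ (a - 1) * φ U = φ U ^ a := by rw [← pow_succ, Nat.sub_add_cancel (by omega)]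
    have e2 : φ V ^ (b - 1) * φ V = φ V ^ b := by rw [← pow_succ, Nat.sub_add_cancel (by omega)]
    have e3 : (↑w⁻¹ * φ U ^ (a - 1)) * φ U + (- ↑w⁻¹ * φ (Polynomial.C (C c)) * φ V ^ (b - 1)) * φ V
        = ↑w⁻¹ * (φ U ^ a - φ (Polynomial.C (C c)) * φ V ^ b) := by
      rw [← e1, ← e2]; ring
    rw [e3, h1, Units.inv_mul]
  left
  rw [← hdegφ]
  refine (natDegree_eq_zero_of_mul_pow_eq (a := a) (b := b)
    (E := φ ((a : Polynomial R) * coeffDerivation d U))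
    (G := φ (Polynomial.C (C c * C (b : K)) * coeffDerivation d V)) ha hb hab hcop
    ?_ ?_ ?_ ?_).1
  · rw [hdegφ, hdegφ, ← Polynomial.C_eq_natCast]
    exact (Polynomial.natDegree_C_mul_le _ _).trans (natDegree_coeffDerivation_le _ _)
  · rw [hdegφ, hdegφ]
    exact (Polynomial.natDegree_C_mul_le _ _).trans (natDegree_coeffDerivation_le _ _)
  · rw [Ne, map_eq_zero_iff _ hφ0]
    intro h0
    have h1 := congrArg (fun p ↦ Polynomial.coeff p 0) h0
    simp only [← Polynomial.C_eq_natCast, Polynomial.coeff_C_mul, coeff_coeffDerivation, hU0, hd0,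
      Polynomial.coeff_zero, hnat] at h1
    exact mul_ne_zero (hC0 ha0) (mul_ne_zero (hC0 hc) (mul_ne_zero (hC0 hb0)
      (pow_ne_zero _ (X_ne_zero _)))) h1
  · rw [← map_pow, ← map_pow, ← map_mul, ← map_mul]
    refine congrArg φ ?_
    rw [← hnat, Polynomial.C_mul, Polynomial.C_eq_natCast]
    calc U ^ (a - 1) * ((a : Polynomial R) * coeffDerivation d U)
        = a * U ^ (a - 1) * coeffDerivation d U := by ring
      _ = _ := by rw [hid]; ring

/-- Setting the extra variable to zero. -/
noncomputable def dropNone {K σ : Type*} [CommRing K] :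
    MvPolynomial (Option σ) K →ₐ[K] MvPolynomial σ K :=
  aeval fun o ↦ o.elim 0 X

theorem dropNone_rename {K σ : Type*} [CommRing K] (p : MvPolynomial σ K) :
    dropNone (rename some p) = p := by
  rw [dropNone, aeval_rename]
  exact aeval_X_left_apply p

theorem coeff_zero_optionEquivLeft {K σ : Type*} [CommRing K] (p : MvPolynomial (Option σ) K) :
    (optionEquivLeft K σ p).coeff 0 = dropNone p := by
  induction p using MvPolynomial.induction_on with
  | C k => rw [optionEquivLeft_C, Polynomial.coeff_C_zero, dropNone, algHom_C]; rfl
  | add p q hp hq => rw [map_add, map_add, Polynomial.coeff_add, hp, hq]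
  | mul_X p o hp =>
    rw [map_mul, map_mul, Polynomial.mul_coeff_zero, hp]
    congr 1
    cases o <;> simp [dropNone]

theorem optionEquivLeft_rename_some {K σ : Type*} [CommRing K] (p : MvPolynomial σ K) :
    optionEquivLeft K σ (rename some p) = Polynomial.C p := by
  induction p using MvPolynomial.induction_on with
  | C k => rw [rename_C, optionEquivLeft_C]
  | add p q hp hq => rw [map_add, map_add, hp, hq, map_add]
  | mul_X p o hp => rw [map_mul, map_mul, hp, rename_X, optionEquivLeft_X_some, map_mul]

theorem natDegree_optionEquivLeft_ne_zero {K σ : Type*} [CommRing K]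
    {p : MvPolynomial (Option σ) K} :
    (optionEquivLeft K σ p).natDegree ≠ 0 ↔ ∃ d, coeff d p ≠ 0 ∧ d none ≠ 0 := by
  rw [natDegree_optionEquivLeft, degreeOf_eq_sup, ← Nat.bot_eq_zero, Ne, Finset.sup_eq_bot_iff]
  simp only [mem_support_iff, not_forall, exists_prop]

theorem weight_option {σ : Type*} [Fintype σ] (s : ℚ) (W : σ → ℚ) (d : Option σ →₀ ℕ) :
    Finsupp.weight (fun o : Option σ ↦ o.elim s W) d = d none * s + Finsupp.weight W d.some := by
  rw [Finsupp.weight_apply, Finsupp.weight_apply, Finsupp.sum_fintype _ _ (by simp),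
    Finsupp.sum_fintype _ _ (by simp), Fintype.sum_option]
  simp

/-- For a substitution `F` that deforms the identity, the leading forms of the `F k`, with respect
to a suitable weight of the deformation parameter, are again a nontrivial deformation of the
identity, and they fix the leading forms of the polynomials fixed by `F`. -/
theorem exists_leading_deformation {K σ : Type*} [CommRing K] [Fintype σ]
    (W : σ → ℚ) {F : σ → MvPolynomial (Option σ) K} (hF : ∀ k, dropNone (F k) = X k)
    (hne : ∃ k, (optionEquivLeft K σ (F k)).natDegree ≠ 0) :
    ∃ G : σ → MvPolynomial (Option σ) K, (∀ k, dropNone (G k) = X k) ∧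
      (∃ k, (optionEquivLeft K σ (G k)).natDegree ≠ 0) ∧
      ∀ p D, WeightLE W D p → aeval F p = rename some p →
        aeval G (weightedHomogeneousComponent W D p) =
          rename some (weightedHomogeneousComponent W D p) := by
  classical
  let T : Finset (Σ _ : σ, Option σ →₀ ℕ) :=
    Finset.univ.sigma fun k ↦ (F k).support.filter fun d ↦ d none ≠ 0
  have hT : ∀ k d, (⟨k, d⟩ : Σ _ : σ, Option σ →₀ ℕ) ∈ T ↔ coeff d (F k) ≠ 0 ∧ d none ≠ 0 := by
    intro k d
    simp [T]
  have hTne : T.Nonempty := by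
    obtain ⟨k, hk⟩ := hne
    obtain ⟨d, hd⟩ := natDegree_optionEquivLeft_ne_zero.mp hk
    exact ⟨⟨k, d⟩, (hT k d).mpr hd⟩
  obtain ⟨⟨k₀, d₀⟩, hmem, hmin⟩ := T.exists_min_image
    (fun x ↦ (W x.1 - Finsupp.weight W x.2.some) / x.2 none) hTne
  obtain ⟨hc₀, hd₀⟩ := (hT _ _).mp hmem
  set s : ℚ := (W k₀ - Finsupp.weight W d₀.some) / d₀ none with hs
  let w : Option σ → ℚ := fun o ↦ o.elim s W
  have hle : ∀ k, WeightLE w (W k) (F k) := by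
    intro k d hd
    rw [weight_option]
    by_cases h : d none = 0
    · rw [← optionEquivLeft_coeff_some_coeff_none, h, coeff_zero_optionEquivLeft, hF,
        coeff_X, ite_ne_right_iff] at hd
      rw [h, ← hd.1]
      simp [Finsupp.weight_apply]
    · have h1 : s ≤ (W k - Finsupp.weight W d.some) / d none := hmin ⟨k, d⟩ ((hT k d).mpr ⟨hd, h⟩)
      rw [le_div_iff₀ (by positivity)] at h1
      linarith
  have hdrop : ∀ o : Option σ, WeightLE W (w o) (o.elim 0 X : MvPolynomial σ K) ∧
      weightedHomogeneousComponent W (w o) (o.elim 0 X : MvPolynomial σ K) = o.elim 0 X := by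
    rintro (_ | k)
    · exact ⟨fun d hd ↦ absurd (coeff_zero d) hd, map_zero _⟩
    · exact ⟨weightLE_X W k, component_X W k⟩
  refine ⟨fun k ↦ weightedHomogeneousComponent w (W k) (F k), fun k ↦ ?_, ⟨k₀, ?_⟩, ?_⟩
  · have h1 := (hle k).component_aeval fun o ↦ (hdrop o).1
    simp only [(hdrop _).2] at h1
    change weightedHomogeneousComponent W (W k) (dropNone (F k)) = dropNone _ at h1
    rw [← h1, hF, component_X]
  · refine natDegree_optionEquivLeft_ne_zero.mpr ⟨d₀, ?_, hd₀⟩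
    rw [coeff_weightedHomogeneousComponent, if_pos]
    · exact hc₀
    · rw [weight_option, hs]
      field_simp
      ring
  · intro p D hp hfix
    have h1 := hp.component_aeval hle
    have h2 := hp.component_aeval fun i ↦ weightLE_X (K := K) w (some i)
    have h3 := fun i ↦ component_X (K := K) w (some i)
    simp only [w, Option.elim_some] at h2 h3
    simp only [h3] at h2
    rw [← h1, hfix, rename_eq_aeval]
    exact h2

theorem exists_component_ne_zero {K σ : Type*} [CommRing K] (w : σ → ℚ) {p : MvPolynomial σ K}
    (hp : p ≠ 0) : ∃ D, WeightLE w D p ∧ weightedHomogeneousComponent w D p ≠ 0 := by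
  classical
  obtain ⟨d, hd, hmax⟩ :=
    p.support.exists_max_image (Finsupp.weight w) (support_nonempty.mpr hp)
  refine ⟨Finsupp.weight w d, fun x hx ↦ hmax x (mem_support_iff.mpr hx), fun h ↦ ?_⟩
  have h1 := congrArg (coeff d) h
  rw [coeff_weightedHomogeneousComponent, if_pos rfl] at h1
  exact mem_support_iff.mp hd h1

theorem weight_one {σ : Type*} (d : σ →₀ ℕ) :
    Finsupp.weight (fun _ ↦ (1 : ℚ)) d = (d.degree : ℕ) := by
  rw [Finsupp.weight_apply, Finsupp.degree_apply]
  simp [Finsupp.sum]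

theorem weightLE_totalDegree {K σ : Type*} [CommRing K] (p : MvPolynomial σ K) :
    WeightLE (fun _ ↦ (1 : ℚ)) p.totalDegree p := by
  intro d hd
  rw [weight_one]
  exact_mod_cast le_totalDegree (mem_support_iff.mpr hd)

theorem totalDegree_lt_of_component_eq_zero {K σ : Type*} [CommRing K] {p : MvPolynomial σ K}
    {n : ℕ} (hn : 0 < n) (hp : WeightLE (fun _ ↦ (1 : ℚ)) n p)
    (h0 : weightedHomogeneousComponent (fun _ ↦ (1 : ℚ)) n p = 0) : p.totalDegree < n := by
  classical
  refine (Finset.sup_lt_iff hn).mpr fun d hd ↦ ?_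
  have h1 := hp d (mem_support_iff.mp hd)
  have h2 := congrArg (coeff d) h0
  rw [coeff_weightedHomogeneousComponent, coeff_zero, ite_eq_right_iff] at h2
  rw [weight_one] at h1 h2
  refine lt_of_le_of_ne (by exact_mod_cast h1) fun h ↦ mem_support_iff.mp hd (h2 ?_)
  exact_mod_cast h

theorem component_totalDegree_ne_zero {K σ : Type*} [CommRing K] {p : MvPolynomial σ K}
    (h : 0 < p.totalDegree) :
    weightedHomogeneousComponent (fun _ ↦ (1 : ℚ)) p.totalDegree p ≠ 0 :=
  fun h0 ↦ (totalDegree_lt_of_component_eq_zero h (weightLE_totalDegree p) h0).false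

/-- Conjugating the translations in all directions but the `j`-th by an automorphism gives, on the
level of leading forms, a nontrivial deformation of the identity that fixes the leading form of the
`j`-th coordinate of the inverse. -/
theorem exists_deformation_fixing {K σ : Type*} [Field K] [Fintype σ] [Nontrivial σ]
    (e : MvPolynomial σ K ≃ₐ[K] MvPolynomial σ K) (W : σ → ℚ) (j : σ) :
    ∃ G : σ → MvPolynomial (Option σ) K, (∀ k, dropNone (G k) = X k) ∧
      (∃ k, (optionEquivLeft K σ (G k)).natDegree ≠ 0) ∧
      ∀ D, WeightLE W D (e.symm (X j)) →
        aeval G (weightedHomogeneousComponent W D (e.symm (X j))) =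
          rename some (weightedHomogeneousComponent W D (e.symm (X j))) := by
  classical
  let shift : σ → MvPolynomial (Option σ) K := fun l ↦
    rename some (e.symm (X l)) + if l = j then 0 else X none
  have hcomp : aeval (fun k ↦ aeval shift (e (X k))) = (aeval shift).comp e.toAlgHom := by
    ext k : 1
    simp
  have happ : ∀ l, aeval (fun k ↦ aeval shift (e (X k))) (e.symm (X l)) = shift l := by
    intro l
    rw [hcomp]
    simp
  have hF : ∀ k, dropNone (aeval shift (e (X k))) = X k := by
    intro k
    have h : dropNone.comp (aeval shift) = e.symm.toAlgHom := by
      ext l : 1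
      simp only [AlgHom.comp_apply, aeval_X, shift, map_add, dropNone_rename]
      split_ifs <;> simp [dropNone]
    rw [← AlgHom.comp_apply, h]
    simp
  have hne : ∃ k, (optionEquivLeft K σ (aeval shift (e (X k)))).natDegree ≠ 0 := by
    by_contra! h
    obtain ⟨l, hl⟩ := exists_ne j
    have h1 : (fun k ↦ aeval shift (e (X k))) = fun k ↦ rename some (X k) := by
      funext k
      apply (optionEquivLeft K σ).injective
      rw [Polynomial.eq_C_of_natDegree_eq_zero (h k), coeff_zero_optionEquivLeft, hF,
        optionEquivLeft_rename_some]
    have h2 := happ l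
    have h3 : aeval (fun k ↦ rename some (X k : MvPolynomial σ K)) =
        rename (R := K) (some : σ → Option σ) := by
      ext k : 1
      simp
    rw [h1, h3] at h2
    simp [shift, hl] at h2
  obtain ⟨G, h1, h2, h3⟩ := exists_leading_deformation W hF hne
  refine ⟨G, h1, h2, fun D hD ↦ h3 _ _ hD ?_⟩
  rw [happ]
  simp [shift]

/-- A polynomial fixed by a nontrivial deformation of the identity of the plane has no divisor of
the form `x ^ a - c y ^ b` with `a` and `b` coprime and at least two. -/
theorem not_two_le_of_dvd_of_fixed {K : Type*} [Field K]
    {G : Fin 2 → MvPolynomial (Option (Fin 2)) K} (hG : ∀ k, dropNone (G k) = X k)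
    (hne : ∃ k, (optionEquivLeft K (Fin 2) (G k)).natDegree ≠ 0)
    {p : MvPolynomial (Fin 2) K} (hp : p ≠ 0) (hfix : aeval G p = rename some p)
    {a b : ℕ} (hab : a.Coprime b) {c : K} (hc : c ≠ 0)
    (hdvd : X 0 ^ a - C c * X 1 ^ b ∣ p) : ¬ (2 ≤ a ∧ 2 ≤ b) := by
  rintro ⟨ha, hb⟩
  set Φ : MvPolynomial (Fin 2) K →ₐ[K] Polynomial (MvPolynomial (Fin 2) K) :=
    (optionEquivLeft K (Fin 2)).toAlgHom.comp (aeval G) with hΦ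
  have hΦX : ∀ k, Φ (X k) = optionEquivLeft K (Fin 2) (G k) := fun k ↦ by simp [hΦ]
  have hΦC : Φ (C c) = Polynomial.C (C c) := by
    rw [algHom_C]; rfl
  have hΦp : Φ p = Polynomial.C p := by
    rw [hΦ, AlgHom.comp_apply, hfix]
    exact optionEquivLeft_rename_some p
  have h1 : Φ (X 0 ^ a - C c * X 1 ^ b) ∣ Polynomial.C p := hΦp ▸ map_dvd Φ hdvd
  have h2 : (Φ (X 0 ^ a - C c * X 1 ^ b)).natDegree = 0 := by
    have := Polynomial.natDegree_le_of_dvd h1 (by simpa using hp)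
    simpa using this
  have h3 := Polynomial.eq_C_of_natDegree_eq_zero h2
  have hcoeff : ∀ k, (optionEquivLeft K (Fin 2) (G k)).coeff 0 = X k := fun k ↦ by
    rw [coeff_zero_optionEquivLeft, hG]
  simp only [map_sub, map_mul, map_pow, hΦX, hΦC] at h3
  have h4 := natDegree_eq_zero_of_pow_sub ha hb hab hc (hcoeff 0) (hcoeff 1) (by
    rw [h3]
    simp [Polynomial.coeff_zero_eq_eval_zero, ← hcoeff])
  obtain ⟨k, hk⟩ := hne
  fin_cases k
  · exact hk h4.1
  · exact hk h4.2

theorem exists_one_lt_weight {K : Type*} [Field K]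
    (e : MvPolynomial (Fin 2) K ≃ₐ[K] MvPolynomial (Fin 2) K) {W : Fin 2 → ℚ} (h0 : 0 ≤ W 0)
    (h1 : 1 < W 1) : ∃ j D, 1 < D ∧ WeightLE W D (e.symm (X j)) ∧
      weightedHomogeneousComponent W D (e.symm (X j)) ≠ 0 := by
  by_contra! h
  have hX : ∀ j, pderiv 1 (e.symm (X j)) = 0 := by
    intro j
    obtain ⟨D, hD, hD0⟩ := exists_component_ne_zero W
      (p := e.symm (X j : MvPolynomial (Fin 2) K)) (by simp)
    have hD1 : D ≤ 1 := by
      by_contra! hD1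
      exact hD0 (h j D hD1 hD)
    refine pderiv_eq_zero_of_notMem_vars fun hv ↦ ?_
    obtain ⟨d, hd, hd1⟩ := (mem_vars_iff_mem_support 1).mp hv
    have h2 := hD d (mem_support_iff.mp hd)
    rw [Finsupp.weight_apply, Finsupp.sum_fintype _ _ (by simp), Fin.sum_univ_two, nsmul_eq_mul,
      nsmul_eq_mul] at h2
    have h3 : (1 : ℚ) ≤ d 1 := by
      exact_mod_cast Nat.one_le_iff_ne_zero.mpr (Finsupp.mem_support_iff.mp hd1)
    have h4 : 0 ≤ (d 0 : ℚ) * W 0 := by positivity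
    nlinarith
  have hall : ∀ r, pderiv 1 (e.symm r) = 0 := by
    intro r
    induction r using MvPolynomial.induction_on with
    | C k => rw [← algebraMap_eq, AlgEquiv.commutes, algebraMap_eq, pderiv_C]
    | add p q hp hq => rw [map_add, map_add, hp, hq, add_zero]
    | mul_X p i hp => rw [map_mul, Derivation.leibniz, hp, hX, smul_zero, smul_zero, add_zero]
  have h5 := hall (e (X 1))
  rw [AlgEquiv.symm_apply_apply, pderiv_X_self] at h5
  exact one_ne_zero h5

theorem totalDegree_pos_of_bijective {K : Type*} [Field K] {σ : Type*} {F : σ → MvPolynomial σ K}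
    (hF : Function.Bijective (aeval (R := K) F)) (i : σ) : 0 < (F i).totalDegree := by
  rw [Nat.pos_iff_ne_zero]
  intro h
  have h1 := totalDegree_eq_zero_iff_eq_C.mp h
  have h2 : (X i : MvPolynomial σ K) = C (coeff 0 (F i)) :=
    hF.1 (by rw [aeval_X, algHom_C]; exact h1)
  have h3 := congrArg totalDegree h2
  simp at h3

/-- In a pair of polynomials that generates the polynomial ring in two variables, the leading form
of the one of larger degree is a multiple of a power of the leading form of the other. -/
theorem exists_elementary_reduction {K : Type*} [Field K] [IsAlgClosed K]
    {f g : MvPolynomial (Fin 2) K}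
    (hbij : Function.Bijective (aeval (R := K) (S₁ := MvPolynomial (Fin 2) K) ![f, g]))
    (hle : f.totalDegree ≤ g.totalDegree) (hg : 1 < g.totalDegree) :
    f.totalDegree ∣ g.totalDegree ∧
      ∃ (c : K) (a : ℕ), (g - C c * f ^ a).totalDegree < g.totalDegree := by
  have hf : 0 < f.totalDegree := totalDegree_pos_of_bijective hbij 0
  have hg0 : 0 < g.totalDegree := by lia
  set w : Fin 2 → ℚ := fun _ ↦ 1 with hw
  set W : Fin 2 → ℚ := fun i ↦ (![f, g] i).totalDegree with hW
  have hfw : WeightLE w f.totalDegree f := weightLE_totalDegree f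
  have hgw : WeightLE w g.totalDegree g := weightLE_totalDegree g
  have hf' := component_totalDegree_ne_zero hf
  rw [← hw] at hf'
  set f' := weightedHomogeneousComponent w (f.totalDegree : ℚ) f with hfeq
  set g' := weightedHomogeneousComponent w (g.totalDegree : ℚ) g with hgeq
  have hg' : g' ≠ 0 := component_totalDegree_ne_zero hg0
  let e := AlgEquiv.ofBijective _ hbij
  obtain ⟨j, D, hD1, hD, hp⟩ := exists_one_lt_weight e (W := W) (Nat.cast_nonneg _)
    (Nat.one_lt_cast.mpr hg)
  obtain ⟨G, hG, hne, hfix⟩ := exists_deformation_fixing e W j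
  set p := weightedHomogeneousComponent W D (e.symm (X j)) with hp_def
  have hker : aeval ![f', g'] p = 0 := by
    have h1 := hD.component_aeval (w' := w) (F := ![f, g]) fun i ↦ weightLE_totalDegree _
    have h2 : aeval ![f, g] (e.symm (X j)) = X j := e.apply_symm_apply (X j)
    rw [h2, (weightLE_X w j).component_eq_zero hD1] at h1
    rw [h1, ← hp_def]
    congr 2
    funext i
    fin_cases i <;> rfl
  obtain ⟨b, a, hba, hb, ha⟩ := Nat.exists_coprime f.totalDegree g.totalDegree
  set d := f.totalDegree.gcd g.totalDegree
  have hd : 0 < d := Nat.gcd_pos_of_pos_left _ hf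
  have hb0 : 0 < b := Nat.pos_of_mul_pos_right (hb ▸ hf)
  have ha0 : 0 < a := Nat.pos_of_mul_pos_right (ha ▸ hg0)
  have hweight : ∀ x, coeff x p ≠ 0 → ((d * (b * x 0 + a * x 1) : ℕ) : ℚ) = D := by
    intro x hx
    rw [← weightedHomogeneousComponent_isWeightedHomogeneous D (w := W) _ hx,
      Finsupp.weight_apply, Finsupp.sum_fintype _ _ (by simp), Fin.sum_univ_two]
    simp only [hW, Matrix.cons_val_zero, Matrix.cons_val_one, nsmul_eq_mul]
    rw [hb, ha]
    push_cast
    ring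
  obtain ⟨x₀, hx₀⟩ := ne_zero_iff.mp hp
  obtain ⟨κ, i, k, s, hκ, hfac⟩ := exists_factorization_of_weighted hp ha0 hb0 hba.symm
    (D := b * x₀ 0 + a * x₀ 1) fun x hx ↦ by
      have h := (hweight x hx).trans (hweight x₀ hx₀).symm
      exact Nat.eq_of_mul_eq_mul_left hd (by exact_mod_cast h)
  have hzero : ∃ c ∈ s, f' ^ a - C c * g' ^ b = 0 := by
    rw [hfac] at hker
    simp only [map_mul, map_pow, aeval_X, algHom_C, algebraMap_eq, map_multiset_prod,
      Multiset.map_map, mul_eq_zero, Multiset.prod_eq_zero_iff, Multiset.mem_map] at hker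
    rcases hker with ((h | h) | h) | ⟨c, hc, h⟩
    · exact absurd (C_eq_zero.mp h) hκ
    · exact absurd (eq_zero_of_pow_eq_zero h) hf'
    · exact absurd (eq_zero_of_pow_eq_zero h) hg'
    · exact ⟨c, hc, by simpa using h⟩
  obtain ⟨c, hcs, hc⟩ := hzero
  have hc0 : c ≠ 0 := by
    rintro rfl
    simp [hf'] at hc
  have hdvd : X 0 ^ a - C c * X 1 ^ b ∣ p := by
    rw [hfac]
    exact (Multiset.dvd_prod (Multiset.mem_map_of_mem _ hcs)).mul_left _
  have hsmall := not_two_le_of_dvd_of_fixed hG hne hp (hfix D hD) hba.symm hc0 hdvd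
  have hba' : b ≤ a := by
    rw [hb, ha] at hle
    exact Nat.le_of_mul_le_mul_right hle hd
  obtain rfl : b = 1 := by lia
  have hgf : g.totalDegree = a * f.totalDegree := by rw [ha, hb, one_mul]
  refine ⟨⟨a, by rw [hgf, mul_comm]⟩, c⁻¹, a, ?_⟩
  have hpow := hfw.pow a
  have hcast : a • (f.totalDegree : ℚ) = g.totalDegree := by rw [hgf]; simp
  rw [hcast] at hpow
  refine totalDegree_lt_of_component_eq_zero hg0 (fun x hx ↦ ?_) ?_
  · rw [coeff_sub, coeff_C_mul] at hx
    by_cases h : coeff x g = 0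
    · refine hpow.1 x fun h' ↦ hx ?_
      rw [h, h', mul_zero, sub_zero]
    · exact hgw x h
  · change weightedHomogeneousComponent w _ _ = 0
    rw [map_sub, weightedHomogeneousComponent_C_mul, hpow.2, ← hgeq, ← hfeq,
      sub_eq_zero.mp hc, pow_one, ← mul_assoc, ← C_mul, inv_mul_cancel₀ hc0, C_1, one_mul, sub_self]

theorem bijective_aeval_swap {K : Type*} [Field K] {f g : MvPolynomial (Fin 2) K}
    (h : Function.Bijective (aeval (R := K) (S₁ := MvPolynomial (Fin 2) K) ![f, g])) :
    Function.Bijective (aeval (R := K) (S₁ := MvPolynomial (Fin 2) K) ![g, f]) := by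
  have h1 : aeval (R := K) ![g, f] =
      (aeval (R := K) ![f, g]).comp (renameEquiv K (Equiv.swap (0 : Fin 2) 1)).toAlgHom := by
    ext i : 1
    fin_cases i <;> simp
  rw [h1, AlgHom.coe_comp]
  exact h.comp (renameEquiv K (Equiv.swap (0 : Fin 2) 1)).bijective

theorem bijective_aeval_sub_mul_pow {K : Type*} [Field K] {f g : MvPolynomial (Fin 2) K}
    (h : Function.Bijective (aeval (R := K) (S₁ := MvPolynomial (Fin 2) K) ![f, g]))
    (c : K) (a : ℕ) :
    Function.Bijective
      (aeval (R := K) (S₁ := MvPolynomial (Fin 2) K) ![f, g - C c * f ^ a]) := by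
  let E : K → MvPolynomial (Fin 2) K →ₐ[K] MvPolynomial (Fin 2) K := fun k ↦
    aeval ![X 0, X 1 - C k * X 0 ^ a]
  have hE : ∀ k, (E k).comp (E (-k)) = AlgHom.id K _ := by
    intro k
    ext i : 1
    fin_cases i <;> simp [E, algHom_C]
  have h1 : aeval (R := K) ![f, g - C c * f ^ a] = (aeval (R := K) ![f, g]).comp (E c) := by
    ext i : 1
    fin_cases i <;> simp [E, algHom_C]
  have h2 : Function.Bijective (E c) := by
    refine (AlgEquiv.ofAlgHom (E c) (E (-c)) (hE c) ?_).bijective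
    simpa using hE (-c)
  rw [h1, AlgHom.coe_comp]
  exact h.comp h2

/-- A component of a polynomial automorphism of the plane of degree greater than one has a mate of
smaller degree. -/
theorem exists_mate_lt {K : Type*} [Field K] [IsAlgClosed K] {f : MvPolynomial (Fin 2) K}
    (hf : 1 < f.totalDegree)
    (hauto : ∃ g, Function.Bijective
      (aeval (R := K) (S₁ := MvPolynomial (Fin 2) K) ![g, f])) :
    ∃ g, Function.Bijective (aeval (R := K) (S₁ := MvPolynomial (Fin 2) K) ![g, f]) ∧
      g.totalDegree < f.totalDegree ∧ g.totalDegree ∣ f.totalDegree := by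
  obtain ⟨g, hg, hmin⟩ := WellFounded.has_min (measure totalDegree).wf
    {g | Function.Bijective (aeval (R := K) (S₁ := MvPolynomial (Fin 2) K) ![g, f])} hauto
  have hlt : g.totalDegree < f.totalDegree := by
    by_contra! hle
    obtain ⟨-, c, a, hlt⟩ := exists_elementary_reduction (bijective_aeval_swap hg) hle (by lia)
    exact hmin _ (bijective_aeval_swap
      (bijective_aeval_sub_mul_pow (bijective_aeval_swap hg) c a)) hlt
  exact ⟨g, hg, hlt, (exists_elementary_reduction hg hlt.le hf).1⟩

/-- If `f` has degree `n > 1` and `(g, f)` is a polynomial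
automorphism of `K²` for some `g`, then there is a chain
`f 1, ..., f (h+1) = f` with `deg f 1 = 1`, `deg f k < deg f (k+1)`,
`deg f k ∣ deg f (k+1)`, and `(f k, f (k+1))` a polynomial automorphism. -/
theorem stmt_10 {K : Type*} [Field K] [IsAlgClosed K]
    (f : MvPolynomial (Fin 2) K) (hdeg : 1 < f.totalDegree)
    (hauto : ∃ g : MvPolynomial (Fin 2) K, Function.Bijective
      (MvPolynomial.aeval (R := K) (S₁ := MvPolynomial (Fin 2) K) ![g, f])) :
    ∃ (h : ℕ) (F : ℕ → MvPolynomial (Fin 2) K), 1 ≤ h ∧ F (h + 1) = f ∧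
      (F 1).totalDegree = 1 ∧
      (∀ k, 1 ≤ k → k ≤ h →
        (F k).totalDegree < (F (k + 1)).totalDegree ∧
        (F k).totalDegree ∣ (F (k + 1)).totalDegree ∧
        Function.Bijective
          (MvPolynomial.aeval (R := K) (S₁ := MvPolynomial (Fin 2) K)
            ![F k, F (k + 1)])) := by
  induction hn : f.totalDegree using Nat.strong_induction_on generalizing f with
  | _ n ih =>
    obtain ⟨g, hbij, hlt, hdvd⟩ := exists_mate_lt hdeg hauto
    have hg0 : 0 < g.totalDegree := totalDegree_pos_of_bijective hbij 0
    obtain hg1 | hg1 : g.totalDegree = 1 ∨ 1 < g.totalDegree := by lia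
    · refine ⟨1, fun k ↦ if k = 1 then g else f, le_rfl, rfl, hg1, fun k hk1 hk2 ↦ ?_⟩
      obtain rfl : k = 1 := le_antisymm hk2 hk1
      exact ⟨hlt, hdvd, hbij⟩
    · obtain ⟨h, F, hh, hFg, hF1, hF⟩ :=
        ih _ (hn ▸ hlt) g hg1 ⟨f, bijective_aeval_swap hbij⟩ rfl
      refine ⟨h + 1, fun k ↦ if k ≤ h + 1 then F k else f, by lia, by simp, by simpa using hF1,
        fun k hk1 hk2 ↦ ?_⟩
      obtain hk | rfl : k ≤ h ∨ k = h + 1 := by lia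
      · simpa [hk, hk2] using hF k hk1 hk
      · simpa [hFg] using ⟨hlt, hdvd, hbij⟩
end

section
/- Let K be a field, h ≥ 1, and let n_1, ..., n_h be integers greater than 1. Define polynomials in K[x, y] by f_1 = y, f_2 = y^{n_1} − x, and f_{k+1} = f_k^{n_k} − f_{k−1} for 2 ≤ k ≤ h. Then for every 1 ≤ k ≤ h the pair (f_k, f_{k+1}) is a polynomial automorphism of K². -/
open MvPolynomial

/-- The Hénon map `(x, y) ↦ (y, y ^ m - x)` is a polynomial automorphism of the plane. -/
theorem bijective_aeval_henon (R : Type*) [CommRing R] (m : ℕ) :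
    Function.Bijective
      (aeval (R := R) (S₁ := MvPolynomial (Fin 2) R) ![X 1, X 1 ^ m - X 0]) := by
  refine Function.bijective_iff_has_inverse.mpr
    ⟨aeval (R := R) ![X 0 ^ m - X 1, X 0], fun p => ?_, fun p => ?_⟩
  · rw [← AlgHom.comp_apply]
    refine DFunLike.congr_fun (g := AlgHom.id R _) (algHom_ext fun i => ?_) p
    fin_cases i <;> simp
  · rw [← AlgHom.comp_apply]
    refine DFunLike.congr_fun (g := AlgHom.id R _) (algHom_ext fun i => ?_) p
    fin_cases i <;> simp

/-- Automorphisms of the plane are stable under `(a, b) ↦ (b, b ^ m - a)`. -/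
theorem bijective_aeval_pow_sub {R : Type*} [CommRing R] {a b : MvPolynomial (Fin 2) R}
    (hab : Function.Bijective (aeval (R := R) ![a, b])) (m : ℕ) :
    Function.Bijective (aeval (R := R) ![b, b ^ m - a]) := by
  have hcomp : aeval (R := R) ![b, b ^ m - a] =
      (aeval ![a, b]).comp (aeval ![X 1, X 1 ^ m - X 0]) := by
    refine algHom_ext fun i => ?_
    fin_cases i <;> simp
  rw [hcomp, AlgHom.coe_comp]
  exact hab.comp (bijective_aeval_henon R m)

/-- For `f 1 = y`, `f 2 = y ^ n 1 - x`,
`f (k+1) = f k ^ n k - f (k-1)` (`2 ≤ k ≤ h`, all `n k > 1`), every pair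
`(f k, f (k+1))`, `1 ≤ k ≤ h`, is a polynomial automorphism of `K²`. -/
theorem stmt_11 {K : Type*} [Field K] (h : ℕ) (hh : 1 ≤ h) (n : ℕ → ℕ)
    (hn : ∀ k, 1 ≤ k → k ≤ h → 1 < n k)
    (f : ℕ → MvPolynomial (Fin 2) K)
    (hf1 : f 1 = MvPolynomial.X 1)
    (hf2 : f 2 = MvPolynomial.X 1 ^ n 1 - MvPolynomial.X 0)
    (hfk : ∀ k, 2 ≤ k → k ≤ h → f (k + 1) = f k ^ n k - f (k - 1)) :
    ∀ k, 1 ≤ k → k ≤ h →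
      Function.Bijective
        (MvPolynomial.aeval (R := K) (S₁ := MvPolynomial (Fin 2) K)
          ![f k, f (k + 1)]) := by
  intro k hk
  induction k, hk using Nat.le_induction with
  | base =>
    intro _
    rw [hf1, hf2]
    exact bijective_aeval_henon K (n 1)
  | succ k hk ih =>
    intro hkh
    rw [hfk (k + 1) (by omega) hkh, Nat.add_sub_cancel]
    exact bijective_aeval_pow_sub (ih (by omega)) (n (k + 1))
end

section
/- (Nagata's example) Let K be a field of characteristic p > 0 and let a ≥ 1 be an integer. Set x(t) = t^{p²} and y(t) = t + t^{ap} in K[t]. Then, for the polynomials f(x, y) = (y^p − x^a)^p − x and g(x, y) = y − (y^p − x^a)^a, one has the identities f(x(t), y(t)) = 0 and g(x(t), y(t)) = t in K[t]. -/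
open MvPolynomial

/-- **Nagata's example.** Over a field `K` of characteristic `p > 0`,
with `x(t) = t^(p²)`, `y(t) = t + t^(ap)`, the polynomials
`f(x,y) = (y^p - x^a)^p - x` and `g(x,y) = y - (y^p - x^a)^a` satisfy
`f(x(t), y(t)) = 0` and `g(x(t), y(t)) = t` in `K[t]`. -/
theorem stmt_13 {K : Type*} [Field K] (p : ℕ) (hp : 0 < p) [CharP K p]
    (a : ℕ) (ha : 1 ≤ a) :
    (MvPolynomial.aeval (R := K) (S₁ := Polynomial K)
        ![Polynomial.X ^ (p ^ 2), Polynomial.X + Polynomial.X ^ (a * p)]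
        ((MvPolynomial.X 1 ^ p - MvPolynomial.X 0 ^ a) ^ p - MvPolynomial.X 0) = 0) ∧
    (MvPolynomial.aeval (R := K) (S₁ := Polynomial K)
        ![Polynomial.X ^ (p ^ 2), Polynomial.X + Polynomial.X ^ (a * p)]
        (MvPolynomial.X 1 - (MvPolynomial.X 1 ^ p - MvPolynomial.X 0 ^ a) ^ a)
      = Polynomial.X) := by
  have : Fact p.Prime := ⟨(CharP.char_is_prime_or_zero K p).resolve_right hp.ne'⟩
  have key : ((Polynomial.X + Polynomial.X ^ (a * p)) ^ p - (Polynomial.X ^ (p ^ 2)) ^ a :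
      Polynomial K) = Polynomial.X ^ p := by
    rw [add_pow_char]
    ring
  constructor
  · simp only [map_sub, map_pow, aeval_X, Matrix.cons_val_zero, Matrix.cons_val_one, key]
    ring
  · simp only [map_sub, map_pow, aeval_X, Matrix.cons_val_zero, Matrix.cons_val_one, key]
    ring
end
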